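/- Let q ≥ 7 be a prime power and let G be a finite group having a normal subgroup S isomorphic to PSL_2(q) whose centralizer in G is trivial (so that G is almost simple with socle isomorphic to PSL_2(q)). If G satisfies the two-prime hypothesis, then |cd(G)| ≤ 6. -/

import Mathlib

open CategoryTheory

/-- The set of degrees of the complex irreducible characters of `G`. -/
def charDegrees (G : Type) [Group G] : Set ℕ :=
  {n | ∃ V : FDRep ℂ G, Simple V ∧ Module.finrank ℂ V = n}

/-- `G` satisfies the two-prime hypothesis: for any distinct irreducible character degrees
`a`, `b`, the gcd `gcd a b` has at most two prime divisors counted with multiplicity. -/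
def TwoPrimeHypothesis (G : Type) [Group G] : Prop :=
  ∀ a ∈ charDegrees G, ∀ b ∈ charDegrees G, a ≠ b →
    (Nat.gcd a b).primeFactorsList.length ≤ 2

/-- `PSL₂(F)`: the quotient of `SL₂(F)` by its center. -/
abbrev PSL2 (F : Type) [Field F] : Type :=
  Matrix.SpecialLinearGroup (Fin 2) F ⧸
    Subgroup.center (Matrix.SpecialLinearGroup (Fin 2) F)


/-- own irreducibility predicate -/
def Irr {G V : Type} [Group G] [AddCommGroup V] [Module ℂ V] (ρ : G →* (V →ₗ[ℂ] V)) : Prop :=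
  (∃ v : V, v ≠ 0) ∧ ∀ p : Submodule ℂ V, (∀ g, ∀ v ∈ p, ρ g v ∈ p) → p = ⊥ ∨ p = ⊤

/-- isomorphism of representations -/
def RIso {G V W : Type} [Group G] [AddCommGroup V] [Module ℂ V] [AddCommGroup W] [Module ℂ W]
    (ρ : G →* (V →ₗ[ℂ] V)) (σ : G →* (W →ₗ[ℂ] W)) : Prop :=
  ∃ e : V ≃ₗ[ℂ] W, ∀ g v, e (ρ g v) = σ g (e v)

/-- restriction of a representation to an invariant submodule -/
def subRep {G V : Type} [Group G] [AddCommGroup V] [Module ℂ V] (ρ : G →* (V →ₗ[ℂ] V))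
    (p : Submodule ℂ V) (hp : ∀ g, ∀ v ∈ p, ρ g v ∈ p) : G →* (p →ₗ[ℂ] p) where
  toFun g := (ρ g).restrict (hp g)
  map_one' := by ext v; simp
  map_mul' g h := by ext v; simp

theorem subRep_coe {G V : Type} [Group G] [AddCommGroup V] [Module ℂ V] (ρ : G →* (V →ₗ[ℂ] V))
    (p : Submodule ℂ V) (hp : ∀ g, ∀ v ∈ p, ρ g v ∈ p) (g : G) (v : p) :
    ((subRep ρ p hp g v : p) : V) = ρ g v := rfl

theorem irr_of_simple {G : Type} [Group G] (V : FDRep ℂ G) (hV : Simple V) :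
    Irr (G := G) (V := V) V.ρ := by
  refine ⟨?_, ?_⟩
  · by_contra h
    push Not at h
    apply id_nonzero V
    apply Action.hom_ext
    apply FGModuleCat.hom_ext
    ext v
    exact (h _).trans (h _).symm
  · intro p hp
    let W : FDRep ℂ G := FDRep.of (subRep V.ρ p hp)
    let i : W ⟶ V := ⟨FGModuleCat.ofHom p.subtype, fun g => by
      apply FGModuleCat.hom_ext
      ext v
      rfl⟩
    have hi : ∀ v : p, i.hom v = (v : V) := fun v => rfl
    have hmono : Mono i := by
      constructor
      intro Z f g hfg
      apply Action.hom_ext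
      apply FGModuleCat.hom_ext
      ext z
      have h2 : (f ≫ i).hom z = (g ≫ i).hom z := by rw [hfg]
      exact h2
    by_cases h0 : i = 0
    · left
      rw [Submodule.eq_bot_iff]
      intro v hv
      have := hi ⟨v, hv⟩
      rw [h0] at this
      exact this.symm
    · right
      have hiso : IsIso i := isIso_of_mono_of_nonzero h0
      rw [Submodule.eq_top_iff']
      intro v
      have : (inv i ≫ i).hom v = v := by rw [IsIso.inv_hom_id]; rfl
      rw [← this]
      exact ((inv i).hom v : p).2


section Clifford

variable {G V W X : Type} [Group G] [AddCommGroup V] [Module ℂ V] [AddCommGroup W] [Module ℂ W]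
  [AddCommGroup X] [Module ℂ X]

theorem RIso.refl (ρ : G →* (V →ₗ[ℂ] V)) : RIso ρ ρ := ⟨LinearEquiv.refl ℂ V, fun _ _ => rfl⟩

theorem RIso.symm {ρ : G →* (V →ₗ[ℂ] V)} {σ : G →* (W →ₗ[ℂ] W)} (h : RIso ρ σ) : RIso σ ρ := by
  obtain ⟨e, he⟩ := h
  refine ⟨e.symm, fun g v => ?_⟩
  apply e.injective
  rw [he]; simp

theorem RIso.trans {ρ : G →* (V →ₗ[ℂ] V)} {σ : G →* (W →ₗ[ℂ] W)} {τ : G →* (X →ₗ[ℂ] X)}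
    (h : RIso ρ σ) (h' : RIso σ τ) : RIso ρ τ := by
  obtain ⟨e, he⟩ := h
  obtain ⟨f, hf⟩ := h'
  refine ⟨e.trans f, fun g v => ?_⟩
  simp [he, hf]

theorem rmul_apply (ρ : G →* (V →ₗ[ℂ] V)) (a b : G) (v : V) : ρ (a * b) v = ρ a (ρ b v) := by
  rw [map_mul]; rfl

theorem rinv_apply (ρ : G →* (V →ₗ[ℂ] V)) (a : G) (v : V) : ρ a⁻¹ (ρ a v) = v := by
  rw [← rmul_apply]; simp

theorem rinv_apply' (ρ : G →* (V →ₗ[ℂ] V)) (a : G) (v : V) : ρ a (ρ a⁻¹ v) = v := by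
  rw [← rmul_apply]; simp

theorem schur_inj {ρ : G →* (V →ₗ[ℂ] V)} {σ : G →* (W →ₗ[ℂ] W)} (hρ : Irr ρ)
    (f : V →ₗ[ℂ] W) (hf : ∀ g v, f (ρ g v) = σ g (f v)) (h0 : f ≠ 0) : Function.Injective f := by
  rw [← LinearMap.ker_eq_bot]
  refine (hρ.2 (LinearMap.ker f) ?_).resolve_right ?_
  · intro g v hv
    rw [LinearMap.mem_ker] at *
    rw [hf, hv, map_zero]
  · intro h
    exact h0 (LinearMap.ker_eq_top.1 h)

theorem schur_iso {ρ : G →* (V →ₗ[ℂ] V)} {σ : G →* (W →ₗ[ℂ] W)} (hρ : Irr ρ) (hσ : Irr σ)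
    (f : V →ₗ[ℂ] W) (hf : ∀ g v, f (ρ g v) = σ g (f v)) (h0 : f ≠ 0) : RIso ρ σ := by
  have hinj := schur_inj hρ f hf h0
  have hsurj : Function.Surjective f := by
    rw [← LinearMap.range_eq_top]
    refine (hσ.2 (LinearMap.range f) ?_).resolve_left ?_
    · rintro g _ ⟨v, rfl⟩
      exact ⟨ρ g v, hf g v⟩
    · intro h
      exact h0 (LinearMap.range_eq_bot.1 h)
  exact ⟨LinearEquiv.ofBijective f ⟨hinj, hsurj⟩, hf⟩

variable (N : Subgroup G) [N.Normal]

/-- twist of a representation of a normal subgroup by conjugation -/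
def tw (σ : N →* (W →ₗ[ℂ] W)) (h : G) : N →* (W →ₗ[ℂ] W) :=
  σ.comp (MulAut.conjNormal h⁻¹ : MulAut N).toMonoidHom

variable {N}

theorem tw_apply (σ : N →* (W →ₗ[ℂ] W)) (h : G) (n : N) :
    tw N σ h n = σ (MulAut.conjNormal h⁻¹ n) := rfl

theorem tw_tw (σ : N →* (W →ₗ[ℂ] W)) (a b : G) : tw N (tw N σ a) b = tw N σ (b * a) := by
  ext n v
  simp only [tw_apply, mul_inv_rev, map_mul]
  rfl

theorem tw_one (σ : N →* (W →ₗ[ℂ] W)) : tw N σ 1 = σ := by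
  ext n v
  simp [tw_apply]

theorem tw_congr {σ : N →* (W →ₗ[ℂ] W)} {τ : N →* (X →ₗ[ℂ] X)} (h : RIso σ τ) (a : G) :
    RIso (tw N σ a) (tw N τ a) := by
  obtain ⟨e, he⟩ := h
  exact ⟨e, fun n v => he _ _⟩

theorem tw_congr' {σ : N →* (W →ₗ[ℂ] W)} {τ : N →* (X →ₗ[ℂ] X)} (a : G)
    (h : RIso (tw N σ a) (tw N τ a)) : RIso σ τ := by
  have := tw_congr h a⁻¹
  simpa [tw_tw, tw_one] using this

theorem tw_irr {σ : N →* (W →ₗ[ℂ] W)} (h : Irr σ) (a : G) : Irr (tw N σ a) := by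
  refine ⟨h.1, fun p hp => h.2 p fun n v hv => ?_⟩
  have := hp (MulAut.conjNormal a n) v hv
  rw [tw_apply, map_inv, MulAut.inv_apply_self] at this
  exact this

theorem tw_mem {σ : N →* (W →ₗ[ℂ] W)} (a : G) (ha : a ∈ N) : RIso (tw N σ a) σ := by
  refine ⟨⟨σ ⟨a, ha⟩, fun v => σ ⟨a, ha⟩⁻¹ v, fun v => rinv_apply _ _ _,
    fun v => rinv_apply' _ _ _⟩, fun n v => ?_⟩
  change σ _ (tw N σ a n v) = σ n (σ _ v)
  rw [tw_apply, ← rmul_apply, ← rmul_apply]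
  congr 2
  ext
  simp [mul_assoc]

theorem irr_sub_exists {H : Type} [Group H] [FiniteDimensional ℂ V] (ρ : H →* (V →ₗ[ℂ] V))
    (h0 : ∃ v : V, v ≠ 0) :
    ∃ (p : Submodule ℂ V) (hp : ∀ g, ∀ v ∈ p, ρ g v ∈ p), Irr (subRep ρ p hp) := by
  classical
  let P : ℕ → Prop := fun n => ∃ (p : Submodule ℂ V), (∀ g, ∀ v ∈ p, ρ g v ∈ p) ∧ p ≠ ⊥ ∧
    Module.finrank ℂ p = n
  have hP : ∃ n, P n := ⟨_, ⊤, fun _ _ _ => trivial, by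
    obtain ⟨v, hv⟩ := h0
    intro h
    exact hv ((Submodule.eq_bot_iff _).1 h v trivial), rfl⟩
  obtain ⟨p, hp, hp0, hpn⟩ := Nat.find_spec hP
  refine ⟨p, hp, ?_, ?_⟩
  · obtain ⟨v, hv, hv0⟩ := Submodule.exists_mem_ne_zero_of_ne_bot hp0
    exact ⟨⟨v, hv⟩, fun h => hv0 (congrArg Subtype.val h)⟩
  · intro r hr
    by_cases hr0 : r = ⊥
    · exact Or.inl hr0
    right
    have hmin := Nat.find_min' hP (m := Module.finrank ℂ r) ⟨r.map p.subtype, ?_, ?_, ?_⟩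
    · apply Submodule.eq_top_of_finrank_eq
      apply le_antisymm (Submodule.finrank_le r)
      rw [hpn]; exact hmin
    · rintro g _ ⟨v, hv, rfl⟩
      exact ⟨_, hr g v hv, rfl⟩
    · intro h
      exact hr0 (Submodule.map_injective_of_injective p.injective_subtype
        (h.trans (Submodule.map_bot _).symm))
    · exact Submodule.finrank_map_subtype_eq p r

end Clifford

section Clifford2
variable {G V W X : Type} [Group G] [AddCommGroup V] [Module ℂ V] [AddCommGroup W] [Module ℂ W]
  [AddCommGroup X] [Module ℂ X] {N : Subgroup G} [N.Normal]

/-- One step of the embedding lemma. -/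
theorem embed_step {H : Type} [Group H] (ρ : H →* (V →ₗ[ℂ] V)) (τ : H →* (X →ₗ[ℂ] X))
    (σ : H →* (W →ₗ[ℂ] W)) (hτ : Irr τ) (hσ : Irr σ)
    (f : X →ₗ[ℂ] V) (hf : ∀ n x, f (τ n x) = ρ n (f x))
    (b : W →ₗ[ℂ] V) (hb : ∀ n x, b (σ n x) = ρ n (b x))
    (A : Submodule ℂ V) (hA : ∀ n, ∀ v ∈ A, ρ n v ∈ A)
    (hle : LinearMap.range f ≤ A ⊔ LinearMap.range b) (hnot : ¬ LinearMap.range f ≤ A) :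
    RIso τ σ := by
  have hbA : A.comap b = ⊥ := by
    refine (hσ.2 (A.comap b) ?_).resolve_right ?_
    · intro n v hv
      rw [Submodule.mem_comap] at *
      rw [hb]; exact hA _ _ hv
    · intro h
      apply hnot
      refine hle.trans (sup_le le_rfl ?_)
      rintro _ ⟨x, rfl⟩
      have : x ∈ A.comap b := h ▸ trivial
      exact this
  have huniq : ∀ w, b w ∈ A → w = 0 := fun w hw => by
    have : w ∈ A.comap b := hw
    rw [hbA] at this
    exact this
  have hex : ∀ x, ∃ w, f x - b w ∈ A := by
    intro x
    obtain ⟨a, ha, _, ⟨w, rfl⟩, h⟩ := Submodule.mem_sup.1 (hle ⟨x, rfl⟩)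
    exact ⟨w, by rw [← h]; simpa using ha⟩
  choose c hc using hex
  have hcu : ∀ x w, f x - b w ∈ A → c x = w := by
    intro x w h
    have := A.sub_mem h (hc x)
    rw [← sub_eq_zero]
    apply huniq
    rw [map_sub]
    convert this using 1
    abel
  let C : X →ₗ[ℂ] W :=
    { toFun := c
      map_add' := fun x y => by
        apply hcu
        have := A.add_mem (hc x) (hc y)
        convert this using 1
        simp only [map_add]; abel
      map_smul' := fun r x => by
        apply hcu
        have := A.smul_mem r (hc x)
        convert this using 1
        simp [smul_sub] }
  refine schur_iso hτ hσ C ?_ ?_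
  · intro n x
    apply hcu
    have := hA n _ (hc x)
    rw [map_sub] at this
    rw [hf, hb]; exact this
  · intro h0
    apply hnot
    rintro _ ⟨x, rfl⟩
    have h1 := hc x
    have : c x = 0 := congrArg (fun f => f x) h0
    rw [this] at h1
    simpa using h1

theorem clifford (g : G) (d : ℕ) (hd : 0 < d) (hgd : g ^ d ∈ N)
    (hgen : ∀ x : G, ∃ k : ℕ, ∃ n ∈ N, x = g ^ k * n) [FiniteDimensional ℂ V]
    [FiniteDimensional ℂ W]
    (ρ : G →* (V →ₗ[ℂ] V)) (hρ : Irr ρ) (σ : N →* (W →ₗ[ℂ] W)) (hσ : Irr σ)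
    (f1 : W →ₗ[ℂ] V) (hf1 : ∀ n w, f1 (σ n w) = ρ n (f1 w)) (hf10 : f1 ≠ 0) :
    ∃ i, 0 < i ∧ i ∣ d ∧ Module.finrank ℂ V = i * Module.finrank ℂ W ∧
      (∀ j k, j < k → k < i → ¬ RIso (tw N σ (g ^ j)) (tw N σ (g ^ k))) ∧
      RIso (tw N σ (g ^ i)) σ := by
  classical
  let P : ℕ → Prop := fun k => RIso (tw N σ (g ^ k)) σ
  have hPd : P d := tw_mem _ hgd
  have hex : ∃ k, 0 < k ∧ P k := ⟨d, hd, hPd⟩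
  obtain ⟨hi0, hPi⟩ := Nat.find_spec hex
  have hmin : ∀ k, 0 < k → P k → Nat.find hex ≤ k := fun k h1 h2 => Nat.find_min' hex ⟨h1, h2⟩
  generalize Nat.find hex = i at hi0 hPi hmin
  have hsub : ∀ a b, P a → P (a + b) → P b := by
    intro a b ha hab
    have h1 := tw_congr ha (g ^ b)
    rw [tw_tw, ← pow_add, add_comm] at h1
    exact h1.symm.trans hab
  have hdvd : i ∣ d := by
    have h1 : ∀ m r, P (i * m + r) → P r := by
      intro m
      induction m with
      | zero => intro r h; simpa using h
      | succ m ih =>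
        intro r h
        apply ih
        apply hsub i _ hPi
        convert h using 1
        ring
    have h2 : P (d % i) := h1 (d / i) _ (by rw [Nat.div_add_mod]; exact hPd)
    by_contra hnd
    have h3 : 0 < d % i := Nat.pos_of_ne_zero fun h => hnd (Nat.dvd_of_mod_eq_zero h)
    have := hmin _ h3 h2
    exact absurd (Nat.mod_lt d hi0) (by omega)
  have hnon : ∀ j k, j < k → k < i → ¬ RIso (tw N σ (g ^ j)) (tw N σ (g ^ k)) := by
    intro j k hjk hki h
    have e : tw N σ (g ^ k) = tw N (tw N σ (g ^ (k - j))) (g ^ j) := by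
      rw [tw_tw, ← pow_add]; congr 2; omega
    rw [e] at h
    have := hmin (k - j) (by omega) (tw_congr' _ h).symm
    omega
  refine ⟨i, hi0, hdvd, ?_, hnon, hPi⟩
  -- the eigenvector
  obtain ⟨e, he⟩ := hPi
  have he' : ∀ n v, e.symm (σ n v) = tw N σ (g ^ i) n (e.symm v) := by
    intro n v
    apply e.injective
    rw [he]; simp
  have htw : ∀ (h : G) (n : N) (f : W →ₗ[ℂ] V) (_ : ∀ n w, f (σ n w) = ρ n (f w)) (w : W),
      ρ h (f (tw N σ h n w)) = ρ n (ρ h (f w)) := by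
    intro h n f hf w
    rw [tw_apply, hf, ← rmul_apply, ← rmul_apply]
    congr 2
    simp [mul_assoc]
  let H : Submodule ℂ (W →ₗ[ℂ] V) :=
    { carrier := {f | ∀ n w, f (σ n w) = ρ n (f w)}
      zero_mem' := by intro n w; simp
      add_mem' := by
        intro a b ha hb n w
        simp only [Set.mem_ofPred_eq] at ha hb
        simp [ha, hb]
      smul_mem' := by
        intro r a ha n w
        simp only [Set.mem_ofPred_eq] at ha
        simp [ha] }
  let Φ0 : (W →ₗ[ℂ] V) →ₗ[ℂ] (W →ₗ[ℂ] V) :=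
    { toFun := fun f => (ρ (g ^ i)) ∘ₗ f ∘ₗ e.symm.toLinearMap
      map_add' := by intro a b; ext w; simp
      map_smul' := by intro r a; ext w; simp }
  have hΦ : ∀ f ∈ H, Φ0 f ∈ H := by
    intro f hf n w
    change ρ (g ^ i) (f (e.symm (σ n w))) = ρ n (ρ (g ^ i) (f (e.symm w)))
    rw [he', htw _ _ _ hf]
  have : Nontrivial H := ⟨⟨⟨f1, hf1⟩, 0, fun h => hf10 (congrArg Subtype.val h)⟩⟩
  obtain ⟨μ, hμ⟩ := Module.End.exists_eigenvalue (Φ0.restrict hΦ)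
  obtain ⟨⟨f0, hf0⟩, hev⟩ := hμ.exists_hasEigenvector
  have hf00 : f0 ≠ 0 := fun h => hev.2 (Subtype.ext h)
  have hev1 : ∀ w, ρ (g ^ i) (f0 (e.symm w)) = μ • f0 w := by
    intro w
    have := hev.apply_eq_smul
    exact congrArg (fun f : H => f.1 w) this
  have hf0' : ∀ n w, f0 (σ n w) = ρ n (f0 w) := hf0
  have hgi : ∀ w, ρ (g ^ i) (f0 w) = f0 (μ • e w) := by
    intro w
    have := hev1 (e w)
    rw [map_smul, ← this]; simp
  have hinj : Function.Injective f0 := schur_inj (ρ := σ) (σ := ρ.comp N.subtype) hσ f0 hf0' hf00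
  -- the spaces
  let b : ℕ → (W →ₗ[ℂ] V) := fun k => ρ (g ^ k) ∘ₗ f0
  have hb : ∀ k n w, b k (tw N σ (g ^ k) n w) = (ρ.comp N.subtype) n (b k w) := by
    intro k n w
    exact htw _ _ _ hf0' _
  have hbinj : ∀ k, Function.Injective (b k) := by
    intro k x y h
    apply hinj
    have : ρ (g ^ k) (f0 x) = ρ (g ^ k) (f0 y) := h
    rw [← rinv_apply ρ (g ^ k) (f0 x), this, rinv_apply]
  let S : ℕ → Submodule ℂ V := fun k => (Finset.range k).sup fun j => LinearMap.range (b j)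
  have hS0 : S 0 = ⊥ := by simp [S]
  have hSs : ∀ k, S (k + 1) = S k ⊔ LinearMap.range (b k) := by
    intro k
    simp only [S, Finset.range_add_one, Finset.sup_insert]
    rw [sup_comm]
  have hSN : ∀ k, ∀ n : N, ∀ v ∈ S k, (ρ.comp N.subtype) n v ∈ S k := by
    intro k
    induction k with
    | zero => intro n v hv; rw [hS0] at *; rw [(Submodule.mem_bot ℂ).1 hv]; simp
    | succ k ih =>
      intro n v hv
      rw [hSs] at *
      obtain ⟨x, hx, _, ⟨y, rfl⟩, rfl⟩ := Submodule.mem_sup.1 hv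
      rw [map_add, ← hb]
      exact Submodule.add_mem_sup (ih n x hx) ⟨_, rfl⟩
  have hemb : ∀ (k : ℕ) (τ : N →* (W →ₗ[ℂ] W)) (_ : Irr τ) (f : W →ₗ[ℂ] V)
      (_ : ∀ n x, f (τ n x) = (ρ.comp N.subtype) n (f x)), f ≠ 0 → LinearMap.range f ≤ S k →
      ∃ j < k, RIso τ (tw N σ (g ^ j)) := by
    intro k
    induction k with
    | zero =>
      intro τ hτ f hf hf0 hle
      rw [hS0, le_bot_iff, LinearMap.range_eq_bot] at hle
      exact absurd hle hf0
    | succ k ih =>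
      intro τ hτ f hf hf0 hle
      by_cases h : LinearMap.range f ≤ S k
      · obtain ⟨j, hj, hh⟩ := ih τ hτ f hf hf0 h
        exact ⟨j, by omega, hh⟩
      · rw [hSs] at hle
        exact ⟨k, by omega, embed_step (ρ.comp N.subtype) τ _ hτ (tw_irr hσ _) f hf (b k) (hb k)
          (S k) (hSN k) hle h⟩
  have hb0 : ∀ k, b k ≠ 0 := by
    intro k h
    apply hf00
    ext w
    have : b k w = b k 0 := by rw [h]; simp
    rw [hbinj k this]; simp
  have hrank : ∀ k ≤ i, Module.finrank ℂ (S k) = k * Module.finrank ℂ W := by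
    intro k
    induction k with
    | zero => intro _; rw [hS0]; simp
    | succ k ih =>
      intro hk
      have h1 : S k ⊓ LinearMap.range (b k) = ⊥ := by
        have h2 : (S k).comap (b k) = ⊥ := by
          refine ((tw_irr hσ (g ^ k)).2 ((S k).comap (b k)) ?_).resolve_right ?_
          · intro n v hv
            rw [Submodule.mem_comap] at *
            rw [hb]; exact hSN _ _ _ hv
          · intro h
            obtain ⟨j, hj, hh⟩ := hemb k _ (tw_irr hσ (g ^ k)) (b k) (hb k) (hb0 k) (by
              rintro _ ⟨x, rfl⟩
              have : x ∈ (S k).comap (b k) := h ▸ trivial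
              exact this)
            exact hnon j k hj (by omega) hh.symm
        rw [Submodule.eq_bot_iff]
        rintro _ ⟨hx, y, rfl⟩
        have : y ∈ (S k).comap (b k) := hx
        rw [h2] at this
        rw [(Submodule.mem_bot ℂ).1 this, map_zero]
      have h3 := Submodule.finrank_sup_add_finrank_inf_eq (S k) (LinearMap.range (b k))
      rw [h1, finrank_bot, ← hSs, ih (by omega), LinearMap.finrank_range_of_inj (hbinj k)] at h3
      rw [← add_zero (Module.finrank ℂ _), h3]; ring
  have hle : ∀ j k, j < k → LinearMap.range (b j) ≤ S k := by
    intro j k hjk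
    exact Finset.le_sup (f := fun j => LinearMap.range (b j)) (Finset.mem_range.2 hjk)
  have htop : S i = ⊤ := by
    have hg : ∀ v ∈ S i, ρ g v ∈ S i := by
      have h4 : ∀ k, k ≤ i → ∀ v ∈ S k, ρ g v ∈ S i := by
        intro k
        induction k with
        | zero => intro _ v hv; rw [hS0] at hv; rw [(Submodule.mem_bot ℂ).1 hv]; simp
        | succ k ih =>
          intro hk v hv
          rw [hSs] at hv
          obtain ⟨x, hx, _, ⟨y, rfl⟩, rfl⟩ := Submodule.mem_sup.1 hv
          rw [map_add]
          refine Submodule.add_mem _ (ih (by omega) x hx) ?_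
          have h5 : ρ g (b k y) = b (k + 1) y := by
            change ρ g (ρ (g ^ k) _) = ρ (g ^ (k + 1)) _
            rw [← rmul_apply, pow_succ']
          rw [h5]
          rcases Nat.lt_or_ge (k + 1) i with h6 | h6
          · exact hle _ _ h6 ⟨y, rfl⟩
          · have : k + 1 = i := by omega
            rw [this]
            apply hle 0 i hi0
            refine ⟨μ • e y, ?_⟩
            change ρ (g ^ 0) _ = ρ (g ^ i) _
            rw [hgi]; simp
      exact h4 i le_rfl
    have hgk : ∀ k : ℕ, ∀ v ∈ S i, ρ (g ^ k) v ∈ S i := by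
      intro k
      induction k with
      | zero => intro v hv; simpa using hv
      | succ k ih =>
        intro v hv
        rw [pow_succ', rmul_apply]
        exact hg _ (ih v hv)
    refine (hρ.2 (S i) ?_).resolve_left ?_
    · intro x v hv
      obtain ⟨k, n, hn, rfl⟩ := hgen x
      rw [rmul_apply]
      exact hgk k _ (hSN i ⟨n, hn⟩ v hv)
    · intro h
      have := hle 0 i hi0
      rw [h, le_bot_iff, LinearMap.range_eq_bot] at this
      exact hb0 0 this
  rw [← hrank i le_rfl, htop, finrank_top]

/-- If `N` has at most two classes of irreducibles of dimension `n`, all `G`-degrees over `n`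
are equal. -/
theorem clifford_two (g : G) (d : ℕ) (hd : 0 < d) (hgd : g ^ d ∈ N)
    (hgen : ∀ x : G, ∃ k : ℕ, ∃ n ∈ N, x = g ^ k * n) [FiniteDimensional ℂ V]
    [FiniteDimensional ℂ W] {V' W' : Type} [AddCommGroup V'] [Module ℂ V'] [AddCommGroup W']
    [Module ℂ W'] [FiniteDimensional ℂ V'] [FiniteDimensional ℂ W'] (n : ℕ)
    (hW : Module.finrank ℂ W = n) (hW' : Module.finrank ℂ W' = n)
    (htwo : ∀ (X1 X2 X3 : Type) [AddCommGroup X1] [Module ℂ X1] [AddCommGroup X2] [Module ℂ X2]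
      [AddCommGroup X3] [Module ℂ X3] [FiniteDimensional ℂ X1] [FiniteDimensional ℂ X2]
      [FiniteDimensional ℂ X3] (τ1 : N →* (X1 →ₗ[ℂ] X1)) (τ2 : N →* (X2 →ₗ[ℂ] X2))
      (τ3 : N →* (X3 →ₗ[ℂ] X3)), Irr τ1 → Irr τ2 → Irr τ3 → Module.finrank ℂ X1 = n →
      Module.finrank ℂ X2 = n → Module.finrank ℂ X3 = n → RIso τ1 τ2 ∨ RIso τ1 τ3 ∨ RIso τ2 τ3)
    (ρ : G →* (V →ₗ[ℂ] V)) (hρ : Irr ρ) (σ : N →* (W →ₗ[ℂ] W)) (hσ : Irr σ)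
    (f1 : W →ₗ[ℂ] V) (hf1 : ∀ n w, f1 (σ n w) = ρ n (f1 w)) (hf10 : f1 ≠ 0)
    (ρ' : G →* (V' →ₗ[ℂ] V')) (hρ' : Irr ρ') (σ' : N →* (W' →ₗ[ℂ] W')) (hσ' : Irr σ')
    (f1' : W' →ₗ[ℂ] V') (hf1' : ∀ n w, f1' (σ' n w) = ρ' n (f1' w)) (hf10' : f1' ≠ 0) :
    Module.finrank ℂ V = Module.finrank ℂ V' := by
  obtain ⟨i, hi0, -, hiV, hi, hii⟩ := clifford g d hd hgd hgen ρ hρ σ hσ f1 hf1 hf10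
  obtain ⟨j, hj0, -, hjV, hj, hjj⟩ := clifford g d hd hgd hgen ρ' hρ' σ' hσ' f1' hf1' hf10'
  rw [hiV, hjV, hW, hW']
  congr 1
  have key : ∀ (Y Y' : Type) [AddCommGroup Y] [Module ℂ Y] [AddCommGroup Y'] [Module ℂ Y']
      [FiniteDimensional ℂ Y] [FiniteDimensional ℂ Y'] (τ : N →* (Y →ₗ[ℂ] Y))
      (τ' : N →* (Y' →ₗ[ℂ] Y')) (_ : Irr τ) (_ : Irr τ') (_ : Module.finrank ℂ Y = n)
      (_ : Module.finrank ℂ Y' = n) (a b : ℕ) (_ : 0 < a) (_ : 0 < b)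
      (_ : ∀ j k, j < k → k < a → ¬ RIso (tw N τ (g ^ j)) (tw N τ (g ^ k)))
      (_ : ∀ j k, j < k → k < b → ¬ RIso (tw N τ' (g ^ j)) (tw N τ' (g ^ k)))
      (_ : RIso (tw N τ (g ^ a)) τ), b ≤ a := by
    intro Y Y' _ _ _ _ _ _ τ τ' hτ hτ' hY hY' a b ha hb hna hnb hra
    by_contra hlt
    push Not at hlt
    have hb2 : b ≤ 2 := by
      by_contra h3
      push Not at h3
      rcases htwo Y' Y' Y' _ _ _ (tw_irr hτ' (g ^ 0)) (tw_irr hτ' (g ^ 1)) (tw_irr hτ' (g ^ 2))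
        hY' hY' hY' with h | h | h
      · exact hnb 0 1 (by omega) (by omega) h
      · exact hnb 0 2 (by omega) (by omega) h
      · exact hnb 1 2 (by omega) (by omega) h
    obtain rfl : a = 1 := by omega
    obtain rfl : b = 2 := by omega
    have hk : ∀ k, RIso τ (tw N τ' (g ^ k)) → False := by
      intro k h
      have h1 := tw_congr h (g ^ 1)
      rw [tw_tw, ← pow_add, add_comm, pow_add, ← tw_tw] at h1
      have h2 := tw_congr' _ ((h.symm.trans hra.symm).trans h1)
      apply hnb 0 1 (by omega) (by omega)
      simpa [tw_one] using h2
    rcases htwo Y Y' Y' τ _ _ hτ (tw_irr hτ' (g ^ 0)) (tw_irr hτ' (g ^ 1))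
        hY hY' hY' with h | h | h
    · exact hk _ h
    · exact hk _ h
    · exact hnb 0 1 (by omega) (by omega) h
  exact le_antisymm (key W' W σ' σ hσ' hσ hW' hW j i hj0 hi0 hj hi hjj)
    (key W W' σ σ' hσ hσ' hW hW' i j hi0 hj0 hi hj hii)

end Clifford2


/-- Abstract structure shared by the groups between `PSL₂` and `PGL₂`. -/
structure Ax (F N : Type) [Field F] [Group N] (Δ : Subgroup Fˣ) where
  u : F → N
  t : Fˣ → N
  w : N
  ι : N → N
  u_add : ∀ x y, u (x + y) = u x * u y
  t_mul : ∀ a ∈ Δ, ∀ b ∈ Δ, t (a * b) = t a * t b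
  tu : ∀ a ∈ Δ, ∀ x, t a * u x = u (a * x) * t a
  ww : w * w = 1
  wt : ∀ a ∈ Δ, w * t a = t a⁻¹ * w
  wuw : ∀ x : Fˣ, w * u x * w =
    u (-((x⁻¹ : Fˣ) : F)) * t (x⁻¹ ^ 2) * w * u (-((x⁻¹ : Fˣ) : F))
  sq : ∀ a : Fˣ, a ^ 2 ∈ Δ
  bruhat : ∀ g, ∃ x, ∃ a ∈ Δ, g = u x * t a ∨ ∃ y, g = u x * t a * w * u y
  ι_mul : ∀ g h, ι (g * h) = ι h * ι g
  ι_u : ∀ x, ι (u x) = u x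
  ι_t : ∀ a ∈ Δ, ι (t a) = t a⁻¹
  ι_w : ι w = w

set_option linter.unusedSectionVars false

namespace Ax

variable {F N : Type} [Field F] [Fintype F] [Group N] {Δ : Subgroup Fˣ} (A : Ax F N Δ)

include A in
theorem hq0 : (Fintype.card F : ℂ) ≠ 0 := by
  exact_mod_cast Fintype.card_ne_zero

theorem u_zero : A.u 0 = 1 := by
  have := A.u_add 0 0
  simpa using this

theorem t_one : A.t 1 = 1 := by
  have := A.t_mul 1 Δ.one_mem 1 Δ.one_mem
  simpa using this

theorem t_inv {a : Fˣ} (ha : a ∈ Δ) : A.t a⁻¹ = (A.t a)⁻¹ := by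
  rw [eq_inv_iff_mul_eq_one, ← A.t_mul _ (Δ.inv_mem ha) _ ha]
  simp [A.t_one]

section proj

variable {R : Type} [Ring R] [Algebra ℂ R] (ψ : AddChar F ℂ) (φ : N →* R)

/-- projection to the `ψ_s`-isotypic part for `U` -/
noncomputable def e (s : F) : R := (Fintype.card F : ℂ)⁻¹ • ∑ x, ψ (-(s * x)) • φ (A.u x)

theorem u_e (s y : F) : φ (A.u y) * A.e ψ φ s = ψ (s * y) • A.e ψ φ s := by
  unfold e
  rw [mul_smul_comm, smul_comm (ψ (s * y))]
  congr 1
  rw [Finset.mul_sum, Finset.smul_sum]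
  refine Fintype.sum_equiv (Equiv.addRight y) _ _ fun x => ?_
  rw [mul_smul_comm, ← map_mul, ← A.u_add, smul_smul, ← AddChar.map_add_eq_mul]
  simp only [Equiv.coe_addRight]
  rw [add_comm y x]
  congr 2; ring

theorem e_u (s y : F) : A.e ψ φ s * φ (A.u y) = ψ (s * y) • A.e ψ φ s := by
  unfold e
  rw [smul_mul_assoc, smul_comm (ψ (s * y))]
  congr 1
  rw [Finset.sum_mul, Finset.smul_sum]
  refine Fintype.sum_equiv (Equiv.addRight y) _ _ fun x => ?_
  rw [smul_mul_assoc, ← map_mul, ← A.u_add, smul_smul, ← AddChar.map_add_eq_mul]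
  simp only [Equiv.coe_addRight]
  congr 2; ring

theorem e_e {ψ : AddChar F ℂ} (hψ : ψ.IsPrimitive) (s r : F) [Decidable (s = r)] :
    A.e ψ φ s * A.e ψ φ r = if s = r then A.e ψ φ r else 0 := by
  classical
  have h1 : A.e ψ φ s * A.e ψ φ r =
      ((Fintype.card F : ℂ)⁻¹ * ∑ x, ψ (x * (r - s))) • A.e ψ φ r := by
    conv_lhs => rw [e]
    rw [smul_mul_assoc, Finset.sum_mul, mul_smul, Finset.sum_smul]
    congr 1
    refine Finset.sum_congr rfl fun x _ => ?_
    rw [smul_mul_assoc, u_e, smul_smul, ← AddChar.map_add_eq_mul]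
    congr 2; ring
  rw [h1, AddChar.sum_mulShift _ hψ]
  by_cases h : s = r
  · rw [if_pos (by rw [h, sub_self]), if_pos h, inv_mul_cancel₀ A.hq0, one_smul]
  · rw [if_neg (by rw [sub_eq_zero]; exact fun h' => h h'.symm), if_neg h]
    simp

theorem e_idem {ψ : AddChar F ℂ} (hψ : ψ.IsPrimitive) (s : F) :
    A.e ψ φ s * A.e ψ φ s = A.e ψ φ s := by
  classical
  rw [A.e_e φ hψ, if_pos rfl]

theorem sum_e {ψ : AddChar F ℂ} (hψ : ψ.IsPrimitive) : ∑ s, A.e ψ φ s = 1 := by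
  classical
  unfold e
  rw [← Finset.smul_sum, Finset.sum_comm]
  simp_rw [← Finset.sum_smul]
  have : ∀ x : F, ∑ s, ψ (-(s * x)) = if x = 0 then (Fintype.card F : ℂ) else 0 := by
    intro x
    have := AddChar.sum_mulShift (-x) hψ
    simp only [mul_neg, neg_eq_zero] at this
    rw [this]; split_ifs <;> simp
  simp_rw [this]
  simp only [ite_smul, zero_smul, Finset.sum_ite_eq', Finset.mem_univ, if_true, A.u_zero, map_one,
    smul_smul, inv_mul_cancel₀ A.hq0, one_smul]
  

theorem t_e {a : Fˣ} (ha : a ∈ Δ) (s : F) :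
    φ (A.t a) * A.e ψ φ s = A.e ψ φ (s * (a⁻¹ : Fˣ)) * φ (A.t a) := by
  unfold e
  rw [mul_smul_comm, smul_mul_assoc, Finset.mul_sum, Finset.sum_mul]
  congr 1
  refine Fintype.sum_equiv (Units.mulLeft a) _ _ fun x => ?_
  simp only [Units.mulLeft_apply]
  rw [mul_smul_comm, smul_mul_assoc, ← map_mul, ← map_mul, A.tu _ ha]
  congr 2
  rw [mul_assoc, Units.inv_mul_cancel_left]

end proj

end Ax

set_option linter.unusedSectionVars false

theorem sum_eq_zero_add_units {F : Type} [Field F] [Fintype F] [DecidableEq F] {M : Type}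
    [AddCommMonoid M] (f : F → M) : ∑ x, f x = f 0 + ∑ x : Fˣ, f x := by
  rw [← Finset.add_sum_erase _ _ (Finset.mem_univ (0 : F))]
  congr 1
  symm
  refine Finset.sum_bij (fun x _ => (x : F)) ?_ ?_ ?_ ?_
  · intro x _; simp
  · intro x _ y _ h; exact Units.ext h
  · intro x hx; exact ⟨Units.mk0 x (Finset.ne_of_mem_erase hx), Finset.mem_univ _, rfl⟩
  · intro x _; rfl

namespace Ax

variable {F N : Type} [Field F] [Fintype F] [DecidableEq F] [Group N] {Δ : Subgroup Fˣ} (A : Ax F N Δ)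
variable {V : Type} [AddCommGroup V] [Module ℂ V] {ψ : AddChar F ℂ} (hψ : ψ.IsPrimitive)
  (ρ : N →* (V →ₗ[ℂ] V))

theorem ue (s y : F) (v : V) : ρ (A.u y) (A.e ψ ρ s v) = ψ (s * y) • A.e ψ ρ s v :=
  congrArg (fun f : V →ₗ[ℂ] V => f v) (A.u_e ψ ρ s y)

theorem eu (s y : F) (v : V) : A.e ψ ρ s (ρ (A.u y) v) = ψ (s * y) • A.e ψ ρ s v :=
  congrArg (fun f : V →ₗ[ℂ] V => f v) (A.e_u ψ ρ s y)

theorem ue0 (y : F) (v : V) : ρ (A.u y) (A.e ψ ρ 0 v) = A.e ψ ρ 0 v := by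
  rw [ue]; simp

theorem eu0 (y : F) (v : V) : A.e ψ ρ 0 (ρ (A.u y) v) = A.e ψ ρ 0 v := by
  rw [eu]; simp

theorem te {a : Fˣ} (ha : a ∈ Δ) (s : F) (v : V) :
    ρ (A.t a) (A.e ψ ρ s v) = A.e ψ ρ (s * (a⁻¹ : Fˣ)) (ρ (A.t a) v) :=
  congrArg (fun f : V →ₗ[ℂ] V => f v) (A.t_e ψ ρ ha s)

theorem te0 {a : Fˣ} (ha : a ∈ Δ) (v : V) :
    ρ (A.t a) (A.e ψ ρ 0 v) = A.e ψ ρ 0 (ρ (A.t a) v) := by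
  rw [te _ _ ha, zero_mul]

include hψ

theorem ee (s : F) (v : V) : A.e ψ ρ s (A.e ψ ρ s v) = A.e ψ ρ s v :=
  congrArg (fun f : V →ₗ[ℂ] V => f v) (A.e_idem ρ hψ s)

theorem ee_ne {s r : F} (h : s ≠ r) (v : V) : A.e ψ ρ s (A.e ψ ρ r v) = 0 := by
  classical
  have := A.e_e ρ hψ s r
  rw [if_neg h] at this
  exact congrArg (fun f : V →ₗ[ℂ] V => f v) this

theorem sum_ev (v : V) : ∑ s, A.e ψ ρ s v = v := by
  have := congrArg (fun f : V →ₗ[ℂ] V => f v) (A.sum_e ρ hψ)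
  simpa using this

omit hψ in
theorem e_apply (s : F) (v : V) :
    A.e ψ ρ s v = (Fintype.card F : ℂ)⁻¹ • ∑ x, ψ (-(s * x)) • ρ (A.u x) v := by
  simp [e]

omit hψ in
theorem e_fix {s : F} {v : V} (h : ∀ x, ρ (A.u x) v = ψ (s * x) • v) : A.e ψ ρ s v = v := by
  rw [e_apply]
  have : ∀ x, ψ (-(s * x)) • ρ (A.u x) v = v := by
    intro x
    rw [h, smul_smul, ← AddChar.map_add_eq_mul]; simp
  simp_rw [this]
  rw [Finset.sum_const, Finset.card_univ, ← Nat.cast_smul_eq_nsmul ℂ, smul_smul,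
    inv_mul_cancel₀ A.hq0, one_smul]

omit hψ in
theorem e_fix0 {v : V} (h : ∀ x, ρ (A.u x) v = v) : A.e ψ ρ 0 v = v :=
  A.e_fix ρ fun x => by simp [h]

theorem finrank_eq [FiniteDimensional ℂ V] :
    Module.finrank ℂ V = ∑ s, Module.finrank ℂ (LinearMap.range (A.e ψ ρ s)) := by
  have h1 : ∀ s, LinearMap.trace ℂ V (A.e ψ ρ s) =
      (Module.finrank ℂ (LinearMap.range (A.e ψ ρ s)) : ℂ) := by
    intro s
    have : LinearMap.IsProj (LinearMap.range (A.e ψ ρ s)) (A.e ψ ρ s) :=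
      ⟨fun x => ⟨x, rfl⟩, by rintro _ ⟨x, rfl⟩; exact A.ee hψ ρ s x⟩
    exact this.trace
  have h2 : LinearMap.trace ℂ V (∑ s, A.e ψ ρ s) = Module.finrank ℂ V := by
    rw [A.sum_e ρ hψ]; exact LinearMap.trace_one ℂ V
  rw [map_sum] at h2
  simp_rw [h1] at h2
  exact_mod_cast h2.symm

omit hψ in
theorem wwv (v : V) : ρ A.w (ρ A.w v) = v := by
  rw [← rmul_apply, A.ww]; simp

omit hψ in
theorem wtv {a : Fˣ} (ha : a ∈ Δ) (v : V) : ρ A.w (ρ (A.t a) v) = ρ (A.t a⁻¹) (ρ A.w v) := by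
  rw [← rmul_apply, A.wt a ha, rmul_apply]

omit hψ in
theorem twv {a : Fˣ} (ha : a ∈ Δ) (v : V) : ρ (A.t a) (ρ A.w v) = ρ A.w (ρ (A.t a⁻¹) v) := by
  rw [wtv _ _ (Δ.inv_mem ha), inv_inv]

omit hψ in
theorem tuv {a : Fˣ} (ha : a ∈ Δ) (x : F) (v : V) :
    ρ (A.t a) (ρ (A.u x) v) = ρ (A.u (a * x)) (ρ (A.t a) v) := by
  rw [← rmul_apply, A.tu a ha, rmul_apply]

omit hψ in
theorem wuwv (x : Fˣ) (v : V) : ρ A.w (ρ (A.u x) (ρ A.w v)) =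
    ρ (A.u (-((x⁻¹ : Fˣ) : F))) (ρ (A.t (x⁻¹ ^ 2)) (ρ A.w (ρ (A.u (-((x⁻¹ : Fˣ) : F))) v))) := by
  rw [← rmul_apply, ← rmul_apply, A.wuw]
  simp only [rmul_apply]

omit hψ in
theorem tinv {a : Fˣ} (ha : a ∈ Δ) (v : V) : ρ (A.t a⁻¹) (ρ (A.t a) v) = v := by
  rw [A.t_inv ha, rinv_apply]

omit hψ in
theorem stable {p : Submodule ℂ V} (hu : ∀ x, ∀ v ∈ p, ρ (A.u x) v ∈ p)
    (ht : ∀ a ∈ Δ, ∀ v ∈ p, ρ (A.t a) v ∈ p) (hw : ∀ v ∈ p, ρ A.w v ∈ p) (g : N) (v : V)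
    (hv : v ∈ p) : ρ g v ∈ p := by
  obtain ⟨x, a, ha, rfl | ⟨y, rfl⟩⟩ := A.bruhat g
  · rw [rmul_apply]; exact hu _ _ (ht _ ha _ hv)
  · simp only [rmul_apply]; exact hu _ _ (ht _ ha _ (hw _ (hu _ _ hv)))

omit hψ in
/-- the key formula -/
theorem key_formula {v : V} (hv : ∀ x, ρ (A.u x) v = v) (s : F) :
    A.e ψ ρ 0 (ρ A.w (A.e ψ ρ s (ρ A.w v))) = (Fintype.card F : ℂ)⁻¹ •
      (v + ∑ x : Fˣ, ψ (-(s * x)) • ρ (A.t (x⁻¹ ^ 2)) (A.e ψ ρ 0 (ρ A.w v))) := by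
  classical
  conv_lhs => rw [A.e_apply ρ s]
  rw [map_smul, map_smul, sum_eq_zero_add_units, map_add, map_add, map_sum, map_sum]
  congr 2
  · rw [A.u_zero]
    simp only [mul_zero, neg_zero, AddChar.map_zero_eq_one, one_smul, map_one, Module.End.one_apply]
    rw [wwv, e_fix0 _ _ hv]
  · refine Finset.sum_congr rfl fun x _ => ?_
    rw [map_smul, map_smul, wuwv, eu0, hv, te0]
    exact A.sq _

omit hψ in
/-- generation by a vector fixed by `U` and torus eigen -/
theorem gen (hρ : Irr ρ) {v : V} (hv0 : v ≠ 0) (hv : ∀ x, ρ (A.u x) v = v) {l : Fˣ → ℂ}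
    (hl : ∀ a ∈ Δ, ρ (A.t a) v = l a • v) :
    Submodule.span ℂ (insert v (Set.range fun x => ρ (A.u x) (ρ A.w v))) = ⊤ := by
  set p := Submodule.span ℂ (insert v (Set.range fun x => ρ (A.u x) (ρ A.w v))) with hp
  have hvp : v ∈ p := Submodule.subset_span (Set.mem_insert _ _)
  have hxp : ∀ x, ρ (A.u x) (ρ A.w v) ∈ p := fun x =>
    Submodule.subset_span (Set.mem_insert_of_mem _ ⟨x, rfl⟩)
  have hwp : ρ A.w v ∈ p := by
    have := hxp 0
    rwa [A.u_zero, map_one] at this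
  have hst : ∀ L : V →ₗ[ℂ] V, L v ∈ p → (∀ x, L (ρ (A.u x) (ρ A.w v)) ∈ p) →
      ∀ y ∈ p, L y ∈ p := by
    intro L h1 h2
    have : p ≤ p.comap L := by
      rw [hp, Submodule.span_le]
      rintro y (rfl | ⟨x, rfl⟩)
      · exact h1
      · exact h2 x
    exact this
  refine (hρ.2 p ?_).resolve_left ?_
  · apply A.stable
    · intro x
      apply hst
      · rw [hv]; exact hvp
      · intro y
        rw [← rmul_apply, ← A.u_add]
        exact hxp _
    · intro a ha
      apply hst
      · rw [hl a ha]; exact p.smul_mem _ hvp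
      · intro y
        rw [tuv _ _ ha, twv _ _ ha, hl _ (Δ.inv_mem ha), map_smul, map_smul]
        exact p.smul_mem _ (hxp _)
    · apply hst
      · exact hwp
      · intro x
        by_cases hx : x = 0
        · rw [hx, A.u_zero]
          simp only [map_one, Module.End.one_apply]
          rw [wwv]; exact hvp
        · have := A.wuwv ρ (Units.mk0 x hx) v
          rw [Units.val_mk0] at this
          rw [this, hv, twv _ _ (A.sq _), hl _ (Δ.inv_mem (A.sq _)), map_smul, map_smul]
          exact p.smul_mem _ (hxp _)
  · intro h
    rw [h] at hvp
    exact hv0 ((Submodule.mem_bot ℂ).1 hvp)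

omit hψ in
theorem range_le (hρ : Irr ρ) {v : V} (hv0 : v ≠ 0) (hv : ∀ x, ρ (A.u x) v = v) {l : Fˣ → ℂ}
    (hl : ∀ a ∈ Δ, ρ (A.t a) v = l a • v) (s : F) :
    LinearMap.range (A.e ψ ρ s) ≤
      Submodule.span ℂ {A.e ψ ρ s v, A.e ψ ρ s (ρ A.w v)} := by
  rw [LinearMap.range_eq_map, ← A.gen ρ hρ hv0 hv hl, Submodule.map_span, Submodule.span_le]
  rintro _ ⟨y, rfl | ⟨x, rfl⟩, rfl⟩
  · exact Submodule.subset_span (by simp)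
  · simp only [eu]
    exact Submodule.smul_mem _ _ (Submodule.subset_span (by simp))

theorem range_ne (hρ : Irr ρ) {v : V} (hv0 : v ≠ 0) (hv : ∀ x, ρ (A.u x) v = v) {l : Fˣ → ℂ}
    (hl : ∀ a ∈ Δ, ρ (A.t a) v = l a • v) {s : F} (hs : s ≠ 0) :
    LinearMap.range (A.e ψ ρ s) = Submodule.span ℂ {A.e ψ ρ s (ρ A.w v)} := by
  apply le_antisymm
  · refine (A.range_le ρ hρ hv0 hv hl s).trans ?_
    rw [Submodule.span_le]
    rintro y (rfl | rfl)
    · have : A.e ψ ρ s v = 0 := by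
        rw [← A.e_fix0 (ψ := ψ) ρ hv, A.ee_ne hψ ρ hs]
      rw [this]; exact Submodule.zero_mem _
    · exact Submodule.subset_span rfl
  · rw [Submodule.span_le]
    rintro y rfl
    exact ⟨_, rfl⟩

/-- `z_s = 0` criterion -/
theorem z_crit (hρ : Irr ρ) {v : V} (hv0 : v ≠ 0) (hv : ∀ x, ρ (A.u x) v = v) {s : F}
    (hs : s ≠ 0) (z : V) (hz : A.e ψ ρ s z = z) (h0 : A.e ψ ρ 0 (ρ A.w z) = 0) : z = 0 := by
  by_contra hz0
  have hzu : ∀ y, ρ (A.u y) z = ψ (s * y) • z := by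
    intro y; rw [← hz, ue]
  have hez : A.e ψ ρ 0 z = 0 := by
    rw [← hz, A.ee_ne hψ ρ hs.symm]
  have hall : ∀ g, A.e ψ ρ 0 (ρ g z) = 0 := by
    intro g
    obtain ⟨x, a, ha, rfl | ⟨y, rfl⟩⟩ := A.bruhat g
    · rw [rmul_apply, eu0, ← te0 _ _ ha, hez, map_zero]
    · simp only [rmul_apply]
      rw [eu0, ← te0 _ _ ha, hzu, map_smul, map_smul, h0, smul_zero, map_zero]
  let p : Submodule ℂ V := Submodule.span ℂ (Set.range fun g => ρ g z)
  have hp : p = ⊤ := by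
    refine (hρ.2 p ?_).resolve_left ?_
    · intro g
      have : p ≤ p.comap (ρ g) := by
        change Submodule.span ℂ _ ≤ _
        rw [Submodule.span_le]
        rintro _ ⟨h, rfl⟩
        refine Submodule.subset_span ⟨g * h, ?_⟩
        simp only [rmul_apply]
      exact this
    · intro h
      have : z ∈ p := Submodule.subset_span ⟨1, by simp⟩
      rw [h] at this
      exact hz0 ((Submodule.mem_bot ℂ).1 this)
  have h1 : p ≤ LinearMap.ker (A.e ψ ρ 0) := by
    change Submodule.span ℂ _ ≤ _
    rw [Submodule.span_le]
    rintro _ ⟨h, rfl⟩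
    exact hall h
  have h2 : v ∈ LinearMap.ker (A.e ψ ρ 0) := h1 (hp ▸ trivial)
  rw [LinearMap.mem_ker, e_fix0 _ _ hv] at h2
  exact hv0 h2

end Ax

set_option linter.unusedSectionVars false
namespace Ax

variable {F N : Type} [Field F] [Fintype F] [DecidableEq F] [Group N] {Δ : Subgroup Fˣ}
  (A : Ax F N Δ)
variable {V : Type} [AddCommGroup V] [Module ℂ V] {ψ : AddChar F ℂ} (hψ : ψ.IsPrimitive)
  (ρ : N →* (V →ₗ[ℂ] V))

theorem t_pow {γ : Fˣ} (hγ : γ ∈ Δ) {v : V} {l : ℂ} (hl : ρ (A.t γ) v = l • v) (k : ℕ) :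
    ρ (A.t (γ ^ k)) v = l ^ k • v := by
  induction k with
  | zero => simp [A.t_one]
  | succ k ih =>
    rw [pow_succ, A.t_mul _ (Δ.pow_mem hγ k) _ hγ, rmul_apply, hl, map_smul, ih, smul_smul, pow_succ]
    ring_nf

theorem card_units_cast : (Fintype.card Fˣ : ℂ) = (Fintype.card F : ℂ) - 1 := by
  rw [Fintype.card_units, Nat.cast_sub Fintype.card_pos]; simp

/-- a `U`-fixed torus eigenvector -/
theorem exists_eigen [FiniteDimensional ℂ V] {γ : Fˣ} (hγ : γ ∈ Δ)
    (h : ∃ v : V, v ≠ 0 ∧ ∀ x, ρ (A.u x) v = v) :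
    ∃ (v : V) (l : ℂ), v ≠ 0 ∧ (∀ x, ρ (A.u x) v = v) ∧ ρ (A.t γ) v = l • v := by
  obtain ⟨v, hv0, hv⟩ := h
  have hst : ∀ y ∈ LinearMap.range (A.e 1 ρ 0), ρ (A.t γ) y ∈ LinearMap.range (A.e 1 ρ 0) := by
    rintro _ ⟨y, rfl⟩
    exact ⟨_, (A.te0 ρ hγ y).symm⟩
  have hvr : v ∈ LinearMap.range (A.e 1 ρ 0) := ⟨v, A.e_fix0 ρ hv⟩
  have : Nontrivial (LinearMap.range (A.e 1 ρ 0)) :=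
    ⟨⟨⟨v, hvr⟩, 0, fun h => hv0 (congrArg Subtype.val h)⟩⟩
  obtain ⟨l, hl⟩ := Module.End.exists_eigenvalue ((ρ (A.t γ)).restrict hst)
  obtain ⟨⟨y, hy⟩, hev⟩ := hl.exists_hasEigenvector
  refine ⟨y, l, fun h => hev.2 (Subtype.ext h), ?_, ?_⟩
  · obtain ⟨z, rfl⟩ := hy
    exact fun x => A.ue0 ρ x z
  · exact congrArg Subtype.val hev.apply_eq_smul

include hψ

/-- the generic principal series -/
theorem principal_one [FiniteDimensional ℂ V] (hρ : Irr ρ) {v : V} (hv0 : v ≠ 0)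
    (hv : ∀ x, ρ (A.u x) v = v) {l : Fˣ → ℂ} (hl : ∀ a ∈ Δ, ρ (A.t a) v = l a • v)
    (hne : ∃ a ∈ Δ, l a ≠ l a⁻¹) : Module.finrank ℂ V = Fintype.card F + 1 := by
  obtain ⟨a, ha, hla⟩ := hne
  set v' := A.e ψ ρ 0 (ρ A.w v) with hv'
  have hev : A.e ψ ρ 0 v = v := A.e_fix0 ρ hv
  have hl' : ∀ a ∈ Δ, ρ (A.t a) v' = l a⁻¹ • v' := by
    intro a ha
    rw [hv', te0 _ _ ha, twv _ _ ha, hl _ (Δ.inv_mem ha), map_smul, map_smul]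
  have hsum : ∀ s : F, A.e ψ ρ 0 (ρ A.w (A.e ψ ρ s (ρ A.w v))) = (Fintype.card F : ℂ)⁻¹ •
      (v + (∑ x : Fˣ, ψ (-(s * x)) * l (x⁻¹ ^ 2)⁻¹) • v') := by
    intro s
    rw [A.key_formula ρ hv s, Finset.sum_smul]
    congr 2
    refine Finset.sum_congr rfl fun x _ => ?_
    rw [← hv', hl' _ (A.sq _), smul_smul]
  have hv'0 : v' ≠ 0 := by
    intro h
    have := hsum 0
    rw [← hv', h] at this
    simp only [map_zero, smul_zero, add_zero] at this
    exact hv0 ((smul_eq_zero.1 this.symm).resolve_left (inv_ne_zero A.hq0))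
  have hind : LinearIndependent ℂ ![v, v'] := by
    rw [LinearIndependent.pair_iff]
    intro α β h
    have h1 := congrArg (ρ (A.t a)) h
    rw [map_add, map_smul, map_smul, hl a ha, hl' a ha, map_zero] at h1
    have h2 : ((l a - l a⁻¹) * α) • v = 0 := by
      have h3 : α • l a • v + β • l a⁻¹ • v' - l a⁻¹ • (α • v + β • v') = 0 := by
        rw [h1, h]; simp
      rw [← h3]; module
    have h4 : α = 0 := by
      have := (smul_eq_zero.1 h2).resolve_right hv0
      exact (mul_eq_zero.1 this).resolve_left (sub_ne_zero.2 hla)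
    refine ⟨h4, ?_⟩
    rw [h4, zero_smul, zero_add] at h
    exact (smul_eq_zero.1 h).resolve_right hv'0
  rw [A.finrank_eq hψ ρ, sum_eq_zero_add_units]
  have h0 : Module.finrank ℂ (LinearMap.range (A.e ψ ρ 0)) = 2 := by
    have : LinearMap.range (A.e ψ ρ 0) = Submodule.span ℂ (Set.range ![v, v']) := by
      rw [Matrix.range_cons, Matrix.range_cons, Matrix.range_empty, Set.union_empty,
        Set.singleton_union]
      apply le_antisymm
      · have := A.range_le (ψ := ψ) ρ hρ hv0 hv hl 0
        rwa [hev] at this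
      · rw [Submodule.span_le]
        rintro y (rfl | rfl)
        · exact ⟨_, hev⟩
        · exact ⟨_, rfl⟩
    rw [this, finrank_span_eq_card hind]; simp
  have h1 : ∀ s : Fˣ, Module.finrank ℂ (LinearMap.range (A.e ψ ρ s)) = 1 := by
    intro s
    rw [A.range_ne hψ ρ hρ hv0 hv hl s.ne_zero]
    apply finrank_span_singleton
    intro hz
    have := hsum s
    rw [hz, map_zero, map_zero] at this
    have h5 := (smul_eq_zero.1 this.symm).resolve_left (inv_ne_zero A.hq0)
    rw [LinearIndependent.pair_iff] at hind
    have := (hind 1 _ (by rw [one_smul]; exact h5)).1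
    exact one_ne_zero this
  rw [h0, Finset.sum_congr rfl fun s _ => h1 s]
  simp only [Finset.sum_const, Finset.card_univ, smul_eq_mul, mul_one, Fintype.card_units]
  have : 0 < Fintype.card F := Fintype.card_pos
  omega

/-- reduction in the non generic case -/
theorem principal_eigen [FiniteDimensional ℂ V] (hρ : Irr ρ) {v : V} (hv0 : v ≠ 0)
    (hv : ∀ x, ρ (A.u x) v = v) {l : Fˣ → ℂ} (hl : ∀ a ∈ Δ, ρ (A.t a) v = l a • v)
    (heq : ∀ a ∈ Δ, l a = l a⁻¹) : ∃ (v1 : V) (c : ℂ), v1 ≠ 0 ∧ (∀ x, ρ (A.u x) v1 = v1) ∧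
      (∀ a ∈ Δ, ρ (A.t a) v1 = l a • v1) ∧ A.e ψ ρ 0 (ρ A.w v1) = c • v1 := by
  have hev : A.e ψ ρ 0 v = v := A.e_fix0 ρ hv
  let p := LinearMap.range (A.e ψ ρ 0)
  have hvr : v ∈ p := ⟨v, hev⟩
  have : Nontrivial p := ⟨⟨⟨v, hvr⟩, 0, fun h => hv0 (congrArg Subtype.val h)⟩⟩
  obtain ⟨c, hc⟩ := Module.End.exists_eigenvalue
    ((A.e ψ ρ 0 ∘ₗ ρ A.w).restrict (p := p) (q := p) (fun y _ => ⟨_, rfl⟩))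
  obtain ⟨⟨y, hy⟩, hev1⟩ := hc.exists_hasEigenvector
  refine ⟨y, c, fun h => hev1.2 (Subtype.ext h), ?_, ?_, ?_⟩
  · obtain ⟨z, rfl⟩ := hy
    exact fun x => A.ue0 ρ x z
  · intro a ha
    have h1 := A.range_le (ψ := ψ) ρ hρ hv0 hv hl 0
    have h2 : Submodule.span ℂ {A.e ψ ρ 0 v, A.e ψ ρ 0 (ρ A.w v)} ≤
        LinearMap.ker (ρ (A.t a) - l a • LinearMap.id) := by
      rw [Submodule.span_le]
      rintro z (rfl | rfl)
      · simp [hev, hl a ha]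
      · simp [te0 _ _ ha, twv _ _ ha, hl _ (Δ.inv_mem ha), ← heq a ha]
    have := h2 (h1 hy)
    simpa [sub_eq_zero] using this
  · exact congrArg Subtype.val hev1.apply_eq_smul

end Ax

set_option linter.unusedSectionVars false
namespace Ax

variable {F N : Type} [Field F] [Fintype F] [DecidableEq F] [Group N] {Δ : Subgroup Fˣ}
  (A : Ax F N Δ)
variable {V : Type} [AddCommGroup V] [Module ℂ V] {ψ : AddChar F ℂ} (hψ : ψ.IsPrimitive)
  (ρ : N →* (V →ₗ[ℂ] V))

include hψ

/-- the non generic principal series -/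
theorem principal_two [FiniteDimensional ℂ V] (hρ : Irr ρ) {v : V} (hv0 : v ≠ 0)
    (hv : ∀ x, ρ (A.u x) v = v) {l : Fˣ → ℂ} (hl : ∀ a ∈ Δ, ρ (A.t a) v = l a • v)
    (heq : ∀ a ∈ Δ, l a = l a⁻¹) {c : ℂ} (hc : A.e ψ ρ 0 (ρ A.w v) = c • v) :
    (c = 1 ∧ Module.finrank ℂ V = 1) ∨
    (c = -(Fintype.card F : ℂ)⁻¹ ∧ Module.finrank ℂ V = Fintype.card F) ∨
    (2 * Module.finrank ℂ V = Fintype.card F + 1 ∧ c ^ 2 = (Fintype.card F : ℂ)⁻¹ ∧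
      ∃ x : Fˣ, l (x ^ 2) ≠ 1) := by
  have hev : A.e ψ ρ 0 v = v := A.e_fix0 ρ hv
  have hq0 := A.hq0
  set q : ℂ := (Fintype.card F : ℂ) with hq
  have hl1 : l 1 = 1 := by
    have := hl 1 Δ.one_mem
    rw [A.t_one, map_one, Module.End.one_apply] at this
    have h2 : (l 1 - 1) • v = 0 := by rw [sub_smul, one_smul, ← this, sub_self]
    exact sub_eq_zero.1 ((smul_eq_zero.1 h2).resolve_right hv0)
  have hlm : ∀ a ∈ Δ, ∀ b ∈ Δ, l (a * b) = l a * l b := by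
    intro a ha b hb
    have h1 := hl _ (Δ.mul_mem ha hb)
    rw [A.t_mul a ha b hb, rmul_apply, hl b hb, map_smul, hl a ha, smul_smul] at h1
    have h2 : (l (a * b) - l a * l b) • v = 0 := by
      rw [sub_smul, ← h1, mul_comm (l a), sub_self]
    exact sub_eq_zero.1 ((smul_eq_zero.1 h2).resolve_right hv0)
  have hsq : ∀ a ∈ Δ, l a = 1 ∨ l a = -1 := by
    intro a ha
    have : l a * l a = 1 := by
      have h := hlm _ ha _ (Δ.inv_mem ha)
      rw [mul_inv_cancel, hl1, ← heq a ha] at h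
      exact h.symm
    exact mul_self_eq_one_iff.1 this
  set η : Fˣ → ℂ := fun x => l (x ^ 2) with hη
  have hη1 : ∀ x, η x = 1 ∨ η x = -1 := fun x => hsq _ (A.sq x)
  have hηm : ∀ x y, η (x * y) = η x * η y := by
    intro x y
    simp only [hη, mul_pow]
    exact hlm _ (A.sq x) _ (A.sq y)
  set S : F → ℂ := fun s => ∑ x : Fˣ, ψ (-(s * x)) * η x with hS
  have hsum : ∀ s : F, A.e ψ ρ 0 (ρ A.w (A.e ψ ρ s (ρ A.w v))) = (q⁻¹ * (1 + c * S s)) • v := by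
    intro s
    rw [A.key_formula ρ hv s, mul_smul, add_smul, one_smul, mul_comm c, mul_smul, ← hc, hS,
      Finset.sum_smul]
    congr 2
    refine Finset.sum_congr rfl fun x _ => ?_
    rw [te0 _ _ (A.sq _), twv _ _ (A.sq _), hl _ (Δ.inv_mem (A.sq _)), map_smul, map_smul,
      smul_smul, ← heq _ (A.sq _)]
    simp only [hη]
    rw [inv_pow, ← heq _ (A.sq _)]
  have hcc : c ^ 2 = q⁻¹ * (1 + c * S 0) := by
    have := hsum 0
    rw [hc, map_smul, map_smul, hc, smul_smul, ← pow_two] at this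
    have h2 : (c ^ 2 - q⁻¹ * (1 + c * S 0)) • v = 0 := by rw [sub_smul, this, sub_self]
    exact sub_eq_zero.1 ((smul_eq_zero.1 h2).resolve_right hv0)
  have hr0 : Module.finrank ℂ (LinearMap.range (A.e ψ ρ 0)) = 1 := by
    have : LinearMap.range (A.e ψ ρ 0) = Submodule.span ℂ {v} := by
      apply le_antisymm
      · refine (A.range_le ρ hρ hv0 hv hl 0).trans ?_
        rw [Submodule.span_le]
        rintro y (rfl | rfl)
        · rw [hev]; exact Submodule.subset_span rfl
        · rw [hc]; exact Submodule.smul_mem _ _ (Submodule.subset_span rfl)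
      · rw [Submodule.span_le]
        rintro y rfl
        exact ⟨_, hev⟩
    rw [this, finrank_span_singleton hv0]
  have hr1 : ∀ s : Fˣ, 1 + c * S s ≠ 0 →
      Module.finrank ℂ (LinearMap.range (A.e ψ ρ s)) = 1 := by
    intro s h
    rw [A.range_ne hψ ρ hρ hv0 hv hl s.ne_zero]
    apply finrank_span_singleton
    intro hz
    have := hsum s
    rw [hz, map_zero, map_zero] at this
    have h5 := (smul_eq_zero.1 this.symm).resolve_right hv0
    exact h ((mul_eq_zero.1 h5).resolve_left (inv_ne_zero hq0))
  have hr2 : ∀ s : Fˣ, 1 + c * S s = 0 →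
      Module.finrank ℂ (LinearMap.range (A.e ψ ρ s)) = 0 := by
    intro s h
    rw [A.range_ne hψ ρ hρ hv0 hv hl s.ne_zero]
    have : A.e ψ ρ s (ρ A.w v) = 0 := by
      apply A.z_crit hψ ρ hρ hv0 hv s.ne_zero _ (A.ee hψ ρ s _)
      rw [hsum, h, mul_zero, zero_smul]
    rw [this]; simp
  have hfr : Module.finrank ℂ V = 1 + ∑ s : Fˣ, Module.finrank ℂ (LinearMap.range (A.e ψ ρ s)) := by
    rw [A.finrank_eq hψ ρ, sum_eq_zero_add_units, hr0]
  have hcu := card_units_cast (F := F)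
  have hψ0 : ∑ x : Fˣ, ψ (x : F) = -1 := by
    have h1 := sum_eq_zero_add_units (fun x : F => ψ x)
    rw [AddChar.sum_eq_zero_of_ne_one (by simpa using hψ one_ne_zero)] at h1
    · rw [AddChar.map_zero_eq_one] at h1
      linear_combination -h1
  have hpos : 0 < Fintype.card F := Fintype.card_pos
  by_cases hη0 : ∀ x, η x = 1
  · have hS0 : S 0 = q - 1 := by
      simp only [hS, zero_mul, neg_zero, AddChar.map_zero_eq_one, hη0, mul_one,
        Finset.sum_const, Finset.card_univ, nsmul_eq_mul]
      exact hcu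
    have hSs : ∀ s : Fˣ, S s = -1 := by
      intro s
      rw [← hψ0]
      simp only [hS, hη0, mul_one]
      refine Fintype.sum_equiv (Equiv.mulLeft (-s)) _ _ fun x => ?_
      simp
    rw [hS0] at hcc
    have h1 : (c - 1) * (q * c + 1) = 0 := by
      field_simp at hcc
      linear_combination hcc
    rcases mul_eq_zero.1 h1 with h | h
    · left
      have hc1 : c = 1 := sub_eq_zero.1 h
      refine ⟨hc1, ?_⟩
      rw [hfr, Finset.sum_congr rfl fun s _ => hr2 s (by rw [hSs, hc1]; ring)]
      simp
    · right; left
      have hc1 : c = -q⁻¹ := by field_simp; linear_combination h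
      refine ⟨hc1, ?_⟩
      have hne : ∀ s : Fˣ, 1 + c * S s ≠ 0 := by
        intro s h2
        rw [hSs, hc1] at h2
        have : q + 1 = 0 := by field_simp at h2; linear_combination h2
        rw [hq] at this
        norm_cast at this
      rw [hfr, Finset.sum_congr rfl fun s _ => hr1 s (hne s)]
      simp only [Finset.sum_const, Finset.card_univ, smul_eq_mul, mul_one, Fintype.card_units]
      omega
  · right; right
    push Not at hη0
    obtain ⟨x0, hx0⟩ := hη0
    let ηh : Fˣ →* ℂ := ⟨⟨η, by simp [hη, hl1]⟩, hηm⟩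
    let χ : MulChar F ℂ := MulChar.ofUnitHom (MonoidHom.toHomUnits ηh)
    have hχ : ∀ x : Fˣ, χ x = η x := by
      intro x
      simp [χ]; rfl
    have hχ1 : χ ≠ 1 := by
      intro h
      apply hx0
      rw [← hχ, h]; simp
    have hχq : χ.IsQuadratic := by
      intro a
      by_cases ha : a = 0
      · left; rw [ha]; exact MulChar.map_zero χ
      · right
        have := hη1 (Units.mk0 a ha)
        rwa [← hχ] at this
    have hG : ∀ s : F, S s = gaussSum χ (ψ.mulShift (-s)) := by
      intro s
      unfold gaussSum
      rw [sum_eq_zero_add_units, MulChar.map_zero χ, zero_mul, zero_add]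
      refine Finset.sum_congr rfl fun x _ => ?_
      rw [hχ, AddChar.mulShift_apply, mul_comm, neg_mul]
    have hS0 : S 0 = 0 := by
      have h2 : ∑ x : Fˣ, η x = 0 := by
        have h3 : (∑ x : Fˣ, η x) = η x0 * ∑ x : Fˣ, η x := by
          rw [Finset.mul_sum]
          refine Fintype.sum_equiv (Equiv.mulLeft x0⁻¹) _ _ fun x => ?_
          rw [← hηm]; simp
        have h4 : (1 - η x0) * ∑ x : Fˣ, η x = 0 := by linear_combination h3
        exact (mul_eq_zero.1 h4).resolve_left (sub_ne_zero.2 (Ne.symm hx0))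
      simpa [hS] using h2
    have hc2 : c ^ 2 = q⁻¹ := by rw [hcc, hS0]; ring
    have hη_neg : η (-1) = 1 := by simp [hη, hl1]
    set g := gaussSum χ ψ with hg
    have hg2 : g ^ 2 = q := by
      rw [hg, gaussSum_sq hχ1 hχq hψ]
      have : χ (-1) = 1 := by
        have := hχ (-1)
        rw [hη_neg] at this
        simpa using this
      rw [this, one_mul]
    have hSs : ∀ s : Fˣ, S s = η s * g := by
      intro s
      have h2 := gaussSum_mulShift χ ψ (-s)
      rw [hχ, ← neg_one_mul, hηm, hη_neg, one_mul] at h2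
      rw [hG, hg, ← h2, ← mul_assoc]
      have : η s * η s = 1 := by rcases hη1 s with h | h <;> simp [h]
      rw [this, one_mul]; simp
    have hcg : c * g = 1 ∨ c * g = -1 := by
      apply mul_self_eq_one_iff.1
      have : c * g * (c * g) = c ^ 2 * g ^ 2 := by ring
      rw [this, hc2, hg2, inv_mul_cancel₀ hq0]
    refine ⟨?_, hc2, x0, hx0⟩
    have hr : ∀ s : Fˣ, (Module.finrank ℂ (LinearMap.range (A.e ψ ρ s)) : ℂ) =
        (1 + (c * g) * η s) / 2 := by
      intro s
      by_cases h : 1 + c * S s = 0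
      · rw [hr2 s h]
        rw [hSs] at h
        have : 1 + c * g * η s = 0 := by linear_combination h
        rw [this]; simp
      · rw [hr1 s h]
        rw [hSs] at h
        have h2 : c * g * η s = 1 ∨ c * g * η s = -1 := by
          rcases hcg with h1 | h1 <;> rcases hη1 s with h2 | h2 <;> simp [h1, h2]
        rcases h2 with h2 | h2
        · rw [h2]; norm_num
        · exact absurd (by linear_combination h2) h
    have hη_sum : ∑ x : Fˣ, η x = 0 := by simpa [hS] using hS0
    have : (2 * Module.finrank ℂ V : ℂ) = q + 1 := by
      rw [hfr]
      push_cast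
      rw [Finset.sum_congr rfl fun s _ => hr s, ← Finset.sum_div, Finset.sum_add_distrib,
        ← Finset.mul_sum, hη_sum]
      simp only [Finset.sum_const, Finset.card_univ, nsmul_eq_mul, mul_one, hcu]
      ring
    rw [hq] at this
    exact_mod_cast this

end Ax

set_option linter.unusedSectionVars false
namespace Ax

variable {F N : Type} [Field F] [Fintype F] [DecidableEq F] [Group N] {Δ : Subgroup Fˣ}
  (A : Ax F N Δ)
variable {V : Type} [AddCommGroup V] [Module ℂ V] {ψ : AddChar F ℂ} (hψ : ψ.IsPrimitive)
  (ρ : N →* (V →ₗ[ℂ] V))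

/-- `e₀ g v` is a fixed multiple of `v` -/
theorem e0g {v : V} (hv : ∀ x, ρ (A.u x) v = v) {γ : Fˣ} (hγ : γ ∈ Δ) {l c : ℂ}
    (hl : ρ (A.t γ) v = l • v) (hc : A.e ψ ρ 0 (ρ A.w v) = c • v) (x y : F) (k : ℕ) :
    A.e ψ ρ 0 (ρ (A.u x * A.t (γ ^ k)) v) = (l ^ k) • v ∧
    A.e ψ ρ 0 (ρ (A.u x * A.t (γ ^ k) * A.w * A.u y) v) = (c * l ^ k) • v := by
  constructor
  · rw [rmul_apply, eu0, A.t_pow ρ hγ hl, map_smul, A.e_fix0 ρ hv]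
  · simp only [rmul_apply]
    rw [eu0, hv, ← te0 _ _ (Δ.pow_mem hγ k), hc, map_smul, A.t_pow ρ hγ hl, smul_smul]

/-- uniqueness of non generic principal series -/
theorem principal_iso {V' : Type} [AddCommGroup V'] [Module ℂ V'] (ρ' : N →* (V' →ₗ[ℂ] V'))
    (hρ : Irr ρ) (hρ' : Irr ρ') {γ : Fˣ} (hγ : γ ∈ Δ) (hgen : ∀ a ∈ Δ, ∃ k : ℕ, a = γ ^ k) {l c : ℂ}
    {v : V} (hv0 : v ≠ 0) (hv : ∀ x, ρ (A.u x) v = v)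
    (hl : ρ (A.t γ) v = l • v) (hc : A.e ψ ρ 0 (ρ A.w v) = c • v)
    {v' : V'} (hv0' : v' ≠ 0) (hv' : ∀ x, ρ' (A.u x) v' = v')
    (hl' : ρ' (A.t γ) v' = l • v') (hc' : A.e ψ ρ' 0 (ρ' A.w v') = c • v') : RIso ρ ρ' := by
  let σ : N →* ((V × V') →ₗ[ℂ] (V × V')) :=
    { toFun := fun g => (ρ g).prodMap (ρ' g)
      map_one' := by ext <;> simp
      map_mul' := fun g h => by ext <;> simp }
  have hσ : ∀ g x y, σ g (x, y) = (ρ g x, ρ' g y) := fun g x y => rfl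
  let X : Submodule ℂ (V × V') := Submodule.span ℂ (Set.range fun g => σ g (v, v'))
  have hX : ∀ g, ∀ y ∈ X, σ g y ∈ X := by
    intro g
    have : X ≤ X.comap (σ g) := by
      change Submodule.span ℂ _ ≤ _
      rw [Submodule.span_le]
      rintro _ ⟨h, rfl⟩
      refine Submodule.subset_span ⟨g * h, ?_⟩
      simp only [rmul_apply]
    exact this
  have hvX : (v, v') ∈ X := Submodule.subset_span ⟨1, by simp⟩
  have hk : ∀ y ∈ X, ∃ k : ℂ, A.e ψ ρ 0 y.1 = k • v ∧ A.e ψ ρ' 0 y.2 = k • v' := by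
    intro y hy
    induction hy using Submodule.span_induction with
    | mem y hy =>
      obtain ⟨g, rfl⟩ := hy
      simp only [hσ]
      obtain ⟨x, a, ha, h⟩ := A.bruhat g
      obtain ⟨k, rfl⟩ := hgen a ha
      obtain rfl | ⟨y, rfl⟩ := h
      · exact ⟨_, (A.e0g ρ hv hγ hl hc x 0 k).1, (A.e0g ρ' hv' hγ hl' hc' x 0 k).1⟩
      · exact ⟨_, (A.e0g ρ hv hγ hl hc x y k).2, (A.e0g ρ' hv' hγ hl' hc' x y k).2⟩
    | zero => exact ⟨0, by simp, by simp⟩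
    | add a b _ _ h1 h2 =>
      obtain ⟨k1, h1, h1'⟩ := h1
      obtain ⟨k2, h2, h2'⟩ := h2
      refine ⟨k1 + k2, ?_, ?_⟩
      · simp [h1, h2, add_smul]
      · simp [h1', h2', add_smul]
    | smul a b _ h1 =>
      obtain ⟨k1, h1, h1'⟩ := h1
      refine ⟨a * k1, ?_, ?_⟩
      · simp [h1, mul_smul]
      · simp [h1', mul_smul]
  have hev : A.e ψ ρ 0 v = v := A.e_fix0 ρ hv
  have hev' : A.e ψ ρ' 0 v' = v' := A.e_fix0 ρ' hv'
  have hK1 : X.comap (LinearMap.inr ℂ V V') = ⊥ := by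
    refine (hρ'.2 _ ?_).resolve_right ?_
    · intro g y hy
      have := hX g _ hy
      simpa [hσ] using this
    · intro h
      have h1 : v' ∈ X.comap (LinearMap.inr ℂ V V') := by rw [h]; trivial
      obtain ⟨k, h2, h3⟩ := hk _ h1
      simp only [LinearMap.inr_apply, map_zero] at h2 h3
      rcases smul_eq_zero.1 h2.symm with rfl | h4
      · rw [hev', zero_smul] at h3; exact hv0' h3
      · exact hv0 h4
  have hK2 : X.comap (LinearMap.inl ℂ V V') = ⊥ := by
    refine (hρ.2 _ ?_).resolve_right ?_
    · intro g y hy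
      have := hX g _ hy
      simpa [hσ] using this
    · intro h
      have h1 : v ∈ X.comap (LinearMap.inl ℂ V V') := by rw [h]; trivial
      obtain ⟨k, h2, h3⟩ := hk _ h1
      simp only [LinearMap.inl_apply, map_zero] at h2 h3
      rcases smul_eq_zero.1 h3.symm with rfl | h4
      · rw [hev, zero_smul] at h2; exact hv0 h2
      · exact hv0' h4
  have hM1 : X.map (LinearMap.fst ℂ V V') = ⊤ := by
    refine (hρ.2 _ ?_).resolve_left ?_
    · rintro g _ ⟨y, hy, rfl⟩
      exact ⟨_, hX g y hy, rfl⟩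
    · intro h
      have : v ∈ X.map (LinearMap.fst ℂ V V') := ⟨_, hvX, rfl⟩
      rw [h] at this
      exact hv0 ((Submodule.mem_bot ℂ).1 this)
  have hM2 : X.map (LinearMap.snd ℂ V V') = ⊤ := by
    refine (hρ'.2 _ ?_).resolve_left ?_
    · rintro g _ ⟨y, hy, rfl⟩
      exact ⟨_, hX g y hy, rfl⟩
    · intro h
      have : v' ∈ X.map (LinearMap.snd ℂ V V') := ⟨_, hvX, rfl⟩
      rw [h] at this
      exact hv0' ((Submodule.mem_bot ℂ).1 this)
  have i1 : RIso (subRep σ X hX) ρ := by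
    refine ⟨LinearEquiv.ofBijective ((LinearMap.fst ℂ V V').domRestrict X) ⟨?_, ?_⟩, ?_⟩
    · rw [← LinearMap.ker_eq_bot, LinearMap.ker_eq_bot']
      rintro ⟨⟨a, b⟩, hab⟩ h
      have ha : a = 0 := h
      subst ha
      have : b ∈ X.comap (LinearMap.inr ℂ V V') := hab
      rw [hK1] at this
      have hb := (Submodule.mem_bot ℂ).1 this
      subst hb
      rfl
    · intro y
      have : y ∈ X.map (LinearMap.fst ℂ V V') := by rw [hM1]; trivial
      obtain ⟨z, hz, rfl⟩ := this
      exact ⟨⟨z, hz⟩, rfl⟩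
    · intro g y; rfl
  have i2 : RIso (subRep σ X hX) ρ' := by
    refine ⟨LinearEquiv.ofBijective ((LinearMap.snd ℂ V V').domRestrict X) ⟨?_, ?_⟩, ?_⟩
    · rw [← LinearMap.ker_eq_bot, LinearMap.ker_eq_bot']
      rintro ⟨⟨a, b⟩, hab⟩ h
      have ha : b = 0 := h
      subst ha
      have : a ∈ X.comap (LinearMap.inl ℂ V V') := hab
      rw [hK2] at this
      have hb := (Submodule.mem_bot ℂ).1 this
      subst hb
      rfl
    · intro y
      have : y ∈ X.map (LinearMap.snd ℂ V V') := by rw [hM2]; trivial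
      obtain ⟨z, hz, rfl⟩ := this
      exact ⟨⟨z, hz⟩, rfl⟩
    · intro g y; rfl
  exact i1.symm.trans i2

include A in
/-- `Δ` has index at most two -/
theorem index_two {a b : Fˣ} (ha : a ∉ Δ) (hb : b ∉ Δ) : a * b ∈ Δ := by
  obtain ⟨ζ, hζ⟩ := IsCyclic.exists_generator (α := Fˣ)
  obtain ⟨i, rfl⟩ := Subgroup.mem_zpowers_iff.1 (hζ a)
  obtain ⟨j, rfl⟩ := Subgroup.mem_zpowers_iff.1 (hζ b)
  have h2 : ∀ k : ℤ, ζ ^ (2 * k) ∈ Δ := by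
    intro k
    have := A.sq (ζ ^ k)
    rwa [← zpow_natCast, ← zpow_mul, mul_comm] at this
  have hodd : ∀ k : ℤ, ζ ^ k ∉ Δ → k % 2 = 1 := by
    intro k hk
    rcases Int.emod_two_eq_zero_or_one k with h | h
    · exact absurd (by have := h2 (k / 2); rwa [show 2 * (k / 2) = k by omega] at this) hk
    · exact h
  rw [← zpow_add]
  have h1 := hodd i ha
  have h3 := hodd j hb
  have := h2 ((i + j) / 2)
  rwa [show 2 * ((i + j) / 2) = i + j by omega] at this

/-- invariants of a non generic principal series -/
def PInv (γ : Fˣ) (ψ : AddChar F ℂ) (l c : ℂ) : Prop :=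
  ∃ v : V, v ≠ 0 ∧ (∀ x, ρ (A.u x) v = v) ∧ ρ (A.t γ) v = l • v ∧ A.e ψ ρ 0 (ρ A.w v) = c • v

include hψ in
theorem principal [FiniteDimensional ℂ V] (hρ : Irr ρ) {γ : Fˣ} (hγ : γ ∈ Δ)
    (hgen : ∀ a ∈ Δ, ∃ k : ℕ, a = γ ^ k) (h : ∃ v : V, v ≠ 0 ∧ ∀ x, ρ (A.u x) v = v) :
    Module.finrank ℂ V = Fintype.card F + 1 ∨ ∃ l c, A.PInv ρ γ ψ l c ∧ (l = 1 ∨ l = -1) ∧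
    ((c = 1 ∧ Module.finrank ℂ V = 1) ∨
      (c = -(Fintype.card F : ℂ)⁻¹ ∧ Module.finrank ℂ V = Fintype.card F) ∨
      (2 * Module.finrank ℂ V = Fintype.card F + 1 ∧ c ^ 2 = (Fintype.card F : ℂ)⁻¹ ∧
        l = -1 ∧ -1 ∈ Δ ∧ Δ ≠ ⊤)) := by
  classical
  obtain ⟨v, l0, hv0, hv, hl0⟩ := A.exists_eigen ρ hγ h
  let l : Fˣ → ℂ := fun a => if h : a ∈ Δ then l0 ^ (hgen a h).choose else 1
  have hl : ∀ a ∈ Δ, ρ (A.t a) v = l a • v := by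
    intro a ha
    simp only [l, dif_pos ha]
    conv_lhs => rw [(hgen a ha).choose_spec]
    exact A.t_pow ρ hγ hl0 _
  by_cases hne : ∃ a ∈ Δ, l a ≠ l a⁻¹
  · exact Or.inl (A.principal_one hψ ρ hρ hv0 hv hl hne)
  right
  push Not at hne
  obtain ⟨v1, c, hv10, hv1, hl1, hc⟩ := A.principal_eigen hψ ρ hρ hv0 hv hl hne
  have hlv : ∀ a b, a ∈ Δ → b ∈ Δ → l (a * b) = l a * l b := by
    intro a b ha hb
    have h1 := hl1 _ (Δ.mul_mem ha hb)
    rw [A.t_mul a ha b hb, rmul_apply, hl1 b hb, map_smul, hl1 a ha, smul_smul] at h1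
    have h2 : (l (a * b) - l a * l b) • v1 = 0 := by
      rw [sub_smul, ← h1, mul_comm (l a), sub_self]
    exact sub_eq_zero.1 ((smul_eq_zero.1 h2).resolve_right hv10)
  have hlone : l 1 = 1 := by
    have := hl1 1 Δ.one_mem
    rw [A.t_one, map_one, Module.End.one_apply] at this
    have h2 : (l 1 - 1) • v1 = 0 := by rw [sub_smul, one_smul, ← this, sub_self]
    exact sub_eq_zero.1 ((smul_eq_zero.1 h2).resolve_right hv10)
  have hsq : ∀ a ∈ Δ, l (a ^ 2) = 1 := by
    intro a ha
    rw [pow_two, hlv a a ha ha]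
    nth_rw 2 [hne a ha]
    rw [← hlv _ _ ha (Δ.inv_mem ha), mul_inv_cancel, hlone]
  have hlγ : l γ = 1 ∨ l γ = -1 := by
    apply mul_self_eq_one_iff.1
    rw [← hlv _ _ hγ hγ, ← pow_two, hsq _ hγ]
  refine ⟨l γ, c, ⟨v1, hv10, hv1, hl1 γ hγ, hc⟩, hlγ, ?_⟩
  rcases A.principal_two hψ ρ hρ hv10 hv1 hl1 hne hc with h | h | ⟨h1, h2, x, hx⟩
  · exact Or.inl h
  · exact Or.inr (Or.inl h)
  · right; right
    have hxΔ : x ∉ Δ := fun h => hx (hsq x h)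
    refine ⟨h1, h2, ?_, ?_, ?_⟩
    · refine hlγ.resolve_left fun h3 => hx ?_
      obtain ⟨k, hk⟩ := hgen _ (A.sq x)
      have h4 := hl1 _ (A.sq x)
      rw [hk, A.t_pow ρ hγ (hl1 γ hγ), h3, one_pow, ← hk, one_smul] at h4
      have h5 : (l (x ^ 2) - 1) • v1 = 0 := by rw [sub_smul, one_smul, ← h4, sub_self]
      exact sub_eq_zero.1 ((smul_eq_zero.1 h5).resolve_right hv10)
    · by_contra h3
      have := hsq _ (A.index_two h3 hxΔ)
      apply hx
      rw [← this]; simp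
    · intro h3
      rw [h3] at hxΔ
      exact hxΔ trivial

end Ax

set_option linter.unusedSectionVars false
namespace Ax

section gelfand
variable {F N : Type} [Field F] [Fintype F] [DecidableEq F] [Group N] {Δ : Subgroup Fˣ}
  (A : Ax F N Δ)
variable {R : Type} [Ring R] [Algebra ℂ R] {ψ : AddChar F ℂ} (hψ : ψ.IsPrimitive) (φ : N →* R)

include hψ

theorem ete {a : Fˣ} (ha : a ∈ Δ) {s : F} (hs : s ≠ 0) (h1 : a ≠ 1) :
    A.e ψ φ s * φ (A.t a) * A.e ψ φ s = 0 := by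
  rw [mul_assoc, t_e _ _ _ ha, ← mul_assoc, A.e_e φ hψ, if_neg, zero_mul]
  intro h
  apply h1
  have : s * ((a⁻¹ : Fˣ) : F) = s * 1 := by rw [← h, mul_one]
  have := mul_left_cancel₀ hs this
  rw [← inv_inj, inv_one]
  exact Units.ext this

theorem e_ι (g : N) {s : F} (hs : s ≠ 0) :
    A.e ψ φ s * φ g * A.e ψ φ s = A.e ψ φ s * φ (A.ι g) * A.e ψ φ s := by
  obtain ⟨x, a, ha, rfl | ⟨y, rfl⟩⟩ := A.bruhat g
  · rw [A.ι_mul, A.ι_u, A.ι_t a ha, map_mul, map_mul]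
    have e1 : A.e ψ φ s * (φ (A.u x) * φ (A.t a)) * A.e ψ φ s =
        ψ (s * x) • (A.e ψ φ s * φ (A.t a) * A.e ψ φ s) := by
      rw [← mul_assoc, e_u, smul_mul_assoc, smul_mul_assoc]
    have e2 : A.e ψ φ s * (φ (A.t a⁻¹) * φ (A.u x)) * A.e ψ φ s =
        ψ (s * x) • (A.e ψ φ s * φ (A.t a⁻¹) * A.e ψ φ s) := by
      rw [mul_assoc, mul_assoc, u_e, mul_smul_comm, mul_smul_comm, mul_assoc]
    rw [e1, e2]
    by_cases h1 : a = 1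
    · rw [h1, inv_one]
    · rw [A.ete hψ φ ha hs h1, A.ete hψ φ (Δ.inv_mem ha) hs (by simpa using h1)]
  · simp only [A.ι_mul, A.ι_u, A.ι_t a ha, A.ι_w, map_mul]
    have e1 : A.e ψ φ s * (φ (A.u x) * φ (A.t a) * φ A.w * φ (A.u y)) * A.e ψ φ s =
        ψ (s * x) • ψ (s * y) • (A.e ψ φ s * φ (A.t a) * φ A.w * A.e ψ φ s) := by
      simp only [← mul_assoc, e_u, smul_mul_assoc]
      rw [mul_assoc _ (φ (A.u y)), u_e, mul_smul_comm]
    have e2 : A.e ψ φ s * (φ (A.u y) * (φ A.w * (φ (A.t a⁻¹) * φ (A.u x)))) * A.e ψ φ s =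
        ψ (s * x) • ψ (s * y) • (A.e ψ φ s * φ (A.t a) * φ A.w * A.e ψ φ s) := by
      rw [← mul_assoc (φ A.w), ← map_mul, A.wt _ (Δ.inv_mem ha), inv_inv, map_mul]
      simp only [← mul_assoc, e_u, smul_mul_assoc]
      rw [mul_assoc _ (φ (A.u x)), u_e, mul_smul_comm, smul_comm]
    rw [e1, e2]

omit hψ in
theorem e_exp (g h : N) (s : F) : A.e ψ φ s * φ g * A.e ψ φ s * φ h * A.e ψ φ s =
    (Fintype.card F : ℂ)⁻¹ • ∑ x, ψ (-(s * x)) •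
      (A.e ψ φ s * φ (g * A.u x * h) * A.e ψ φ s) := by
  have : A.e ψ φ s * φ g * A.e ψ φ s * φ h * A.e ψ φ s = A.e ψ φ s * φ g *
      ((Fintype.card F : ℂ)⁻¹ • ∑ x, ψ (-(s * x)) • φ (A.u x)) * φ h * A.e ψ φ s := by
    conv_lhs => rw [mul_assoc, mul_assoc, mul_assoc]
    conv_rhs => rw [mul_assoc, mul_assoc, mul_assoc]
    rfl
  rw [this, mul_smul_comm, smul_mul_assoc, smul_mul_assoc, Finset.mul_sum, Finset.sum_mul,
    Finset.sum_mul]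
  congr 1
  refine Finset.sum_congr rfl fun x _ => ?_
  rw [mul_smul_comm, smul_mul_assoc, smul_mul_assoc]
  simp only [map_mul, mul_assoc]

/-- Gelfand's trick -/
theorem e_comm (g h : N) {s : F} (hs : s ≠ 0) :
    A.e ψ φ s * φ g * A.e ψ φ s * φ h * A.e ψ φ s =
    A.e ψ φ s * φ h * A.e ψ φ s * φ g * A.e ψ φ s := by
  rw [A.e_exp]
  have h1 : ∀ x, A.e ψ φ s * φ (g * A.u x * h) * A.e ψ φ s =
      A.e ψ φ s * φ (A.ι h * A.u x * A.ι g) * A.e ψ φ s := by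
    intro x
    rw [A.e_ι hψ φ _ hs, A.ι_mul, A.ι_mul, A.ι_u, mul_assoc (A.ι h)]
  simp_rw [h1]
  rw [← A.e_exp, ← A.e_ι hψ φ h hs, mul_assoc, mul_assoc, ← mul_assoc (A.e ψ φ s) (φ (A.ι g)),
    ← A.e_ι hψ φ g hs]
  simp only [mul_assoc]

end gelfand

variable {F N : Type} [Field F] [Fintype F] [DecidableEq F] [Group N] {Δ : Subgroup Fˣ}
  (A : Ax F N Δ)
variable {V : Type} [AddCommGroup V] [Module ℂ V] {ψ : AddChar F ℂ} (hψ : ψ.IsPrimitive)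
  (ρ : N →* (V →ₗ[ℂ] V))

theorem span_orbit (hρ : Irr ρ) {v : V} (hv0 : v ≠ 0) :
    Submodule.span ℂ (Set.range fun g => ρ g v) = ⊤ := by
  refine (hρ.2 _ ?_).resolve_left ?_
  · intro g
    set p := Submodule.span ℂ (Set.range fun g => ρ g v) with hp
    have : p ≤ p.comap (ρ g) := by
      rw [hp, Submodule.span_le]
      rintro _ ⟨h, rfl⟩
      refine Submodule.subset_span ⟨g * h, ?_⟩
      simp only [rmul_apply]
    exact this
  · intro h
    have : v ∈ Submodule.span ℂ (Set.range fun g => ρ g v) := Submodule.subset_span ⟨1, by simp⟩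
    rw [h] at this
    exact hv0 ((Submodule.mem_bot ℂ).1 this)

theorem range_span (hρ : Irr ρ) {v : V} (hv0 : v ≠ 0) (s : F) :
    LinearMap.range (A.e ψ ρ s) = Submodule.span ℂ (Set.range fun g => A.e ψ ρ s (ρ g v)) := by
  rw [LinearMap.range_eq_map, ← span_orbit ρ hρ hv0, Submodule.map_span, ← Set.range_comp]
  rfl

include hψ

/-- multiplicity one for nontrivial characters of `U` -/
theorem mult_one [FiniteDimensional ℂ V] (hρ : Irr ρ) {s : F} (hs : s ≠ 0) {v : V} (hv0 : v ≠ 0)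
    (hv : A.e ψ ρ s v = v) : LinearMap.range (A.e ψ ρ s) = Submodule.span ℂ {v} := by
  set p := LinearMap.range (A.e ψ ρ s) with hp
  have hvp : v ∈ p := ⟨v, hv⟩
  have : Nontrivial p := ⟨⟨⟨v, hvp⟩, 0, fun h => hv0 (congrArg Subtype.val h)⟩⟩
  have hfix : ∀ y ∈ p, A.e ψ ρ s y = y := by
    rintro _ ⟨y, rfl⟩; exact A.ee hψ ρ s y
  have hsc : ∀ g, ∃ μ : ℂ, ∀ y ∈ p, A.e ψ ρ s (ρ g y) = μ • y := by
    intro g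
    obtain ⟨μ, hμ⟩ := Module.End.exists_eigenvalue
      ((A.e ψ ρ s ∘ₗ ρ g).restrict (p := p) (q := p) (fun y _ => ⟨_, rfl⟩))
    obtain ⟨⟨z, hz⟩, hev⟩ := hμ.exists_hasEigenvector
    have hz0 : z ≠ 0 := fun h => hev.2 (Subtype.ext h)
    have hz1 : A.e ψ ρ s (ρ g z) = μ • z := congrArg Subtype.val hev.apply_eq_smul
    refine ⟨μ, ?_⟩
    have hle : p ≤ LinearMap.ker (A.e ψ ρ s ∘ₗ ρ g - μ • LinearMap.id) := by
      rw [hp, A.range_span ρ hρ hz0, Submodule.span_le]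
      rintro _ ⟨h, rfl⟩
      have hc := congrArg (fun f : V →ₗ[ℂ] V => f z) (A.e_comm hψ ρ g h hs)
      simp only [Module.End.mul_apply, hfix z hz, hz1, map_smul] at hc
      simp [hc]
    intro y hy
    have := hle hy
    simpa [sub_eq_zero] using this
  apply le_antisymm
  · rw [hp, A.range_span ρ hρ hv0, Submodule.span_le]
    rintro _ ⟨g, rfl⟩
    obtain ⟨μ, hμ⟩ := hsc g
    simp only [hμ v hvp]
    exact Submodule.smul_mem _ _ (Submodule.subset_span rfl)
  · rw [Submodule.span_le]
    rintro y rfl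
    exact hvp

omit hψ in
theorem supp_stable {s : F} {a : Fˣ} (ha : a ∈ Δ) (h : A.e ψ ρ s ≠ 0) :
    A.e ψ ρ (s * (a : Fˣ)) ≠ 0 := by
  intro h1
  apply h
  ext v
  have := A.te (ψ := ψ) ρ (Δ.inv_mem ha) s (ρ (A.t a) v)
  rw [inv_inv, h1, tinv _ _ ha] at this
  rw [← A.tinv ρ (Δ.inv_mem ha) (A.e ψ ρ s v), A.te ρ (Δ.inv_mem ha), inv_inv, h1]
  simp

/-- dimension of cuspidal representations -/
theorem cuspidal_dim [FiniteDimensional ℂ V] (hρ : Irr ρ) (h0 : A.e ψ ρ 0 = 0) :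
    Module.finrank ℂ V = Fintype.card F - 1 ∨
    (Δ ≠ ⊤ ∧ 2 * Module.finrank ℂ V = Fintype.card F - 1 ∧
      ∃ s : Fˣ, ∀ r : Fˣ, A.e ψ ρ r ≠ 0 ↔ r * s⁻¹ ∈ Δ) := by
  classical
  have hr : ∀ s : Fˣ, Module.finrank ℂ (LinearMap.range (A.e ψ ρ s)) =
      if A.e ψ ρ s ≠ 0 then 1 else 0 := by
    intro s
    split_ifs with h
    · obtain ⟨v, hv⟩ : ∃ v, A.e ψ ρ s v ≠ 0 := by
        by_contra hcon
        push Not at hcon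
        exact h (LinearMap.ext hcon)
      rw [A.mult_one hψ ρ hρ s.ne_zero hv (A.ee hψ ρ s v), finrank_span_singleton hv]
    · push Not at h
      rw [h]; simp
  have hfr : Module.finrank ℂ V = (Finset.univ.filter fun s : Fˣ => A.e ψ ρ s ≠ 0).card := by
    rw [A.finrank_eq hψ ρ, sum_eq_zero_add_units, h0, Finset.card_filter,
      Finset.sum_congr rfl fun s _ => hr s]
    simp
  have hex : ∃ s : Fˣ, A.e ψ ρ s ≠ 0 := by
    by_contra hcon
    push Not at hcon
    obtain ⟨v, hv⟩ := hρ.1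
    apply hv
    rw [← A.sum_ev hψ ρ v, sum_eq_zero_add_units, h0]
    simp [hcon]
  obtain ⟨s, hs⟩ := hex
  have hst : ∀ r : Fˣ, r * s⁻¹ ∈ Δ → A.e ψ ρ r ≠ 0 := by
    intro r hr
    have := A.supp_stable ρ hr hs
    rw [← Units.val_mul] at this
    simpa [mul_comm] using this
  by_cases hall : ∀ r : Fˣ, A.e ψ ρ r ≠ 0
  · left
    rw [hfr, Finset.filter_true_of_mem fun x _ => hall x, Finset.card_univ, Fintype.card_units]
  · right
    push Not at hall
    obtain ⟨r0, hr0⟩ := hall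
    have hr0Δ : r0 * s⁻¹ ∉ Δ := fun h => hst r0 h hr0
    have hiff : ∀ r : Fˣ, A.e ψ ρ r ≠ 0 ↔ r * s⁻¹ ∈ Δ := by
      intro r
      refine ⟨fun h => ?_, hst r⟩
      by_contra h1
      have h2 := A.index_two (Δ := Δ) (a := (r * s⁻¹)⁻¹) (b := r0 * s⁻¹) (Δ.inv_mem_iff.not.2 h1) hr0Δ
      have := A.supp_stable ρ h2 h
      rw [← Units.val_mul] at this
      apply this
      have h3 : r * ((r * s⁻¹)⁻¹ * (r0 * s⁻¹)) = r0 := by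
        apply Units.ext; push_cast; field_simp
      rw [h3, hr0]
    refine ⟨?_, ?_, s, hiff⟩
    · intro h; rw [h] at hr0Δ; exact hr0Δ trivial
    · have h1 : (Finset.univ.filter fun r : Fˣ => A.e ψ ρ r ≠ 0).card =
          (Finset.univ.filter fun r : Fˣ => ¬ A.e ψ ρ r ≠ 0).card := by
        refine Finset.card_bij (fun r _ => r * (r0 * s⁻¹)) ?_ ?_ ?_
        · intro r hr
          simp only [Finset.mem_filter, Finset.mem_univ, true_and, hiff] at hr ⊢
          intro h
          apply hr0Δ
          have := Δ.mul_mem (Δ.inv_mem hr) h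
          convert this using 1
          apply Units.ext; push_cast; field_simp
        · intro a _ b _ h; exact mul_right_cancel h
        · intro r hr
          simp only [Finset.mem_filter, Finset.mem_univ, true_and, hiff] at hr
          refine ⟨r * (r0 * s⁻¹)⁻¹, ?_, by group⟩
          simp only [Finset.mem_filter, Finset.mem_univ, true_and, hiff]
          have := A.index_two (Δ := Δ) hr (b := (r0 * s⁻¹)⁻¹) (Δ.inv_mem_iff.not.2 hr0Δ)
          convert this using 1
          rw [mul_right_comm]
      have h2 := Finset.card_filter_add_card_filter_not (s := (Finset.univ : Finset Fˣ)) (fun r : Fˣ => A.e ψ ρ r ≠ 0)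
      rw [Finset.card_univ, Fintype.card_units] at h2
      rw [hfr]; omega

end Ax

set_option linter.unusedSectionVars false

theorem index_two' {F : Type} [Field F] [Fintype F] {D : Subgroup Fˣ} (hsq : ∀ a : Fˣ, a ^ 2 ∈ D)
    {a b : Fˣ} (ha : a ∉ D) (hb : b ∉ D) : a * b ∈ D := by
  obtain ⟨ζ, hζ⟩ := IsCyclic.exists_generator (α := Fˣ)
  obtain ⟨i, rfl⟩ := Subgroup.mem_zpowers_iff.1 (hζ a)
  obtain ⟨j, rfl⟩ := Subgroup.mem_zpowers_iff.1 (hζ b)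
  have h2 : ∀ k : ℤ, ζ ^ (2 * k) ∈ D := by
    intro k
    have := hsq (ζ ^ k)
    rwa [← zpow_natCast, ← zpow_mul, mul_comm] at this
  have hodd : ∀ k : ℤ, ζ ^ k ∉ D → k % 2 = 1 := by
    intro k hk
    rcases Int.emod_two_eq_zero_or_one k with h | h
    · exact absurd (by have := h2 (k / 2); rwa [show 2 * (k / 2) = k by omega] at this) hk
    · exact h
  rw [← zpow_add]
  have h1 := hodd i ha
  have h3 := hodd j hb
  have := h2 ((i + j) / 2)
  rwa [show 2 * ((i + j) / 2) = i + j by omega] at this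

namespace Ax

variable {F N : Type} [Field F] [Fintype F] [DecidableEq F] [Group N] {Δ : Subgroup Fˣ}
  (A : Ax F N Δ)
variable {V : Type} [AddCommGroup V] [Module ℂ V] {ψ : AddChar F ℂ} (hψ : ψ.IsPrimitive)
  (ρ : N →* (V →ₗ[ℂ] V))

include A in
theorem isSq (h : Δ ≠ ⊤) {a : Fˣ} (ha : a ∈ Δ) : ∃ b : Fˣ, a = b ^ 2 := by
  by_contra hcon
  apply h
  rw [eq_top_iff]
  intro b _
  by_contra hb
  let D : Subgroup Fˣ := (powMonoidHom 2 : Fˣ →* Fˣ).range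
  have haD : a ∉ D := by
    rintro ⟨x, hx⟩; exact hcon ⟨x, hx.symm⟩
  have hbD : b ∉ D := by
    rintro ⟨x, hx⟩
    apply hb; rw [← hx]; exact A.sq x
  obtain ⟨x, hx⟩ := index_two' (D := D) (fun a => ⟨a, rfl⟩) haD hbD
  apply hb
  have h1 : a * b ∈ Δ := by rw [← hx]; exact A.sq x
  exact (Δ.mul_mem_cancel_left ha).1 h1

include A in
theorem two_ne (h : Δ ≠ ⊤) : (2 : F) ≠ 0 := by
  intro h2
  apply h
  rw [eq_top_iff]
  intro b _
  have hch : ringChar F = 2 := by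
    have h3 : ringChar F ∣ 2 := (ringChar.spec F 2).1 (by exact_mod_cast h2)
    rcases (Nat.dvd_prime Nat.prime_two).1 h3 with h4 | h4
    · have := (ringChar.spec F 1).2 (by rw [h4])
      simp at this
    · exact h4
  obtain ⟨c, hc⟩ := FiniteField.isSquare_of_char_two hch (b : F)
  have hc0 : c ≠ 0 := by
    rintro rfl
    simp at hc
  have : b = (Units.mk0 c hc0) ^ 2 := by
    apply Units.ext; rw [hc]; simp [pow_two]
  rw [this]; exact A.sq _

include hψ

theorem half_excl (hΔ : Δ ≠ ⊤) (h1 : -1 ∈ Δ) (hρ : Irr ρ)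
    [FiniteDimensional ℂ V] (h0 : A.e ψ ρ 0 = 0) (s : Fˣ)
    (hiff : ∀ r : Fˣ, A.e ψ ρ r ≠ 0 ↔ r * s⁻¹ ∈ Δ) : False := by
  have hs : A.e ψ ρ s ≠ 0 := by rw [hiff]; simp
  have h2 := A.two_ne hΔ
  obtain ⟨v, hv⟩ : ∃ v, A.e ψ ρ s v ≠ 0 := by
    by_contra hcon
    push Not at hcon
    exact hs (LinearMap.ext hcon)
  have hv1 := A.ee hψ ρ s v
  have hm := A.mult_one hψ ρ hρ s.ne_zero hv hv1
  generalize A.e ψ ρ s v = v at *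
  have huv : ∀ x, ρ (A.u x) v = ψ (s * x) • v := by
    intro x; rw [← hv1, ue]
  -- the torus sum
  set y := ∑ x : Fˣ, ρ (A.t (x ^ 2)) v with hy
  have hne : (-(s : F)) ≠ s := by
    intro h
    have : (2 : F) * s = 0 := by linear_combination -h
    rcases mul_eq_zero.1 this with h | h
    · exact h2 h
    · exact s.ne_zero h
  have hrel : A.e ψ ρ (-(s : F)) (ρ A.w y) = 0 := by
    have e1 : A.e ψ ρ 0 (ρ A.w v) = 0 := by rw [h0]; rfl
    rw [e_apply, smul_eq_zero] at e1
    have e2 := e1.resolve_left (inv_ne_zero A.hq0)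
    simp only [zero_mul, neg_zero, AddChar.map_zero_eq_one, one_smul] at e2
    rw [sum_eq_zero_add_units, A.u_zero, map_one, Module.End.one_apply] at e2
    have e3 := congrArg (fun z => A.e ψ ρ (-(s : F)) (ρ A.w z)) e2
    simp only [map_add, map_sum, map_zero, wwv] at e3
    have e4 : A.e ψ ρ (-(s : F)) v = 0 := by
      rw [← hv1, A.ee_ne hψ ρ hne]
    rw [e4, zero_add] at e3
    rw [hy, map_sum, map_sum, ← e3]
    refine Finset.sum_congr rfl fun x _ => ?_
    rw [wuwv, huv, eu, map_smul, map_smul, map_smul, smul_smul, ← AddChar.map_add_eq_mul, twv _ _ (A.sq _)]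
    have : (-(s : F) * -((x⁻¹ : Fˣ) : F) + s * -((x⁻¹ : Fˣ) : F)) = 0 := by ring
    rw [this, AddChar.map_zero_eq_one, one_smul]
    simp
  have hyfix : ∀ a ∈ Δ, ρ (A.t a) y = y := by
    intro a ha
    obtain ⟨b, rfl⟩ := A.isSq hΔ ha
    rw [hy, map_sum]
    refine Fintype.sum_equiv (Equiv.mulLeft b) _ _ fun x => ?_
    rw [← rmul_apply, ← A.t_mul _ ha _ (A.sq x)]
    simp [mul_pow]
  have hys : A.e ψ ρ s y = (2 : ℂ) • v := by
    rw [hy, map_sum]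
    have hterm : ∀ x : Fˣ, A.e ψ ρ s (ρ (A.t (x ^ 2)) v) = if x ^ 2 = 1 then v else 0 := by
      intro x
      split_ifs with h
      · rw [h, A.t_one, map_one, Module.End.one_apply, hv1]
      · rw [← hv1, te _ _ (A.sq x), A.ee_ne hψ]
        intro h3
        apply h
        have : (s : F) * (((x ^ 2)⁻¹ : Fˣ) : F) = s * 1 := by rw [← h3, mul_one]
        have := mul_left_cancel₀ s.ne_zero this
        rw [← inv_inj, inv_one]
        exact Units.ext this
    simp_rw [hterm]
    rw [← Finset.sum_filter]
    have : (Finset.univ.filter fun x : Fˣ => x ^ 2 = 1) = {1, -1} := by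
      ext x
      simp only [Finset.mem_filter, Finset.mem_univ, true_and, Finset.mem_insert,
        Finset.mem_singleton]
      rw [← Units.val_inj, ← Units.val_inj, ← Units.val_inj]
      simp
    rw [this, Finset.sum_pair, two_smul]
    intro h
    apply h2
    have := congrArg Units.val h
    simp only [Units.val_one, Units.val_neg] at this
    linear_combination this
  have hy0 : y ≠ 0 := by
    intro h
    rw [h, map_zero] at hys
    exact hv ((smul_eq_zero.1 hys.symm).resolve_left two_ne_zero)
  have huniq : ∀ z, (∀ a ∈ Δ, ρ (A.t a) z = z) → A.e ψ ρ s z = 0 → z = 0 := by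
    intro z hz h3
    rw [← A.sum_ev hψ ρ z, sum_eq_zero_add_units, h0, LinearMap.zero_apply, zero_add]
    refine Finset.sum_eq_zero fun r _ => ?_
    by_cases h4 : A.e ψ ρ r = 0
    · rw [h4]; rfl
    · have h5 := (hiff r).1 h4
      have := A.te (ψ := ψ) ρ (Δ.inv_mem h5) s z
      rw [h3, map_zero, hz _ (Δ.inv_mem h5)] at this
      rw [this]
      congr 2
      rw [← Units.val_mul]; congr 1
      apply Units.ext; push_cast; field_simp
  have hwy : ∃ κ : ℂ, ρ A.w y = κ • y := by
    have h3 : A.e ψ ρ s (ρ A.w y) ∈ Submodule.span ℂ {v} := by rw [← hm]; exact ⟨_, rfl⟩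
    obtain ⟨k, hk⟩ := Submodule.mem_span_singleton.1 h3
    refine ⟨k / 2, ?_⟩
    rw [← sub_eq_zero]
    apply huniq
    · intro a ha
      rw [map_sub, map_smul, hyfix a ha, twv _ _ ha, hyfix _ (Δ.inv_mem ha)]
    · rw [map_sub, map_smul, hys, ← hk, smul_smul, div_mul_cancel₀ _ two_ne_zero, sub_self]
  obtain ⟨κ, hκ⟩ := hwy
  have hκ0 : κ ≠ 0 := by
    rintro rfl
    apply hy0
    rw [← A.wwv ρ y, hκ]; simp
  rw [hκ, map_smul, smul_eq_zero] at hrel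
  have h5 := hrel.resolve_left hκ0
  have h6 := A.te (ψ := ψ) ρ h1 s y
  rw [hyfix _ h1, hys, map_smul] at h6
  have h7 : (s : F) * (((-1)⁻¹ : Fˣ) : F) = -(s : F) := by simp
  rw [h7, h5] at h6
  have h8 := (smul_eq_zero.1 h6).resolve_left two_ne_zero
  apply hv
  rw [← A.tinv ρ h1 v, h8, map_zero]

end Ax

set_option linter.unusedSectionVars false

namespace Ax

variable {F N : Type} [Field F] [Fintype F] [DecidableEq F] [Group N] {Δ : Subgroup Fˣ}
  (A : Ax F N Δ)
variable {V : Type} [AddCommGroup V] [Module ℂ V] {ψ : AddChar F ℂ} (hψ : ψ.IsPrimitive)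
  (ρ : N →* (V →ₗ[ℂ] V))

include hψ

theorem psi_units {s : F} (hs : s ≠ 0) : ∑ x : Fˣ, ψ (-(s * x)) = -1 := by
  have h1 := sum_eq_zero_add_units (fun x : F => ψ (x * (-s)))
  rw [AddChar.sum_mulShift _ hψ, if_neg (neg_ne_zero.2 hs)] at h1
  simp only [zero_mul, AddChar.map_zero_eq_one] at h1
  have h2 : ∑ x : Fˣ, ψ (-(s * x)) = ∑ x : Fˣ, ψ (x * (-s)) :=
    Finset.sum_congr rfl fun x _ => by congr 1; ring
  rw [h2]
  push_cast at h1
  linear_combination -h1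

theorem half_bound [Fintype N] [FiniteDimensional ℂ V] {γ : Fˣ} (hγ : γ ∈ Δ)
    (hgen : ∀ a ∈ Δ, ∃ k : ℕ, a = γ ^ k) {k0 : ℕ} (hk0 : γ = (γ ^ 2) ^ k0)
    (hno : ∀ z : V, (∀ g, ρ g z = z) → z = 0) {s : F} (hs : s ≠ 0) :
    Module.finrank ℂ (LinearMap.range (A.e ψ ρ 0)) ≤
      2 * Module.finrank ℂ (LinearMap.range (A.e ψ ρ s)) := by
  set p := LinearMap.range (A.e ψ ρ 0) with hp
  have hpu : ∀ v ∈ p, ∀ x, ρ (A.u x) v = v := by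
    rintro _ ⟨y, rfl⟩ x; exact A.ue0 ρ x y
  let f : p →ₗ[ℂ] V := (A.e ψ ρ s ∘ₗ ρ A.w).domRestrict p
  have hf : ∀ v : p, f v = A.e ψ ρ s (ρ A.w v) := fun v => rfl
  let K : Submodule ℂ V := (LinearMap.ker f).map p.subtype
  have hKf : Module.finrank ℂ K = Module.finrank ℂ (LinearMap.ker f) :=
    Submodule.finrank_map_subtype_eq _ _
  have hrn := LinearMap.finrank_range_add_finrank_ker f
  have hrange : Module.finrank ℂ (LinearMap.range f) ≤
      Module.finrank ℂ (LinearMap.range (A.e ψ ρ s)) := by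
    apply Submodule.finrank_mono
    rintro _ ⟨v, rfl⟩
    exact ⟨_, rfl⟩
  have hKp : K ≤ p := Submodule.map_subtype_le _ _
  have hKe : ∀ v ∈ K, A.e ψ ρ s (ρ A.w v) = 0 := by
    rintro _ ⟨v, hv, rfl⟩
    exact hv
  let P : V →ₗ[ℂ] V := ρ (A.t γ) - ρ (A.t γ⁻¹)
  have hPv : ∀ v, P v = ρ (A.t γ) v - ρ (A.t γ⁻¹) v := fun v => rfl
  let J : V →ₗ[ℂ] V := ∑ x : Fˣ, ψ (-(s * x)) • (ρ (A.t (x⁻¹ ^ 2)) ∘ₗ A.e ψ ρ 0 ∘ₗ ρ A.w)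
  have hJv : ∀ v, J v = ∑ x : Fˣ, ψ (-(s * x)) • ρ (A.t (x⁻¹ ^ 2)) (A.e ψ ρ 0 (ρ A.w v)) := by
    intro v; simp [J]
  have hJK : ∀ v ∈ K, J v = -v := by
    intro v hv
    have h1 := A.key_formula (ψ := ψ) ρ (hpu v (hKp hv)) s
    rw [hKe v hv, map_zero, map_zero, ← hJv] at h1
    have h2 := (smul_eq_zero.1 h1.symm).resolve_left (inv_ne_zero A.hq0)
    exact (neg_eq_of_add_eq_zero_right h2).symm
  have hγi := Δ.inv_mem hγ
  have htt : ∀ a ∈ Δ, ∀ b ∈ Δ, ∀ v, ρ (A.t a) (ρ (A.t b) v) = ρ (A.t b) (ρ (A.t a) v) := by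
    intro a ha b hb v
    rw [← rmul_apply, ← rmul_apply, ← A.t_mul a ha b hb, mul_comm, A.t_mul b hb a ha]
  have hPJ : ∀ v, J (P v) = -P (J v) := by
    intro v
    rw [hJv, hJv, map_sum, ← Finset.sum_neg_distrib]
    refine Finset.sum_congr rfl fun x _ => ?_
    rw [hPv, hPv, map_sub, map_sub, map_sub, wtv _ _ hγ, wtv _ _ hγi, inv_inv, ← te0 _ _ hγ,
      ← te0 _ _ hγi, map_smul, map_smul, htt _ (A.sq _) _ hγ, htt _ (A.sq _) _ hγi]
    module
  have hPp : ∀ v ∈ p, P v ∈ p := by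
    rintro _ ⟨y, rfl⟩
    refine ⟨P y, ?_⟩
    rw [hPv, hPv, map_sub, te0 _ _ hγ, te0 _ _ hγi]
  have hinj : ∀ v ∈ K, P v = 0 → v = 0 := by
    intro v hv h
    have hvp := hKp hv
    rw [hPv, sub_eq_zero] at h
    have h1 : ρ (A.t (γ ^ 2)) v = (1 : ℂ) • v := by
      rw [one_smul, pow_two, A.t_mul _ hγ _ hγ, rmul_apply, h]
      have := A.tinv ρ hγi v
      rwa [inv_inv] at this
    have h2 : ρ (A.t γ) v = (1 : ℂ) • v := by
      conv_lhs => rw [hk0]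
      rw [A.t_pow ρ (Δ.pow_mem hγ 2) h1, one_pow]
    have h3 : ∀ a ∈ Δ, ρ (A.t a) v = v := by
      intro a ha
      obtain ⟨k, rfl⟩ := hgen a ha
      rw [A.t_pow ρ hγ h2, one_pow, one_smul]
    have h4 : A.e ψ ρ 0 (ρ A.w v) = v := by
      have h5 := hJK v hv
      have h6 : ∀ a ∈ Δ, ρ (A.t a) (A.e ψ ρ 0 (ρ A.w v)) = A.e ψ ρ 0 (ρ A.w v) := by
        intro a ha
        rw [te0 _ _ ha, twv _ _ ha, h3 _ (Δ.inv_mem ha)]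
      rw [hJv] at h5
      simp_rw [h6 _ (A.sq _)] at h5
      rw [← Finset.sum_smul, psi_units hψ hs, neg_one_smul, neg_inj] at h5
      exact h5
    have h7 : ∀ g, A.e ψ ρ 0 (ρ g v) = v := by
      intro g
      have hu := hpu v hvp
      obtain ⟨x, a, ha, rfl | ⟨y, rfl⟩⟩ := A.bruhat g
      · rw [rmul_apply, eu0, h3 a ha, A.e_fix0 ρ hu]
      · simp only [rmul_apply]
        rw [eu0, hu, ← te0 _ _ ha, h4, h3 a ha]
    have h8 : ∑ g, ρ g v = 0 := by
      apply hno
      intro g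
      rw [map_sum]
      refine Fintype.sum_equiv (Equiv.mulLeft g) _ _ fun h => ?_
      rw [← rmul_apply]; rfl
    have h9 := congrArg (fun z => A.e ψ ρ 0 z) h8
    beta_reduce at h9
    rw [map_sum, map_zero, Finset.sum_congr rfl fun g _ => h7 g, Finset.sum_const,
      Finset.card_univ, ← Nat.cast_smul_eq_nsmul ℂ, smul_eq_zero] at h9
    exact h9.resolve_left (by exact_mod_cast Fintype.card_ne_zero)
  have hPK : Module.finrank ℂ (K.map P) = Module.finrank ℂ K := by
    have h1 : K.map P = LinearMap.range (P.domRestrict K) := by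
      ext y; constructor
      · rintro ⟨v, hv, rfl⟩; exact ⟨⟨v, hv⟩, rfl⟩
      · rintro ⟨⟨v, hv⟩, rfl⟩; exact ⟨v, hv, rfl⟩
    rw [h1]
    apply LinearMap.finrank_range_of_inj
    rw [← LinearMap.ker_eq_bot, LinearMap.ker_eq_bot']
    rintro ⟨v, hv⟩ h
    exact Subtype.ext (hinj v hv h)
  have hdis : K ⊓ K.map P = ⊥ := by
    rw [eq_bot_iff]
    rintro z ⟨hz, v, hv, rfl⟩
    have h1 := hJK _ hz
    rw [hPJ, hJK v hv, map_neg, neg_neg] at h1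
    have h2 : (2 : ℂ) • P v = 0 := by
      rw [two_smul]; nth_rw 1 [h1]; simp
    exact (Submodule.mem_bot ℂ).2 ((smul_eq_zero.1 h2).resolve_left two_ne_zero)
  have hsup := Submodule.finrank_sup_add_finrank_inf_eq K (K.map P)
  rw [hdis, finrank_bot, hPK] at hsup
  have hle : Module.finrank ℂ ↥(K ⊔ K.map P) ≤ Module.finrank ℂ p := by
    apply Submodule.finrank_mono
    apply sup_le hKp
    rintro _ ⟨v, hv, rfl⟩
    exact hPp v (hKp hv)
  omega

theorem fixed_count [Fintype N] [FiniteDimensional ℂ V] {γ : Fˣ} (hγ : γ ∈ Δ)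
    (hgen : ∀ a ∈ Δ, ∃ k : ℕ, a = γ ^ k) {k0 : ℕ} (hk0 : γ = (γ ^ 2) ^ k0)
    (hno : ∀ z : V, (∀ g, ρ g z = z) → z = 0) :
    (Fintype.card F + 1) * Module.finrank ℂ (LinearMap.range (A.e ψ ρ 0)) ≤
      2 * Module.finrank ℂ V := by
  rw [A.finrank_eq hψ ρ, sum_eq_zero_add_units, mul_add, Finset.mul_sum]
  have h1 : ∑ s : Fˣ, Module.finrank ℂ (LinearMap.range (A.e ψ ρ 0)) ≤
      ∑ s : Fˣ, 2 * Module.finrank ℂ (LinearMap.range (A.e ψ ρ s)) :=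
    Finset.sum_le_sum fun s _ => A.half_bound hψ ρ hγ hgen hk0 hno s.ne_zero
  rw [Finset.sum_const, Finset.card_univ, smul_eq_mul, Fintype.card_units] at h1
  have hpos : 0 < Fintype.card F := Fintype.card_pos
  obtain ⟨c, hc⟩ : ∃ c, Fintype.card F = c + 1 := ⟨_, (Nat.succ_pred_eq_of_pos hpos).symm⟩
  rw [hc] at h1 ⊢
  simp only [Nat.add_sub_cancel] at h1
  linarith

theorem cusp_card [FiniteDimensional ℂ V] [DecidablePred fun s : Fˣ => A.e ψ ρ s ≠ 0]
    (hρ : Irr ρ) (h0 : A.e ψ ρ 0 = 0) :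
    Module.finrank ℂ V = (Finset.univ.filter fun s : Fˣ => A.e ψ ρ s ≠ 0).card := by
  have hr : ∀ s : Fˣ, Module.finrank ℂ (LinearMap.range (A.e ψ ρ s)) =
      if A.e ψ ρ s ≠ 0 then 1 else 0 := by
    intro s
    split_ifs with h
    · obtain ⟨v, hv⟩ : ∃ v, A.e ψ ρ s v ≠ 0 := by
        by_contra hcon
        push Not at hcon
        exact h (LinearMap.ext hcon)
      rw [A.mult_one hψ ρ hρ s.ne_zero hv (A.ee hψ ρ s v), finrank_span_singleton hv]
    · push Not at h
      rw [h]; simp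
  rw [A.finrank_eq hψ ρ, sum_eq_zero_add_units, h0, Finset.card_filter,
      Finset.sum_congr rfl fun s _ => hr s]
  simp

theorem half_iso [Fintype N] [FiniteDimensional ℂ V] {V' : Type} [AddCommGroup V'] [Module ℂ V']
    [FiniteDimensional ℂ V'] (ρ' : N →* (V' →ₗ[ℂ] V')) (hρ : Irr ρ) (hρ' : Irr ρ')
    {γ : Fˣ} (hγ : γ ∈ Δ) (hgen : ∀ a ∈ Δ, ∃ k : ℕ, a = γ ^ k) (h1 : -1 ∉ Δ)
    (h0 : A.e ψ ρ 0 = 0) (hn : 2 * Module.finrank ℂ V = Fintype.card F - 1)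
    (hn' : Module.finrank ℂ V' = Module.finrank ℂ V)
    (hsupp : ∀ r : Fˣ, A.e ψ ρ r ≠ 0 ↔ A.e ψ ρ' r ≠ 0) : RIso ρ ρ' := by
  classical
  by_contra hcon
  obtain ⟨k0, hk0⟩ : ∃ k0, γ = (γ ^ 2) ^ k0 := by
    rcases Nat.even_or_odd (orderOf γ) with ⟨m, hm⟩ | ⟨m, hm⟩
    · exfalso
      apply h1
      have hpos := orderOf_pos γ
      have h2 : (γ ^ m) ^ 2 = 1 := by
        rw [← pow_mul, mul_two, ← hm, pow_orderOf_eq_one]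
      have h3 : γ ^ m ≠ 1 := pow_ne_one_of_lt_orderOf (by omega) (by omega)
      have h4 : γ ^ m = -1 := by
        apply Units.ext
        have h5 : ((γ ^ m : Fˣ) : F) ^ 2 = 1 := by
          rw [← Units.val_pow_eq_pow_val, h2, Units.val_one]
        rcases sq_eq_one_iff.1 h5 with h6 | h6
        · exact absurd (Units.ext h6) h3
        · simpa using h6
      rw [← h4]; exact Δ.pow_mem hγ m
    · refine ⟨m + 1, ?_⟩
      rw [← pow_mul]
      have : 2 * (m + 1) = orderOf γ + 1 := by omega
      rw [this, pow_succ, pow_orderOf_eq_one, one_mul]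
  let τ : N →* ((V →ₗ[ℂ] V') →ₗ[ℂ] (V →ₗ[ℂ] V')) := Representation.linHom ρ ρ'
  have hτ : ∀ g f v, τ g f v = ρ' g (f (ρ g⁻¹ v)) := fun g f v => rfl
  have hno : ∀ z : V →ₗ[ℂ] V', (∀ g, τ g z = z) → z = 0 := by
    intro z hz
    by_contra hz0
    apply hcon
    refine schur_iso hρ hρ' z ?_ hz0
    intro g v
    have := LinearMap.congr_fun (hz g) (ρ g v)
    rw [hτ, rinv_apply] at this
    exact this.symm
  have hcount := A.fixed_count hψ τ hγ hgen hk0 hno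
  rw [Module.finrank_linearMap, hn'] at hcount
  -- lower bound for U-fixed maps
  have hm : Module.finrank ℂ V ≤ Module.finrank ℂ (LinearMap.range (A.e ψ τ 0)) := by
    rw [A.cusp_card hψ ρ hρ h0, ← Fintype.card_subtype]
    have hex1 : ∀ r : {r : Fˣ // A.e ψ ρ r ≠ 0}, ∃ v, v ≠ 0 ∧ A.e ψ ρ (r : Fˣ) v = v := by
      rintro ⟨r, hr⟩
      obtain ⟨v, hv⟩ : ∃ v, A.e ψ ρ r v ≠ 0 := by
        by_contra hcon
        push Not at hcon
        exact hr (LinearMap.ext hcon)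
      exact ⟨_, hv, A.ee hψ ρ r v⟩
    have hex2 : ∀ r : {r : Fˣ // A.e ψ ρ r ≠ 0}, ∃ v, v ≠ 0 ∧ A.e ψ ρ' (r : Fˣ) v = v := by
      rintro ⟨r, hr⟩
      obtain ⟨v, hv⟩ : ∃ v, A.e ψ ρ' r v ≠ 0 := by
        by_contra hcon
        push Not at hcon
        exact (hsupp r).1 hr (LinearMap.ext hcon)
      exact ⟨_, hv, A.ee hψ ρ' r v⟩
    choose a ha0 ha using hex1
    choose b hb0 hb using hex2
    have hex3 : ∀ r, ∃ φ : V →ₗ[ℂ] ℂ, φ (a r) ≠ 0 := by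
      intro r
      by_contra hcon
      push Not at hcon
      exact ha0 r ((Module.forall_dual_apply_eq_zero_iff ℂ (a r)).1 hcon)
    choose φ hφ using hex3
    let f : {r : Fˣ // A.e ψ ρ r ≠ 0} → (V →ₗ[ℂ] V') := fun r =>
      (φ r ∘ₗ A.e ψ ρ (r : Fˣ)).smulRight (b r)
    have hfv : ∀ r v, f r v = φ r (A.e ψ ρ (r : Fˣ) v) • b r := fun r v => rfl
    have hfix : ∀ r, A.e ψ τ 0 (f r) = f r := by
      intro r
      apply A.e_fix0
      intro x
      ext v
      rw [hτ, hfv, hfv, map_smul]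
      have e1 : (A.u x)⁻¹ = A.u (-x) := by
        rw [inv_eq_iff_mul_eq_one, ← A.u_add]; simp [A.u_zero]
      have e2 : ρ' (A.u x) (b r) = ψ (((r : Fˣ) : F) * x) • b r := by rw [← hb, ue]
      rw [e1, eu, e2, map_smul, smul_smul, smul_eq_mul, mul_right_comm, ← AddChar.map_add_eq_mul]
      simp
    have hli : LinearIndependent ℂ f := by
      rw [Fintype.linearIndependent_iff]
      intro g hg k
      have h2 := LinearMap.congr_fun hg (a k)
      simp only [LinearMap.sum_apply, LinearMap.smul_apply, LinearMap.zero_apply, hfv] at h2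
      rw [Finset.sum_eq_single k] at h2
      · rw [ha, smul_smul, smul_eq_zero] at h2
        exact (mul_eq_zero.1 (h2.resolve_right (hb0 k))).resolve_right (hφ k)
      · intro r _ hr
        rw [← ha k, A.ee_ne hψ ρ]
        · simp
        · intro h
          exact hr (Subtype.ext (Units.ext h))
      · simp
    let f' : {r : Fˣ // A.e ψ ρ r ≠ 0} → LinearMap.range (A.e ψ τ 0) := fun r => ⟨f r, f r, hfix r⟩
    have hli' : LinearIndependent ℂ f' :=
      LinearIndependent.of_comp (LinearMap.range (A.e ψ τ 0)).subtype hli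
    exact hli'.fintype_card_le_finrank
  have hnpos : 0 < Module.finrank ℂ V := by
    obtain ⟨v, hv⟩ := hρ.1
    have : Nontrivial V := ⟨⟨v, 0, hv⟩⟩
    exact Module.finrank_pos
  set n := Module.finrank ℂ V
  have h5 : (Fintype.card F + 1) * n ≤ 2 * (n * n) :=
    le_trans (Nat.mul_le_mul_left _ hm) hcount
  have h6 : (Fintype.card F + 1) * n ≤ (2 * n) * n := by linarith
  have h7 := Nat.le_of_mul_le_mul_right h6 hnpos
  omega

end Ax

set_option linter.unusedSectionVars false

theorem exists_gen {F : Type} [Field F] [Fintype F] (Δ : Subgroup Fˣ) :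
    ∃ γ ∈ Δ, ∀ a ∈ Δ, ∃ k : ℕ, a = γ ^ k := by
  obtain ⟨⟨γ, hγ⟩, h⟩ := IsCyclic.exists_generator (α := Δ)
  refine ⟨γ, hγ, fun a ha => ?_⟩
  have := h ⟨a, ha⟩
  rw [← mem_powers_iff_mem_zpowers] at this
  obtain ⟨k, hk⟩ := this
  exact ⟨k, (congrArg Subtype.val hk).symm⟩

theorem pigeon3 (a b c : Bool) : a = b ∨ a = c ∨ b = c := by
  cases a <;> cases b <;> cases c <;> simp

namespace Ax

variable {F N : Type} [Field F] [Fintype F] [DecidableEq F] [Group N] [Fintype N]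
  {Δ : Subgroup Fˣ} (A : Ax F N Δ)
variable {V : Type} [AddCommGroup V] [Module ℂ V] {ψ : AddChar F ℂ} (hψ : ψ.IsPrimitive)
  (ρ : N →* (V →ₗ[ℂ] V))

include hψ

theorem fix_of_e0 (h : A.e ψ ρ 0 ≠ 0) : ∃ v : V, v ≠ 0 ∧ ∀ x, ρ (A.u x) v = v := by
  obtain ⟨v, hv⟩ : ∃ v, A.e ψ ρ 0 v ≠ 0 := by
    by_contra hcon
    push Not at hcon
    exact h (LinearMap.ext hcon)
  exact ⟨_, hv, fun x => A.ue0 ρ x v⟩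

/-- classification of the irreducible representations -/
theorem cls [FiniteDimensional ℂ V] (hρ : Irr ρ) {γ : Fˣ} (hγ : γ ∈ Δ)
    (hgen : ∀ a ∈ Δ, ∃ k : ℕ, a = γ ^ k) {c0 : ℂ} (hc0 : c0 ^ 2 = (Fintype.card F : ℂ)⁻¹) :
    Module.finrank ℂ V = Fintype.card F + 1 ∨ Module.finrank ℂ V = Fintype.card F - 1 ∨
    (Module.finrank ℂ V = 1 ∧ ∃ b : Bool, A.PInv ρ γ ψ (if b then 1 else -1) 1) ∨
    (Module.finrank ℂ V = Fintype.card F ∧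
      ∃ b : Bool, A.PInv ρ γ ψ (if b then 1 else -1) (-(Fintype.card F : ℂ)⁻¹)) ∨
    (2 * Module.finrank ℂ V = Fintype.card F + 1 ∧ Δ ≠ ⊤ ∧ -1 ∈ Δ ∧
      ∃ b : Bool, A.PInv ρ γ ψ (-1) (if b then c0 else -c0)) ∨
    (2 * Module.finrank ℂ V = Fintype.card F - 1 ∧ Δ ≠ ⊤ ∧ -1 ∉ Δ ∧ A.e ψ ρ 0 = 0 ∧
      ∃ s : Fˣ, ∀ r : Fˣ, A.e ψ ρ r ≠ 0 ↔ r * s⁻¹ ∈ Δ) := by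
  by_cases h0 : A.e ψ ρ 0 = 0
  · rcases A.cuspidal_dim hψ ρ hρ h0 with h | ⟨h1, h2, s, hs⟩
    · exact Or.inr (Or.inl h)
    · by_cases h3 : -1 ∈ Δ
      · exact (A.half_excl hψ ρ h1 h3 hρ h0 s hs).elim
      · exact Or.inr (Or.inr (Or.inr (Or.inr (Or.inr ⟨h2, h1, h3, h0, s, hs⟩))))
  · rcases A.principal hψ ρ hρ hγ hgen (A.fix_of_e0 hψ ρ h0) with
      h | ⟨l, c, hi, hl, ⟨hc, h⟩ | ⟨hc, h⟩ | ⟨h, hc, hl1, h1, h2⟩⟩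
    · exact Or.inl h
    · subst hc
      refine Or.inr (Or.inr (Or.inl ⟨h, ?_⟩))
      rcases hl with rfl | rfl
      · exact ⟨true, hi⟩
      · exact ⟨false, hi⟩
    · subst hc
      refine Or.inr (Or.inr (Or.inr (Or.inl ⟨h, ?_⟩)))
      rcases hl with rfl | rfl
      · exact ⟨true, hi⟩
      · exact ⟨false, hi⟩
    · refine Or.inr (Or.inr (Or.inr (Or.inr (Or.inl ⟨h, h2, h1, ?_⟩))))
      subst hl1
      rw [← hc0] at hc
      rcases sq_eq_sq_iff_eq_or_eq_neg.1 hc with rfl | rfl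
      · exact ⟨true, hi⟩
      · exact ⟨false, hi⟩

omit hψ [Fintype N] in
theorem PInv_iso {V' : Type} [AddCommGroup V'] [Module ℂ V'] (ρ' : N →* (V' →ₗ[ℂ] V'))
    (hρ : Irr ρ) (hρ' : Irr ρ') {γ : Fˣ} (hγ : γ ∈ Δ) (hgen : ∀ a ∈ Δ, ∃ k : ℕ, a = γ ^ k)
    {l c : ℂ} (h : A.PInv ρ γ ψ l c) (h' : A.PInv ρ' γ ψ l c) : RIso ρ ρ' := by
  obtain ⟨v, h1, h2, h3, h4⟩ := h
  obtain ⟨v', h1', h2', h3', h4'⟩ := h'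
  exact A.principal_iso ρ ρ' hρ hρ' hγ hgen h1 h2 h3 h4 h1' h2' h3' h4'

omit hψ in
include A in
theorem dims [FiniteDimensional ℂ V] (hρ : Irr ρ) :
    Module.finrank ℂ V = Fintype.card F + 1 ∨ Module.finrank ℂ V = Fintype.card F - 1 ∨
    Module.finrank ℂ V = 1 ∨ Module.finrank ℂ V = Fintype.card F ∨
    (Δ ≠ ⊤ ∧ -1 ∈ Δ ∧ 2 * Module.finrank ℂ V = Fintype.card F + 1) ∨
    (Δ ≠ ⊤ ∧ -1 ∉ Δ ∧ 2 * Module.finrank ℂ V = Fintype.card F - 1) := by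
  obtain ⟨γ, hγ, hgen⟩ := exists_gen Δ
  obtain ⟨c0, hc0⟩ := IsAlgClosed.exists_pow_nat_eq (Fintype.card F : ℂ)⁻¹ (n := 2) (by norm_num)
  have := A.cls (AddChar.FiniteField.primitiveChar_to_Complex_isPrimitive F) ρ hρ hγ hgen hc0
  tauto

omit hψ in
include A in
theorem two (h7 : 7 ≤ Fintype.card F) (n : ℕ)
    (hn : n = 1 ∨ n = Fintype.card F ∨ 2 * n = Fintype.card F + 1 ∨ 2 * n = Fintype.card F - 1)
    (X1 X2 X3 : Type) [AddCommGroup X1] [Module ℂ X1] [AddCommGroup X2] [Module ℂ X2]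
      [AddCommGroup X3] [Module ℂ X3] [FiniteDimensional ℂ X1] [FiniteDimensional ℂ X2]
      [FiniteDimensional ℂ X3] (τ1 : N →* (X1 →ₗ[ℂ] X1)) (τ2 : N →* (X2 →ₗ[ℂ] X2))
      (τ3 : N →* (X3 →ₗ[ℂ] X3)) (h1 : Irr τ1) (h2 : Irr τ2) (h3 : Irr τ3)
      (hX1 : Module.finrank ℂ X1 = n) (hX2 : Module.finrank ℂ X2 = n)
      (hX3 : Module.finrank ℂ X3 = n) : RIso τ1 τ2 ∨ RIso τ1 τ3 ∨ RIso τ2 τ3 := by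
  classical
  obtain ⟨γ, hγ, hgen⟩ := exists_gen Δ
  obtain ⟨c0, hc0⟩ := IsAlgClosed.exists_pow_nat_eq (Fintype.card F : ℂ)⁻¹ (n := 2) (by norm_num)
  have hψ := AddChar.FiniteField.primitiveChar_to_Complex_isPrimitive F
  set ψ := AddChar.FiniteField.primitiveChar_to_Complex F
  have c1 := A.cls hψ τ1 h1 hγ hgen hc0
  have c2 := A.cls hψ τ2 h2 hγ hgen hc0
  have c3 := A.cls hψ τ3 h3 hγ hgen hc0
  have pig : ∀ f : Bool → ℂ × ℂ, (∃ b, A.PInv τ1 γ ψ (f b).1 (f b).2) →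
      (∃ b, A.PInv τ2 γ ψ (f b).1 (f b).2) → (∃ b, A.PInv τ3 γ ψ (f b).1 (f b).2) →
      RIso τ1 τ2 ∨ RIso τ1 τ3 ∨ RIso τ2 τ3 := by
    rintro f ⟨b1, hb1⟩ ⟨b2, hb2⟩ ⟨b3, hb3⟩
    rcases pigeon3 b1 b2 b3 with rfl | rfl | rfl
    · exact Or.inl (A.PInv_iso τ1 τ2 h1 h2 hγ hgen hb1 hb2)
    · exact Or.inr (Or.inl (A.PInv_iso τ1 τ3 h1 h3 hγ hgen hb1 hb3))
    · exact Or.inr (Or.inr (A.PInv_iso τ2 τ3 h2 h3 hγ hgen hb2 hb3))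
  rw [hX1] at c1
  rw [hX2] at c2
  rw [hX3] at c3
  rcases hn with hn | hn | hn | hn
  · have key : ∀ (P1 P2 P3 P4 : Prop), (n = Fintype.card F + 1 ∨ n = Fintype.card F - 1 ∨
      (n = 1 ∧ P1) ∨ (n = Fintype.card F ∧ P2) ∨ (2 * n = Fintype.card F + 1 ∧ P3) ∨
      (2 * n = Fintype.card F - 1 ∧ P4)) → P1 := by
      intro P1 P2 P3 P4 h
      rcases h with h | h | ⟨h, h'⟩ | ⟨h, h'⟩ | ⟨h, h'⟩ | ⟨h, h'⟩ <;> first | exact h' | omega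
    exact pig (fun b => (if b then 1 else -1, 1)) (key _ _ _ _ c1) (key _ _ _ _ c2) (key _ _ _ _ c3)
  · have key : ∀ (P1 P2 P3 P4 : Prop), (n = Fintype.card F + 1 ∨ n = Fintype.card F - 1 ∨
      (n = 1 ∧ P1) ∨ (n = Fintype.card F ∧ P2) ∨ (2 * n = Fintype.card F + 1 ∧ P3) ∨
      (2 * n = Fintype.card F - 1 ∧ P4)) → P2 := by
      intro P1 P2 P3 P4 h
      rcases h with h | h | ⟨h, h'⟩ | ⟨h, h'⟩ | ⟨h, h'⟩ | ⟨h, h'⟩ <;> first | exact h' | omega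
    exact pig (fun b => (if b then 1 else -1, -(Fintype.card F : ℂ)⁻¹))
      (key _ _ _ _ c1) (key _ _ _ _ c2) (key _ _ _ _ c3)
  · have key : ∀ (P1 P2 P3 P4 : Prop), (n = Fintype.card F + 1 ∨ n = Fintype.card F - 1 ∨
      (n = 1 ∧ P1) ∨ (n = Fintype.card F ∧ P2) ∨ (2 * n = Fintype.card F + 1 ∧ P3) ∨
      (2 * n = Fintype.card F - 1 ∧ P4)) → P3 := by
      intro P1 P2 P3 P4 h
      rcases h with h | h | ⟨h, h'⟩ | ⟨h, h'⟩ | ⟨h, h'⟩ | ⟨h, h'⟩ <;> first | exact h' | omega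
    exact pig (fun b => (-1, if b then c0 else -c0))
      (key _ _ _ _ c1).2.2 (key _ _ _ _ c2).2.2 (key _ _ _ _ c3).2.2
  · have key : ∀ (P1 P2 P3 P4 : Prop), (n = Fintype.card F + 1 ∨ n = Fintype.card F - 1 ∨
      (n = 1 ∧ P1) ∨ (n = Fintype.card F ∧ P2) ∨ (2 * n = Fintype.card F + 1 ∧ P3) ∨
      (2 * n = Fintype.card F - 1 ∧ P4)) → P4 := by
      intro P1 P2 P3 P4 h
      rcases h with h | h | ⟨h, h'⟩ | ⟨h, h'⟩ | ⟨h, h'⟩ | ⟨h, h'⟩ <;> first | exact h' | omega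
    obtain ⟨hΔ, hm1, z1, s1, hs1⟩ := key _ _ _ _ c1
    obtain ⟨-, -, z2, s2, hs2⟩ := key _ _ _ _ c2
    obtain ⟨-, -, z3, s3, hs3⟩ := key _ _ _ _ c3
    have comp : ∀ s s' : Fˣ, decide (s⁻¹ ∈ Δ) = decide (s'⁻¹ ∈ Δ) → ∀ r : Fˣ,
        (r * s⁻¹ ∈ Δ ↔ r * s'⁻¹ ∈ Δ) := by
      intro s s' h r
      rw [decide_eq_decide] at h
      have h5 : s⁻¹ * s' ∈ Δ := by
        by_cases h6 : s⁻¹ ∈ Δ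
        · have := Δ.inv_mem (h.1 h6)
          rw [inv_inv] at this
          exact Δ.mul_mem h6 this
        · have h7 : s' ∉ Δ := fun h8 => h6 (h.2 (Δ.inv_mem h8))
          exact A.index_two h6 h7
      constructor
      · intro h8
        have := Δ.mul_mem h8 (Δ.inv_mem h5)
        convert this using 1
        apply Units.ext; push_cast; field_simp
      · intro h8
        have := Δ.mul_mem h8 h5
        convert this using 1
        apply Units.ext; push_cast; field_simp
    rcases pigeon3 (decide (s1⁻¹ ∈ Δ)) (decide (s2⁻¹ ∈ Δ)) (decide (s3⁻¹ ∈ Δ)) with h | h | h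
    · exact Or.inl (A.half_iso hψ τ1 τ2 h1 h2 hγ hgen hm1 z1 (by rw [hX1]; exact hn)
        (by rw [hX1, hX2]) (fun r => by rw [hs1, hs2]; exact comp _ _ h r))
    · exact Or.inr (Or.inl (A.half_iso hψ τ1 τ3 h1 h3 hγ hgen hm1 z1 (by rw [hX1]; exact hn)
        (by rw [hX1, hX3]) (fun r => by rw [hs1, hs3]; exact comp _ _ h r)))
    · exact Or.inr (Or.inr (A.half_iso hψ τ2 τ3 h2 h3 hγ hgen hm1 z2 (by rw [hX2]; exact hn)
        (by rw [hX2, hX3]) (fun r => by rw [hs2, hs3]; exact comp _ _ h r)))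

end Ax


set_option linter.unusedSectionVars false

namespace PSL

open Matrix

variable {F : Type} [Field F]

local notation "SL2" => Matrix.SpecialLinearGroup (Fin 2)
local notation "GL2" => Matrix.GeneralLinearGroup (Fin 2)

theorem slext {s t : SL2 F} (h : (s : Matrix (Fin 2) (Fin 2) F) = t) : s = t := Subtype.ext h

/-- upper unipotent -/
def U (x : F) : SL2 F := ⟨!![1, x; 0, 1], by simp [Matrix.det_fin_two]⟩
/-- lower unipotent -/
def V (x : F) : SL2 F := ⟨!![1, 0; x, 1], by simp [Matrix.det_fin_two]⟩
/-- Weyl element -/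
def W : SL2 F := ⟨!![0, 1; -1, 0], by simp [Matrix.det_fin_two]⟩

/-- explicit element of GL2 -/
noncomputable def gl (a b c d : F) (h : a * d - b * c ≠ 0) : GL2 F :=
  Matrix.GeneralLinearGroup.mkOfDetNeZero !![a, b; c, d] (by rw [Matrix.det_fin_two_of]; exact h)

theorem gl_coe (a b c d : F) (h : a * d - b * c ≠ 0) :
    ((gl a b c d h : GL2 F) : Matrix (Fin 2) (Fin 2) F) = !![a, b; c, d] := rfl

theorem U_coe (x : F) : ((U x : SL2 F) : Matrix (Fin 2) (Fin 2) F) = !![1, x; 0, 1] := rfl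
theorem V_coe (x : F) : ((V x : SL2 F) : Matrix (Fin 2) (Fin 2) F) = !![1, 0; x, 1] := rfl
theorem W_coe : ((W : SL2 F) : Matrix (Fin 2) (Fin 2) F) = !![0, 1; -1, 0] := rfl

theorem U_add (x y : F) : U (x + y) = U x * U y := by
  apply slext
  rw [Matrix.SpecialLinearGroup.coe_mul, U_coe, U_coe, U_coe]
  ext i j; fin_cases i <;> fin_cases j <;> simp [add_comm]

theorem U_zero : U (0 : F) = 1 := by
  apply slext
  rw [U_coe, Matrix.SpecialLinearGroup.coe_one]
  ext i j; fin_cases i <;> fin_cases j <;> simp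

theorem V_zero : V (0 : F) = 1 := by
  apply slext
  rw [V_coe, Matrix.SpecialLinearGroup.coe_one]
  ext i j; fin_cases i <;> fin_cases j <;> simp

theorem U_pow (x : F) (n : ℕ) : U x ^ n = U (n * x) := by
  induction n with
  | zero => simp [U_zero]
  | succ n ih => rw [pow_succ, ih, ← U_add]; congr 1; push_cast; ring

/-- conjugation -/
noncomputable def cj (h : GL2 F) : SL2 F →* SL2 F where
  toFun s := ⟨(h : Matrix (Fin 2) (Fin 2) F) * s * ((h⁻¹ : GL2 F) : Matrix (Fin 2) (Fin 2) F), by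
    rw [Matrix.det_mul, Matrix.det_mul, s.2, mul_one, ← Matrix.det_mul, ← Units.val_mul]
    simp⟩
  map_one' := by
    apply slext
    simp
  map_mul' s t := by
    apply slext
    have : ((h⁻¹ : GL2 F) : Matrix (Fin 2) (Fin 2) F) * (h : Matrix (Fin 2) (Fin 2) F) = 1 := by
      rw [← Units.val_mul]; simp
    change (h : Matrix (Fin 2) (Fin 2) F) * ((s : Matrix (Fin 2) (Fin 2) F) * t) *
      ((h⁻¹ : GL2 F) : Matrix (Fin 2) (Fin 2) F) =
      (h : Matrix (Fin 2) (Fin 2) F) * s * ((h⁻¹ : GL2 F) : Matrix (Fin 2) (Fin 2) F) *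
      ((h : Matrix (Fin 2) (Fin 2) F) * t * ((h⁻¹ : GL2 F) : Matrix (Fin 2) (Fin 2) F))
    simp only [mul_assoc]
    rw [← mul_assoc _ (h : Matrix (Fin 2) (Fin 2) F) _, this, one_mul]

theorem cj_coe (h : GL2 F) (s : SL2 F) : ((cj h s : SL2 F) : Matrix (Fin 2) (Fin 2) F) =
  (h : Matrix (Fin 2) (Fin 2) F) * s * ((h⁻¹ : GL2 F) : Matrix (Fin 2) (Fin 2) F) := rfl

theorem cj_eq {h : GL2 F} {s s' : SL2 F} :
    cj h s = s' ↔ (h : Matrix (Fin 2) (Fin 2) F) * s = s' * h := by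
  rw [show cj h s = s' ↔ ((PSL.cj h s : SL2 F) : Matrix (Fin 2) (Fin 2) F) = s' from ⟨fun h => by rw [h], slext⟩]
  change (h : Matrix (Fin 2) (Fin 2) F) * s * ((h⁻¹ : GL2 F) : Matrix (Fin 2) (Fin 2) F) = s' ↔ _
  constructor
  · intro H
    rw [← H, mul_assoc, ← Units.val_mul, inv_mul_cancel, Units.val_one, mul_one]
  · intro H
    rw [H, mul_assoc, ← Units.val_mul, mul_inv_cancel, Units.val_one, mul_one]

theorem cj_mul (h k : GL2 F) (s : SL2 F) : cj (h * k) s = cj h (cj k s) := by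
  apply slext
  simp only [cj_coe, Units.val_mul, _root_.mul_inv_rev, mul_assoc]

theorem cj_one (s : SL2 F) : cj 1 s = s := by
  apply slext
  simp [cj_coe]

theorem cj_sl (s t : SL2 F) : cj (s : GL2 F) t = s * t * s⁻¹ := by
  rw [cj_eq]
  change (s : Matrix (Fin 2) (Fin 2) F) * t = ((s * t * s⁻¹ : SL2 F) : Matrix (Fin 2) (Fin 2) F) * s
  rw [← Matrix.SpecialLinearGroup.coe_mul, ← Matrix.SpecialLinearGroup.coe_mul]
  simp

/-- equality mod centre -/
def Rel (s s' : SL2 F) : Prop :=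
  ∃ r : F, r * r = 1 ∧ (s' : Matrix (Fin 2) (Fin 2) F) = r • (s : Matrix (Fin 2) (Fin 2) F)

theorem Rel_iff {s s' : SL2 F} : Rel s s' ↔ ∃ r : F, r * r = 1 ∧ s' 0 0 = r * s 0 0 ∧
    s' 0 1 = r * s 0 1 ∧ s' 1 0 = r * s 1 0 ∧ s' 1 1 = r * s 1 1 := by
  unfold Rel
  refine exists_congr fun r => and_congr_right fun _ => ?_
  constructor
  · intro h
    have : ∀ i j, s' i j = r * s i j := fun i j => by
      have := congrFun (congrFun h i) j
      simpa using this
    exact ⟨this _ _, this _ _, this _ _, this _ _⟩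
  · rintro ⟨h1, h2, h3, h4⟩
    ext i j; fin_cases i <;> fin_cases j <;> simp [h1, h2, h3, h4]

theorem Rel.cj {s s' : SL2 F} (h : Rel s s') (k : GL2 F) : Rel (cj k s) (cj k s') := by
  obtain ⟨r, hr, h⟩ := h
  refine ⟨r, hr, ?_⟩
  rw [cj_coe, cj_coe, h]
  simp

theorem cj_inv_cj (k : GL2 F) (s : SL2 F) : PSL.cj k⁻¹ (PSL.cj k s) = s := by
  rw [← cj_mul]; simp [cj_one]

theorem Rel.cj_iff {s s' : SL2 F} (k : GL2 F) : Rel (PSL.cj k s) (PSL.cj k s') ↔ Rel s s' := by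
  constructor
  · intro h
    have := h.cj k⁻¹
    rwa [cj_inv_cj, cj_inv_cj] at this
  · intro h
    exact h.cj k

theorem mk_eq_iff (s s' : SL2 F) : (QuotientGroup.mk s : PSL2 F) = QuotientGroup.mk s' ↔ Rel s s' := by
  rw [QuotientGroup.eq, Matrix.SpecialLinearGroup.mem_center_iff]
  unfold Rel
  simp only [Fintype.card_fin]
  refine exists_congr fun r => and_congr (by rw [sq]) ?_
  constructor
  · intro h
    have : (s' : Matrix (Fin 2) (Fin 2) F) = (s : Matrix (Fin 2) (Fin 2) F) * ((s⁻¹ * s' : SL2 F) : Matrix (Fin 2) (Fin 2) F) := by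
      rw [← Matrix.SpecialLinearGroup.coe_mul]; simp
    rw [this, ← h]
    ext i j; simp [mul_comm]
  · intro h
    rw [Matrix.SpecialLinearGroup.coe_mul, h, Matrix.mul_smul, ← Matrix.SpecialLinearGroup.coe_mul]
    ext i j; simp [Matrix.smul_apply, Matrix.one_apply, Matrix.diagonal_apply]

/-- SL2 is generated by U and V -/
theorem gen {H : Type} [Group H] (φ ψ : SL2 F →* H) (hU : ∀ x, φ (U x) = ψ (U x))
    (hV : ∀ x, φ (V x) = ψ (V x)) (s : SL2 F) : φ s = ψ s := by
  have key : ∀ s : SL2 F, s 1 0 ≠ 0 → φ s = ψ s := by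
    intro s hs
    have hd : s 0 0 * s 1 1 - s 0 1 * s 1 0 = 1 := by
      rw [← Matrix.det_fin_two]; exact s.2
    have : s = U ((s 0 0 - 1) / s 1 0) * V (s 1 0) * U ((s 1 1 - 1) / s 1 0) := by
      apply slext
      rw [Matrix.SpecialLinearGroup.coe_mul, Matrix.SpecialLinearGroup.coe_mul, U_coe, U_coe, V_coe]
      ext i j; fin_cases i <;> fin_cases j <;> simp <;> field_simp <;> grind
    rw [this]
    simp only [map_mul, hU, hV]
  by_cases hs : s 1 0 = 0
  · have hd : s 0 0 * s 1 1 - s 0 1 * s 1 0 = 1 := by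
      rw [← Matrix.det_fin_two]; exact s.2
    have h1 : (V 1 * s : SL2 F) 1 0 ≠ 0 := by
      rw [Matrix.SpecialLinearGroup.coe_mul, V_coe]
      simp [hs, Matrix.mul_apply, Fin.sum_univ_two]
      rintro h
      rw [h, hs] at hd
      simp at hd
    have := key _ h1
    rwa [map_mul, map_mul, hV, mul_right_inj] at this
  · exact key s hs

end PSL


set_option linter.unusedSectionVars false

namespace PSL

open Matrix

variable {F : Type} [Field F] [Fintype F]

local notation "SL2" => Matrix.SpecialLinearGroup (Fin 2)
local notation "GL2" => Matrix.GeneralLinearGroup (Fin 2)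

variable {H : Type} [Group H] (π α : SL2 F →* H)

/-- explicit element of SL2 -/
def sl (a b c d : F) (h : a * d - b * c = 1) : SL2 F :=
  ⟨!![a, b; c, d], by rw [Matrix.det_fin_two_of]; exact h⟩

theorem sl_coe (a b c d : F) (h : a * d - b * c = 1) :
    ((sl a b c d h : SL2 F) : Matrix (Fin 2) (Fin 2) F) = !![a, b; c, d] := rfl

theorem U_neg (x : F) : (U x)⁻¹ = U (-x) := by
  rw [inv_eq_iff_mul_eq_one, ← U_add]; simp [U_zero]

theorem sl_det (s : SL2 F) : s 0 0 * s 1 1 - s 0 1 * s 1 0 = 1 := by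
  rw [← Matrix.det_fin_two]; exact s.2

theorem tr_lem (hπ : ∀ s s', π s = π s' ↔ Rel s s') (A : SL2 F) (x : F) (h : π A = α (U x)) :
    ∃ r : F, r * r = 1 ∧ A 0 0 + A 1 1 = r * 2 := by
  have h1 : π 1 = π (A ^ Fintype.card F) := by
    rw [map_pow, h, ← map_pow, U_pow]
    simp [U_zero]
  rw [hπ] at h1
  obtain ⟨r, hr, h2⟩ := h1
  refine ⟨r, hr, ?_⟩
  have h3 := FiniteField.trace_pow_card (A : Matrix (Fin 2) (Fin 2) F)
  rw [FiniteField.pow_card, ← Matrix.SpecialLinearGroup.coe_pow, h2] at h3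
  rw [Matrix.trace_smul, Matrix.SpecialLinearGroup.coe_one, Matrix.trace_one, Matrix.trace_fin_two] at h3
  simpa using h3.symm

theorem step1 (hπ : ∀ s s', π s = π s' ↔ Rel s s') (hr : ∀ s, ∃ s', π s' = α s) :
    ∃ (h : GL2 F) (z : F), π (cj h (U z)) = α (U 1) := by
  obtain ⟨A, hA⟩ := hr (U 1)
  obtain ⟨r, hr, ht⟩ := tr_lem π α hπ A 1 hA
  have hd := sl_det A
  by_cases hc : A 1 0 = 0
  · refine ⟨1, r * A 0 1, ?_⟩
    rw [← hA, cj_one, hπ, Rel_iff]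
    rw [hc] at hd
    have h1 : (A 0 0 - r) ^ 2 = 0 := by linear_combination A 0 0 * ht + hr - hd
    have h2 : A 0 0 = r := sub_eq_zero.1 (pow_eq_zero_iff (two_ne_zero) |>.1 h1)
    refine ⟨r, hr, ?_⟩
    rw [U_coe, hc]
    simp
    refine ⟨h2, by linear_combination -(A 0 1) * hr, by linear_combination ht - h2⟩
  · refine ⟨gl (A 0 0 - r) 1 (A 1 0) 0 (by simpa using hc), r, ?_⟩
    rw [← hA, hπ]
    have h0 : ∀ B : SL2 F, B 0 0 = r * A 0 0 → B 0 1 = r * A 0 1 → B 1 0 = r * A 1 0 →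
        B 1 1 = r * A 1 1 → cj (gl (A 0 0 - r) 1 (A 1 0) 0 (by simpa using hc)) (U r) = B := by
      intro B h1 h2 h3 h4
      rw [cj_eq, gl_coe, U_coe]
      ext i j
      fin_cases i <;> fin_cases j <;> simp [Matrix.mul_apply, Fin.sum_univ_two, h1, h2, h3, h4] <;> grind
    rw [h0 (sl (r * A 0 0) (r * A 0 1) (r * A 1 0) (r * A 1 1)
      (by linear_combination (r * r) * hd + hr)) rfl rfl rfl rfl]
    rw [Rel_iff, sl_coe]
    refine ⟨r, hr, ?_⟩
    simp [← mul_assoc, hr]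

theorem Rel.symm {s s' : SL2 F} (h : Rel s s') : Rel s' s := by
  obtain ⟨r, hr, h⟩ := h
  exact ⟨r, hr, by rw [h, smul_smul, hr, one_smul]⟩

theorem Rel_U {x y : F} (h : Rel (U x) (U y)) : x = y := by
  rw [Rel_iff] at h
  obtain ⟨r, hr, h1, h2, -⟩ := h
  simp only [U_coe] at h1 h2
  simp at h1 h2
  rw [h2, ← h1, one_mul]

theorem Rel_V {x y : F} (h : Rel (V x) (V y)) : x = y := by
  rw [Rel_iff] at h
  obtain ⟨r, hr, h1, -, h2, -⟩ := h
  simp only [V_coe] at h1 h2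
  simp at h1 h2
  rw [h2, ← h1, one_mul]

theorem Rel_UV {x y : F} (h : Rel (U x) (V y)) : x = 0 := by
  rw [Rel_iff] at h
  obtain ⟨r, hr, h1, h2, -⟩ := h
  simp only [U_coe, V_coe] at h1 h2
  simp at h1 h2
  rcases h2 with h2 | h2
  · rw [h2] at hr; simp at hr
  · exact h2

theorem step2 (hπ : ∀ s s', π s = π s' ↔ Rel s s') (hr : ∀ s, ∃ s', π s' = α s)
    (hα : ∀ s s', α s = α s' ↔ Rel s s')
    (z : F) (hz : π (U z) = α (U 1)) (y : F) : ∃ x, π (U x) = α (U y) := by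
  have hz0 : z ≠ 0 := by
    rintro rfl
    rw [U_zero, map_one, ← map_one α, hα, ← U_zero] at hz
    exact zero_ne_one (Rel_U hz)
  obtain ⟨B, hB⟩ := hr (U y)
  obtain ⟨r', hr', ht⟩ := tr_lem π α hπ B y hB
  have hcm : π (U z * B) = π (B * U z) := by
    rw [map_mul, map_mul, hB, hz, ← map_mul, ← map_mul, ← U_add, ← U_add, add_comm]
  rw [hπ, Rel_iff] at hcm
  obtain ⟨r, hr, h1, h2, h3, h4⟩ := hcm
  rw [Matrix.SpecialLinearGroup.coe_mul, Matrix.SpecialLinearGroup.coe_mul, U_coe] at h1 h2 h3 h4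
  simp [Matrix.mul_apply, Fin.sum_univ_two] at h1 h2 h3 h4
  have hd := sl_det B
  have hc : B 1 0 = 0 := by
    by_contra hc
    have hr1 : r = 1 := by
      have : (r - 1) * B 1 0 = 0 := by linear_combination -h3
      rcases mul_eq_zero.1 this with h | h
      · exact sub_eq_zero.1 h
      · exact absurd h hc
    rw [hr1] at h1
    apply mul_ne_zero hz0 hc
    linear_combination -h1
  rw [hc] at hd
  have h1 : (B 0 0 - r') ^ 2 = 0 := by linear_combination B 0 0 * ht + hr' - hd
  have h2 : B 0 0 = r' := sub_eq_zero.1 (pow_eq_zero_iff (two_ne_zero) |>.1 h1)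
  refine ⟨r' * B 0 1, ?_⟩
  rw [← hB, hπ, Rel_iff]
  refine ⟨r', hr', ?_⟩
  rw [U_coe, hc]
  simp
  refine ⟨h2, by linear_combination -(B 0 1) * hr', by linear_combination ht - h2⟩

theorem W_U (y : F) : V y = W * U (-y) * W⁻¹ := by
  rw [eq_mul_inv_iff_mul_eq]
  apply slext
  rw [Matrix.SpecialLinearGroup.coe_mul, Matrix.SpecialLinearGroup.coe_mul, U_coe, V_coe, W_coe]
  ext i j; fin_cases i <;> fin_cases j <;> simp

theorem step3 (hπ : ∀ s s', π s = π s' ↔ Rel s s') (hr : ∀ s, ∃ s', π s' = α s)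
    (hα : ∀ s s', α s = α s' ↔ Rel s s') (f : F → F)
    (hf : ∀ y, π (U (f y)) = α (U y)) :
    ∃ t k : F, ∀ y, π (cj (U t : SL2 F) (V (k * f (- y)))) = α (V y) := by
  obtain ⟨w, hw⟩ := hr W
  have hd := sl_det w
  have hc : w 1 0 ≠ 0 := by
    intro hc
    rw [hc] at hd
    have h1 : α (V 1) = π (U (w 0 0 * w 0 0 * f (-1))) := by
      rw [W_U, map_mul, map_mul, map_inv, ← hw, ← hf, ← map_inv, ← map_mul, ← map_mul]
      congr 1
      rw [mul_inv_eq_iff_eq_mul]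
      apply slext
      rw [Matrix.SpecialLinearGroup.coe_mul, Matrix.SpecialLinearGroup.coe_mul, U_coe, U_coe]
      ext i j
      fin_cases i <;> fin_cases j <;> simp [Matrix.mul_apply, Fin.sum_univ_two, hc]
      linear_combination -(w 0 0 * f (-1)) * hd
    have hs : ∀ (x : F), ∃ x', f x' = x := by
      have : Function.Injective f := by
        intro a b hab
        have : α (U a) = α (U b) := by rw [← hf, ← hf, hab]
        rw [hα] at this
        exact Rel_U this
      exact Finite.injective_iff_surjective.1 this
    obtain ⟨x', hx'⟩ := hs (w 0 0 * w 0 0 * f (-1))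
    rw [← hx', hf] at h1
    have h2 := Rel_UV ((hα _ _).1 h1.symm)
    rw [h2, U_zero, map_one, ← map_one α, hα, ← V_zero] at h1
    exact one_ne_zero (Rel_V h1)
  refine ⟨w 0 0 / w 1 0, - (w 1 0 * w 1 0), fun y => ?_⟩
  rw [W_U y, map_mul α, map_mul α, map_inv α, ← hw, ← hf, ← map_inv, ← map_mul, ← map_mul]
  congr 1
  rw [cj_sl, eq_mul_inv_iff_mul_eq, U_neg]
  apply slext
  rw [Matrix.SpecialLinearGroup.coe_mul, Matrix.SpecialLinearGroup.coe_mul,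
    Matrix.SpecialLinearGroup.coe_mul, Matrix.SpecialLinearGroup.coe_mul, U_coe, U_coe, U_coe, V_coe]
  ext i j
  fin_cases i <;> fin_cases j <;> simp [Matrix.mul_apply, Fin.sum_univ_two] <;> field_simp <;> grind

/-- the final normalised step -/
theorem step4 (hπ : ∀ s s', π s = π s' ↔ Rel s s') 
    (hα : ∀ s s', α s = α s' ↔ Rel s s') (f : F → F) (k : F) (hf1 : f 1 = 1)
    (hf : ∀ y, π (U (f y)) = α (U y)) (hk : ∀ y, π (V (k * f y)) = α (V y)) :
    ∃ σ : F ≃+* F, ∀ y, f y = σ y ∧ k = 1 := by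
  have hadd : ∀ x y, f (x + y) = f x + f y := by
    intro x y
    apply Rel_U
    rw [← hπ, U_add, map_mul, hf, hf, hf, U_add, map_mul]
  have hf0 : f 0 = 0 := by simpa using hadd 0 0
  have hneg : ∀ x, f (-x) = - f x := fun x => by
    have := hadd x (-x)
    rw [add_neg_cancel, hf0] at this
    linear_combination -this
  have hinj : Function.Injective f := by
    intro a b hab
    have : α (U a) = α (U b) := by rw [← hf, ← hf, hab]
    rw [hα] at this
    exact Rel_U this
  have hne : ∀ x, x ≠ 0 → f x ≠ 0 := fun x hx h => hx (hinj (h.trans hf0.symm))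
  -- the basic relation
  have hrel : ∀ x z : F, x ≠ 0 → U x * V (-x⁻¹) * U x * U z = V (-z * x⁻¹ * x⁻¹) * (U x * V (-x⁻¹) * U x) := by
    intro x z hx
    apply slext
    simp only [Matrix.SpecialLinearGroup.coe_mul, U_coe, V_coe]
    ext i j
    fin_cases i <;> fin_cases j <;> simp [Matrix.mul_apply, Fin.sum_univ_two] <;> field_simp <;> grind
  have hrel2 : ∀ x z : F, x ≠ 0 → Rel (U (f x) * V (k * f (-x⁻¹)) * U (f x) * U (f z))
      (V (k * f (-z * x⁻¹ * x⁻¹)) * (U (f x) * V (k * f (-x⁻¹)) * U (f x))) := by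
    intro x z hx
    rw [← hπ]
    simp only [map_mul, hf, hk]
    simp only [← map_mul, hrel x z hx]
  have key0 : ∀ x : F, x ≠ 0 → k * f x * f x⁻¹ = 1 := by
    intro x hx
    have h2 := hrel2 x 1 hx
    rw [Rel_iff] at h2
    obtain ⟨r, hr, h1, h2, -, -⟩ := h2
    simp only [Matrix.SpecialLinearGroup.coe_mul, U_coe, V_coe] at h1 h2
    simp [Matrix.mul_apply, Fin.sum_univ_two, hneg, hf1] at h1 h2
    by_contra hcon
    have h3 : (r - 1) * (1 - k * f x * f x⁻¹) = 0 := by linear_combination -h1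
    rcases mul_eq_zero.1 h3 with h4 | h4
    · have hr1 : r = 1 := sub_eq_zero.1 h4
      rw [hr1] at h2
      apply hcon
      linear_combination h2
    · apply hcon
      linear_combination -h4
  have hk1 : k = 1 := by
    have := key0 1 one_ne_zero
    simpa [hf1] using this
  subst hk1
  have key1 : ∀ x : F, x ≠ 0 → ∀ z, f z = f (z * x⁻¹ * x⁻¹) * (f x * f x) := by
    intro x hx z
    have h0 := key0 x hx
    have h2 := hrel2 x z hx
    rw [Rel_iff] at h2
    obtain ⟨r, hr, h1, h2, h3, h4⟩ := h2
    simp only [Matrix.SpecialLinearGroup.coe_mul, U_coe, V_coe] at h1 h2 h3 h4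
    simp [Matrix.mul_apply, Fin.sum_univ_two, hneg] at h1 h2 h3 h4
    have hz := hne x hx
    rw [one_mul] at h0
    have hr1 : r = 1 := by
      have : (r - 1) * f x = 0 := by
        linear_combination -h2 - (f x * (1 - r) - r * f z) * h0
      rcases mul_eq_zero.1 this with h4 | h4
      · exact sub_eq_zero.1 h4
      · exact absurd h4 hz
    rw [hr1] at h4
    linear_combination (f x) * h4 + (- f z - f x * f x * f (z * x⁻¹ * x⁻¹)) * h0
  have key2 : ∀ x z : F, f (z * (x * x)) = f z * (f x * f x) := by
    intro x z
    by_cases hx : x = 0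
    · subst hx; simp [hf0]
    · rw [key1 x hx (z * (x * x))]
      congr 2
      field_simp
  have hmul : ∀ x y, f (x * y) = f x * f y := by
    intro x y
    by_cases h2 : (2 : F) = 0
    · have : CharP F 2 := by
        apply CharTwo.of_one_ne_zero_of_two_eq_zero one_ne_zero h2
      obtain ⟨s, rfl⟩ := FiniteField.isSquare_of_char_two (ringChar.eq_iff.2 this) y
      rw [key2, ← one_mul (s * s), key2, hf1, one_mul]
    · have h3 := key2 (y + 1) x
      have h4 := key2 y x
      rw [hadd y 1, hf1, show x * ((y + 1) * (y + 1)) = x * (y * y) + (x * y + x * y) + x by ring,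
        hadd, hadd, hadd, h4] at h3
      apply mul_left_cancel₀ h2
      linear_combination h3
  refine ⟨RingEquiv.ofBijective (⟨⟨⟨f, hf1⟩, hmul⟩, hf0, hadd⟩ : F →+* F)
    (Finite.injective_iff_bijective.1 hinj), fun y => ⟨rfl, rfl⟩⟩

theorem cj_comm_Rel (hπ : ∀ s s', π s = π s' ↔ Rel s s') (h : GL2 F) :
    ∀ s s', (π.comp (cj h)) s = (π.comp (cj h)) s' ↔ Rel s s' := by
  intro s s'
  simp only [MonoidHom.comp_apply]
  rw [hπ, Rel.cj_iff]

theorem cj_surj (h : GL2 F) (s : SL2 F) : cj h (cj h⁻¹ s) = s := by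
  rw [← cj_mul]; simp [cj_one]

theorem aut (hπ : ∀ s s', π s = π s' ↔ Rel s s') (hr : ∀ s, ∃ s', π s' = α s)
    (hα : ∀ s s', α s = α s' ↔ Rel s s') :
    ∃ (h : GL2 F) (σ : F ≃+* F), ∀ s,
      α s = π (cj h (Matrix.SpecialLinearGroup.map (σ : F →+* F) s)) := by
  obtain ⟨h1, z, hz⟩ := step1 π α hπ hr
  have hr1 : ∀ s, ∃ s', (π.comp (cj h1)) s' = α s := by
    intro s
    obtain ⟨s', hs'⟩ := hr s
    exact ⟨cj h1⁻¹ s', by rw [MonoidHom.comp_apply, cj_surj, hs']⟩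
  have h2 := step2 (π.comp (cj h1)) α (cj_comm_Rel π hπ h1) hr1 hα z hz
  choose f hf using h2
  obtain ⟨t, k, hk⟩ := step3 (π.comp (cj h1)) α (cj_comm_Rel π hπ h1) hr1 hα f hf
  have hadd : ∀ x y, f (x + y) = f x + f y := by
    intro x y
    apply Rel_U
    rw [← cj_comm_Rel π hπ h1, U_add, map_mul, hf, hf, hf, U_add, map_mul]
  have hf0 : f 0 = 0 := by simpa using hadd 0 0
  have hneg : ∀ x, f (-x) = - f x := fun x => by
    have := hadd x (-x)
    rw [add_neg_cancel, hf0] at this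
    linear_combination -this
  have hinj : Function.Injective f := by
    intro a b hab
    have : α (U a) = α (U b) := by rw [← hf, ← hf, hab]
    rw [hα] at this
    exact Rel_U this
  have hne : f 1 ≠ 0 := fun h => one_ne_zero (hinj (h.trans hf0.symm))
  have cU : ∀ x, cj (gl (f 1) 0 0 1 (by simpa using hne)) (U x) = U (f 1 * x) := by
    intro x
    rw [cj_eq, gl_coe, U_coe, U_coe]
    ext i j; fin_cases i <;> fin_cases j <;> simp
  have cV : ∀ x, cj (gl (f 1) 0 0 1 (by simpa using hne)) (V x) = V (x / f 1) := by
    intro x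
    rw [cj_eq, gl_coe, V_coe, V_coe]
    ext i j; fin_cases i <;> fin_cases j <;> simp [hne]
  have cUU : ∀ x, cj (F := F) (U t : SL2 F) (U x) = U x := by
    intro x
    rw [cj_sl, U_neg, ← U_add, ← U_add]
    congr 1; ring
  set h := h1 * (U t : SL2 F) * gl (f 1) 0 0 1 (by simpa using hne) with hh
  obtain ⟨σ, hσ⟩ := step4 (π.comp (cj h)) α (cj_comm_Rel π hπ h) hα (fun y => f y / f 1)
    (- k * f 1 * f 1) (by simp [hne])
    (by
      intro y
      rw [MonoidHom.comp_apply, hh, cj_mul, cj_mul, cU, cUU, ← hf, MonoidHom.comp_apply]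
      congr 3; field_simp)
    (by
      intro y
      have e : k * -f y = - k * f 1 * f 1 * (f y / f 1) / f 1 := by field_simp
      rw [MonoidHom.comp_apply, hh, cj_mul, cj_mul, cV, ← hk, MonoidHom.comp_apply, hneg, e])
  refine ⟨h, σ, fun s => ?_⟩
  change α s = ((π.comp (cj h)).comp (Matrix.SpecialLinearGroup.map (σ : F →+* F))) s
  apply gen
  · intro x
    rw [← hf, MonoidHom.comp_apply, MonoidHom.comp_apply, MonoidHom.comp_apply]
    have : Matrix.SpecialLinearGroup.map (σ : F →+* F) (U x) = U (f x / f 1) := by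
      apply slext
      rw [(hσ x).1]
      ext i j; fin_cases i <;> fin_cases j <;> simp [U_coe]
    rw [this, hh, cj_mul, cj_mul, cU, cUU]
    congr 3; field_simp
  · intro x
    rw [← hk, MonoidHom.comp_apply, MonoidHom.comp_apply, MonoidHom.comp_apply]
    have : Matrix.SpecialLinearGroup.map (σ : F →+* F) (V x) = V ((- k * f 1 * f 1) * (f x / f 1)) := by
      apply slext
      rw [(hσ x).2, one_mul, (hσ x).1]
      ext i j; fin_cases i <;> fin_cases j <;> simp [V_coe]
    have e : k * -f x = - k * f 1 * f 1 * (f x / f 1) / f 1 := by field_simp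
    rw [this, hh, cj_mul, cj_mul, cV, hneg, e]

end PSL


set_option linter.unusedSectionVars false

namespace PSL

open Matrix

variable {F : Type} [Field F] [Fintype F]

local notation "SL2" => Matrix.SpecialLinearGroup (Fin 2)
local notation "GL2" => Matrix.GeneralLinearGroup (Fin 2)

theorem exists_frob (p : ℕ) [Fact p.Prime] [CharP F p] (σ : F ≃+* F) :
    ∃ k : ℕ, (σ : F →+* F) = iterateFrobenius F p k := by
  let _ := ZMod.algebra F p
  let τ : F →ₐ[ZMod p] F := { (σ : F →+* F) with
    commutes' := fun r => by
      have : ((σ : F →+* F).comp (algebraMap (ZMod p) F)) = algebraMap (ZMod p) F :=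
        Subsingleton.elim _ _
      exact congrArg (fun f => f r) this }
  obtain ⟨n, hn⟩ := (FiniteField.bijective_frobeniusAlgHom_pow (ZMod p) F).2 τ
  refine ⟨n.1, RingHom.ext fun x => ?_⟩
  have := congrArg (fun f => f x) hn
  simp only [AlgHom.coe_pow, FiniteField.coe_frobeniusAlgHom, pow_iterate, ZMod.card] at this
  rw [iterateFrobenius_def, this]
  rfl

variable {G : Type} [Group G] (π : SL2 F →* G)

theorem cj_map (f : F →+* F) (h : GL2 F) (s : SL2 F) :
    cj (Matrix.GeneralLinearGroup.map f h) (Matrix.SpecialLinearGroup.map f s) =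
      Matrix.SpecialLinearGroup.map f (cj h s) := by
  rw [cj_eq]
  change (f.mapMatrix (h : Matrix (Fin 2) (Fin 2) F)) * f.mapMatrix (s : Matrix (Fin 2) (Fin 2) F) =
    f.mapMatrix ((cj h s : SL2 F) : Matrix (Fin 2) (Fin 2) F) * f.mapMatrix (h : Matrix (Fin 2) (Fin 2) F)
  rw [← map_mul, ← map_mul, cj_eq.1 rfl]

theorem map_map' (f g : F →+* F) (s : SL2 F) : Matrix.SpecialLinearGroup.map f
    (Matrix.SpecialLinearGroup.map g s) = Matrix.SpecialLinearGroup.map (f.comp g) s := by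
  apply slext
  ext i j; simp

theorem map_inj (f : F →+* F) (s s' : SL2 F) (h : Matrix.SpecialLinearGroup.map f s =
    Matrix.SpecialLinearGroup.map f s') : s = s' := by
  apply slext
  ext i j
  have := congrArg (fun m : SL2 F => m i j) h
  simp at this
  exact f.injective this

theorem gl_map_surj (f : F →+* F) (h : GL2 F) : ∃ m, Matrix.GeneralLinearGroup.map f m = h := by
  have : Function.Injective (Matrix.GeneralLinearGroup.map f : GL2 F →* GL2 F) := by
    intro a b hab
    apply Units.ext
    ext i j
    have := congrArg (fun m : GL2 F => m i j) hab
    simp at this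
    exact f.injective this
  exact Finite.injective_iff_surjective.1 this h

/-- `x` acts as `h` composed with the field automorphism `f` -/
def Ty (f : F →+* F) (h : GL2 F) (x : G) : Prop :=
  ∀ s, x * π s * x⁻¹ = π (cj h (Matrix.SpecialLinearGroup.map f s))

variable {π}

theorem Ty.mul {f f' : F →+* F} {h h' : GL2 F} {x x' : G} (H : Ty π f h x) (H' : Ty π f' h' x') :
    Ty π (f.comp f') (h * Matrix.GeneralLinearGroup.map f h') (x * x') := by
  intro s
  rw [cj_mul, ← map_map', cj_map, ← H, ← H']
  group

theorem Ty.one : Ty π (RingHom.id F) 1 (1 : G) := by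
  intro s
  rw [cj_one]
  have : Matrix.SpecialLinearGroup.map (RingHom.id F) s = s := by
    apply slext; ext i j; simp
  rw [this]; simp

theorem Ty.div {f : F →+* F} {h h' : GL2 F} {x x' : G} (H : Ty π f h x) (H' : Ty π f h' x') :
    ∃ k, Ty π (RingHom.id F) k (x⁻¹ * x') := by
  obtain ⟨m, hm⟩ := gl_map_surj f (h⁻¹ * h')
  refine ⟨m, fun s => ?_⟩
  have h1 := H' s
  have h2 := H (cj m s)
  rw [← cj_map, hm, ← cj_mul, mul_inv_cancel_left] at h2
  have h3 : Matrix.SpecialLinearGroup.map (RingHom.id F) s = s := by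
    apply slext; ext i j; simp
  rw [h3, show x⁻¹ * x' * π s * (x⁻¹ * x')⁻¹ = x⁻¹ * (x' * π s * x'⁻¹) * x by group, h1, ← h2]
  group

variable (π) in
/-- acts as `h` -/
def R (x : G) (h : GL2 F) : Prop := ∀ s, x * π s * x⁻¹ = π (cj h s)

theorem map_id' (s : SL2 F) : Matrix.SpecialLinearGroup.map (RingHom.id F) s = s := by
    apply slext; ext i j; simp

theorem R_iff {x : G} {h : GL2 F} : R π x h ↔ Ty π (RingHom.id F) h x := by
  unfold R Ty
  simp only [map_id']

theorem R.mul {x y : G} {h k : GL2 F} (H : R π x h) (K : R π y k) : R π (x * y) (h * k) := by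
  intro s
  rw [cj_mul, ← H, ← K]; group

theorem R.inv {x : G} {h : GL2 F} (H : R π x h) : R π x⁻¹ h⁻¹ := by
  intro s
  have := H (cj h⁻¹ s)
  rw [cj_surj] at this
  rw [← this]; group

theorem R_one : R π (1 : G) 1 := by
  intro s; rw [cj_one]; simp

theorem R_sl (s : SL2 F) : R π (π s) (s : GL2 F) := by
  intro t
  rw [cj_sl]; simp

theorem R.scal {x : G} {h k : GL2 F} {r : F} (H : R π x h)
    (e : (h : Matrix (Fin 2) (Fin 2) F) = r • (k : Matrix (Fin 2) (Fin 2) F)) : R π x k := by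
  intro s
  rw [H s]
  congr 1
  rw [cj_eq, e]
  have h0 : (k : Matrix (Fin 2) (Fin 2) F) * s = (cj k s : SL2 F) * (k : Matrix (Fin 2) (Fin 2) F) := cj_eq.1 rfl
  rw [smul_mul_assoc, h0, mul_smul_comm]

theorem R.uniq (hcen : ∀ x : G, (∀ s, x * π s = π s * x) → x = 1) {x y : G} {h : GL2 F}
    (H : R π x h) (K : R π y h) : x = y := by
  rw [← inv_mul_eq_one]
  apply hcen
  intro s
  have h1 := (H.inv.mul K) s
  rw [inv_mul_cancel, cj_one] at h1
  exact mul_inv_eq_iff_eq_mul.1 h1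

theorem R.eq (hcen : ∀ x : G, (∀ s, x * π s = π s * x) → x = 1) {x y : G} {h k : GL2 F}
    (H : R π x h) (K : R π y k) (r : F)
    (e : (h : Matrix (Fin 2) (Fin 2) F) = r • (k : Matrix (Fin 2) (Fin 2) F)) : x = y :=
  R.uniq hcen (H.scal e) K

end PSL


set_option linter.unusedSectionVars false

namespace PSL

open Matrix

variable {F : Type} [Field F] [Fintype F]

local notation "SL2" => Matrix.SpecialLinearGroup (Fin 2)
local notation "GL2" => Matrix.GeneralLinearGroup (Fin 2)

variable {G : Type} [Group G] (π : SL2 F →* G)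

/-- the subgroup of elements acting linearly -/
def NN : Subgroup G where
  carrier := {x | ∃ h, R π x h}
  mul_mem' := by
    rintro a b ⟨h, hh⟩ ⟨k, hk⟩
    exact ⟨_, hh.mul hk⟩
  one_mem' := ⟨_, R_one⟩
  inv_mem' := by
    rintro a ⟨h, hh⟩
    exact ⟨_, hh.inv⟩

theorem mem_NN {x : G} : x ∈ NN π ↔ ∃ h, R π x h := Iff.rfl

/-- diagonal matrix -/
noncomputable def dg (a : Fˣ) : GL2 F := gl (a : F) 0 0 1 (by simp)

theorem dg_coe (a : Fˣ) : ((dg a : GL2 F) : Matrix (Fin 2) (Fin 2) F) = !![(a : F), 0; 0, 1] := rfl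

theorem dg_mul (a b : Fˣ) : dg (a * b) = dg a * dg b := by
  apply Units.ext
  rw [Units.val_mul, dg_coe, dg_coe, dg_coe]
  ext i j; fin_cases i <;> fin_cases j <;> simp

theorem dg_one : dg (1 : Fˣ) = 1 := by
  apply Units.ext
  rw [dg_coe, Units.val_one]
  ext i j; fin_cases i <;> fin_cases j <;> simp

theorem dg_inv (a : Fˣ) : dg a⁻¹ = (dg a)⁻¹ := by
  rw [eq_inv_iff_mul_eq_one, ← dg_mul]; simp [dg_one]

/-- the group of possible diagonal entries -/
def Del : Subgroup Fˣ where
  carrier := {a | ∃ x, R π x (dg a)}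
  mul_mem' := by
    rintro a b ⟨h, hh⟩ ⟨k, hk⟩
    exact ⟨_, by rw [dg_mul]; exact hh.mul hk⟩
  one_mem' := ⟨1, by rw [dg_one]; exact R_one⟩
  inv_mem' := by
    rintro a ⟨h, hh⟩
    exact ⟨_, by rw [dg_inv]; exact hh.inv⟩

theorem mem_Del {a : Fˣ} : a ∈ Del π ↔ ∃ x, R π x (dg a) := Iff.rfl

open Classical in
/-- the torus elements -/
noncomputable def tt (a : Fˣ) : NN π :=
  if h : ∃ x, R π x (dg a) then ⟨h.choose, ⟨_, h.choose_spec⟩⟩ else 1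

variable {π}

theorem tt_R {a : Fˣ} (h : a ∈ Del π) : R π (tt π a : G) (dg a) := by
  rw [mem_Del] at h
  unfold tt
  rw [dif_pos h]
  exact h.choose_spec

variable (π) in
/-- elements of SL2 in N -/
def nn (s : SL2 F) : NN π := ⟨π s, ⟨_, R_sl s⟩⟩

theorem nn_R (s : SL2 F) : R π (nn π s : G) (s : GL2 F) := R_sl s

theorem toGL_coe (s : SL2 F) : ((s : GL2 F) : Matrix (Fin 2) (Fin 2) F) = (s : Matrix (Fin 2) (Fin 2) F) := rfl

/-- diag(1,-1) -/
noncomputable def eps : GL2 F := gl 1 0 0 (-1) (by simp)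

theorem eps_coe : ((eps : GL2 F) : Matrix (Fin 2) (Fin 2) F) = !![1, 0; 0, -1] := rfl

/-- anti-automorphism relation -/
def E (π : SL2 F →* G) (n m : G) : Prop := ∀ s s', n * π s * n⁻¹ = π s' →
  m⁻¹ * π (cj eps s) * m = π (cj eps s')

theorem E_of_R (hπ : ∀ s s', π s = π s' ↔ Rel s s') {n m : G} {h : GL2 F} (H : R π n h)
    (K : R π m (eps * h⁻¹ * eps⁻¹)) : E π n m := by
  intro s s' hs
  rw [H s, hπ] at hs
  have h1 := K (cj eps s')
  rw [cj_mul, cj_inv_cj, cj_mul] at h1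
  have h2 : Rel (cj h⁻¹ (cj h s)) (cj h⁻¹ s') := hs.cj _
  rw [cj_inv_cj] at h2
  have h3 := (hπ _ _).2 (h2.cj eps)
  rw [← h3] at h1
  rw [← h1]
  group

theorem E_mul (hnorm : ∀ (x : G) s, ∃ s', π s' = x * π s * x⁻¹) {n m n' m' : G} (H : E π n m)
    (H' : E π n' m') : E π (n * n') (m' * m) := by
  intro s s' hs
  obtain ⟨s1, hs1⟩ := hnorm n' s
  have h1 := H' s s1 hs1.symm
  have h2 := H s1 s' (by rw [hs1, ← hs]; group)
  rw [← h2, ← h1]; group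

theorem E_uniq (hnorm : ∀ (x : G) s, ∃ s', π s' = x * π s * x⁻¹)
    (hcen : ∀ x : G, (∀ s, x * π s = π s * x) → x = 1) {n m m' : G} (H : E π n m)
    (H' : E π n m') : m = m' := by
  rw [← mul_inv_eq_one]
  apply hcen
  intro s
  obtain ⟨s', hs'⟩ := hnorm n (cj eps⁻¹ s)
  have h1 := H _ _ hs'.symm
  have h2 := H' _ _ hs'.symm
  rw [cj_surj] at h1 h2
  rw [← h1] at h2
  have h3 : π s = m' * (m⁻¹ * π s * m) * m'⁻¹ := by rw [← h2]; group
  have h4 : m'⁻¹ * π s = (m⁻¹ * π s * m) * m'⁻¹ := by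
    rw [eq_mul_inv_iff_mul_eq]; exact h2
  rw [mul_assoc, h4]; group

theorem exists_E (hπ : ∀ s s', π s = π s' ↔ Rel s s') (n : NN π) :
    ∃ m : NN π, ∃ h, R π n h ∧ R π m (eps * h⁻¹ * eps⁻¹) ∧ E π n m := by
  obtain ⟨h, hh⟩ := n.2
  have hdet : Matrix.det ((h * eps * h⁻¹ * eps⁻¹ : GL2 F) : Matrix (Fin 2) (Fin 2) F) = 1 := by
    have : Matrix.GeneralLinearGroup.det (h * eps * h⁻¹ * eps⁻¹ : GL2 F) = 1 := by
      simp
    exact congrArg Units.val this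
  have key : ∃ m, R π m (eps * h⁻¹ * eps⁻¹) := by
    refine ⟨(n : G)⁻¹ * π ⟨_, hdet⟩, ?_⟩
    have h1 := hh.inv.mul (R_sl (π := π) ⟨_, hdet⟩)
    have h2 : (Matrix.SpecialLinearGroup.toGL (⟨_, hdet⟩ : SL2 F) : GL2 F) = h * eps * h⁻¹ * eps⁻¹ := by
      apply Units.ext; rfl
    rw [h2] at h1
    convert h1 using 1
    group
  obtain ⟨m, hm⟩ := key
  exact ⟨⟨m, ⟨_, hm⟩⟩, h, hh, hm, E_of_R hπ hh hm⟩

theorem NN_eq (hcen : ∀ x : G, (∀ s, x * π s = π s * x) → x = 1) {x y : NN π} {h k : GL2 F}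
    (H : R π (x : G) h) (K : R π (y : G) k) (r : F)
    (e : (h : Matrix (Fin 2) (Fin 2) F) = r • (k : Matrix (Fin 2) (Fin 2) F)) : x = y :=
  Subtype.ext (R.eq hcen H K r e)

theorem sq_Del (a : Fˣ) : a ^ 2 ∈ Del π := by
  refine ⟨π (sl (a : F) 0 0 (a⁻¹ : Fˣ) (by simp)), (R_sl _).scal (r := ((a⁻¹ : Fˣ) : F)) ?_⟩
  rw [toGL_coe, sl_coe, dg_coe]
  ext i j; fin_cases i <;> fin_cases j <;> simp [sq]

/-- The main structure -/
noncomputable def ax (hπ : ∀ s s', π s = π s' ↔ Rel s s')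
    (hnorm : ∀ (x : G) s, ∃ s', π s' = x * π s * x⁻¹)
    (hcen : ∀ x : G, (∀ s, x * π s = π s * x) → x = 1) : Ax F (NN π) (Del π) where
  u x := nn π (U x)
  t := tt π
  w := nn π W
  ι n := (exists_E hπ n).choose
  u_add x y := by
    apply Subtype.ext
    change π _ = π _ * π _
    rw [U_add, map_mul]
  t_mul a ha b hb := by
    refine NN_eq hcen (tt_R (mul_mem ha hb)) ((tt_R ha).mul (tt_R hb)) 1 ?_
    rw [dg_mul, one_smul]
  tu a ha x := by
    refine NN_eq hcen ((tt_R ha).mul (nn_R _)) ((nn_R _).mul (tt_R ha)) 1 ?_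
    simp only [Units.val_mul, toGL_coe, dg_coe, U_coe]
    ext i j; fin_cases i <;> fin_cases j <;> simp
  ww := by
    refine NN_eq hcen ((nn_R _).mul (nn_R _)) R_one (-1) ?_
    simp only [Units.val_mul, toGL_coe, W_coe]
    ext i j; fin_cases i <;> fin_cases j <;> simp
  wt a ha := by
    refine NN_eq hcen ((nn_R _).mul (tt_R ha)) ((tt_R (inv_mem ha)).mul (nn_R _)) a ?_
    simp only [Units.val_mul, toGL_coe, W_coe, dg_coe]
    ext i j; fin_cases i <;> fin_cases j <;> simp
  wuw x := by
    refine NN_eq hcen (((nn_R _).mul (nn_R _)).mul (nn_R _))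
      ((((nn_R _).mul (tt_R (sq_Del _))).mul (nn_R _)).mul (nn_R _)) (-x) ?_
    simp only [Units.val_mul, toGL_coe, W_coe, dg_coe, U_coe]
    ext i j; fin_cases i <;> fin_cases j <;> simp [sq]
  sq a := sq_Del a
  bruhat g := by
    obtain ⟨h, hh⟩ := g.2
    obtain ⟨a, b, c, d, hm⟩ : ∃ a b c d, (h : Matrix (Fin 2) (Fin 2) F) = !![a, b; c, d] :=
      ⟨_, _, _, _, Matrix.eta_fin_two _⟩
    have hdet : a * d - b * c ≠ 0 := by
      have := h.isUnit
      rw [Matrix.isUnit_iff_isUnit_det, hm, Matrix.det_fin_two_of] at this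
      exact this.ne_zero
    by_cases hc : c = 0
    · subst hc
      have ha : a ≠ 0 := by rintro rfl; simp at hdet
      have hd : d ≠ 0 := by rintro rfl; simp at hdet
      have h1 : R π ((nn π (U (-(b / d))) * g : NN π) : G) (dg (Units.mk0 (a / d) (div_ne_zero ha hd))) := by
        refine ((nn_R (U (-(b / d)))).mul hh).scal (r := d) ?_
        simp only [Units.val_mul, toGL_coe, dg_coe, U_coe, hm]
        ext i j; fin_cases i <;> fin_cases j <;> simp [field]
      have h2 : Units.mk0 (a / d) (div_ne_zero ha hd) ∈ Del π := ⟨_, h1⟩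
      refine ⟨b / d, _, h2, Or.inl ?_⟩
      have h3 : nn π (U (-(b / d))) * g = tt π (Units.mk0 (a / d) (div_ne_zero ha hd)) :=
        Subtype.ext (R.uniq hcen h1 (tt_R h2))
      rw [← h3, ← mul_assoc]
      have h4 : nn π (U (b / d)) * nn π (U (-(b / d))) = 1 := by
        apply Subtype.ext
        change π _ * π _ = 1
        rw [← map_mul, ← U_add]; simp [U_zero]
      rw [h4, one_mul]
    · have hδ : (a * d - b * c) / (c * c) ≠ 0 := div_ne_zero hdet (mul_ne_zero hc hc)
      have h1 : R π ((nn π (U (-(a / c))) * g * nn π (U (-(d / c))) * nn π W : NN π) : G) (dg (Units.mk0 _ hδ)) := by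
        refine ((((nn_R (U (-(a / c)))).mul hh).mul (nn_R _)).mul (nn_R _)).scal (r := c) ?_
        simp only [Units.val_mul, toGL_coe, dg_coe, U_coe, hm, W_coe]
        ext i j; fin_cases i <;> fin_cases j <;> simp [field] <;> ring
      have h2 : Units.mk0 _ hδ ∈ Del π := ⟨_, h1⟩
      refine ⟨a / c, _, h2, Or.inr ⟨d / c, ?_⟩⟩
      refine NN_eq hcen hh ((((nn_R _).mul (tt_R h2)).mul (nn_R _)).mul (nn_R _)) (-c) ?_
      simp only [Units.val_mul, toGL_coe, dg_coe, U_coe, hm, W_coe]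
      ext i j; fin_cases i <;> fin_cases j <;> simp [field]
  ι_mul g h := by
    obtain ⟨k1, -, -, h1⟩ := (exists_E hπ (g * h)).choose_spec
    obtain ⟨k2, -, -, h2⟩ := (exists_E hπ g).choose_spec
    obtain ⟨k3, -, -, h3⟩ := (exists_E hπ h).choose_spec
    exact Subtype.ext (E_uniq hnorm hcen h1 (E_mul hnorm h2 h3))
  ι_u x := by
    obtain ⟨k1, -, -, h1⟩ := (exists_E hπ (nn π (U x))).choose_spec
    refine Subtype.ext (E_uniq hnorm hcen h1 (E_of_R hπ (nn_R _) ?_))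
    refine (nn_R _).scal (r := 1) ?_
    rw [one_smul, ← Units.ext_iff, eq_mul_inv_iff_mul_eq, eq_mul_inv_iff_mul_eq]
    apply Units.ext
    simp only [Units.val_mul, toGL_coe, U_coe, eps_coe]
    ext i j; fin_cases i <;> fin_cases j <;> simp
  ι_t a ha := by
    obtain ⟨k1, -, -, h1⟩ := (exists_E hπ (tt π a)).choose_spec
    refine Subtype.ext (E_uniq hnorm hcen h1 (E_of_R hπ (tt_R ha) ?_))
    refine (tt_R (inv_mem ha)).scal (r := 1) ?_
    rw [one_smul, ← Units.ext_iff, eq_mul_inv_iff_mul_eq, eq_mul_inv_iff_mul_eq]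
    apply Units.ext
    simp only [Units.val_mul, dg_coe, eps_coe]
    ext i j; fin_cases i <;> fin_cases j <;> simp
  ι_w := by
    obtain ⟨k1, -, -, h1⟩ := (exists_E hπ (nn π W)).choose_spec
    refine Subtype.ext (E_uniq hnorm hcen h1 (E_of_R hπ (nn_R _) ?_))
    refine (nn_R _).scal (r := 1) ?_
    rw [one_smul, ← Units.ext_iff, eq_mul_inv_iff_mul_eq, eq_mul_inv_iff_mul_eq]
    apply Units.ext
    simp only [Units.val_mul, toGL_coe, W_coe, eps_coe]
    ext i j; fin_cases i <;> fin_cases j <;> simp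

end PSL


set_option linter.unusedSectionVars false

namespace PSL

open Matrix

variable {F : Type} [Field F] [Fintype F]

local notation "SL2" => Matrix.SpecialLinearGroup (Fin 2)
local notation "GL2" => Matrix.GeneralLinearGroup (Fin 2)

variable {G : Type} [Group G] {π : SL2 F →* G} {p : ℕ} [Fact p.Prime] [CharP F p]

variable (π p) in
/-- `x` induces the field automorphism `Frob^k` up to linear ones -/
def T (k : ℕ) (x : G) : Prop := ∃ h, Ty π (iterateFrobenius F p k) h x

theorem T.mul {k l : ℕ} {x y : G} (hx : T π p k x) (hy : T π p l y) : T π p (k + l) (x * y) := by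
  obtain ⟨h, hh⟩ := hx
  obtain ⟨h', hh'⟩ := hy
  have := hh.mul hh'
  rw [← iterateFrobenius_add] at this
  exact ⟨_, this⟩

theorem frob_zero : iterateFrobenius F p 0 = RingHom.id F := by
  ext x; simp

theorem T_zero {x : G} : T π p 0 x ↔ x ∈ NN π := by
  unfold T
  rw [frob_zero, mem_NN]
  simp only [R_iff]

theorem T.div {k : ℕ} {x y : G} (hx : T π p k x) (hy : T π p k y) : x⁻¹ * y ∈ NN π := by
  obtain ⟨h, hh⟩ := hx
  obtain ⟨h', hh'⟩ := hy
  obtain ⟨m, hm⟩ := hh.div hh'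
  exact ⟨m, R_iff.2 hm⟩

theorem T.pow {k : ℕ} {x : G} (hx : T π p k x) (n : ℕ) : T π p (n * k) (x ^ n) := by
  induction n with
  | zero => simpa [T_zero] using one_mem _
  | succ n ih => rw [pow_succ, Nat.succ_mul]; exact ih.mul hx

theorem frob_mod {f : ℕ} (hf : Fintype.card F = p ^ f) (k n : ℕ) :
    iterateFrobenius F p (k + n * f) = iterateFrobenius F p k := by
  ext x
  rw [iterateFrobenius_def, iterateFrobenius_def, pow_add, pow_mul, mul_comm n f, pow_mul p f n,
    ← hf, FiniteField.pow_card_pow]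

theorem T_mod {f : ℕ} (hf : Fintype.card F = p ^ f) {k n : ℕ} {x : G} (h : T π p (k + n * f) x) :
    T π p k x := by
  unfold T at h
  rwa [frob_mod hf] at h

variable (p) in
theorem exists_T (hπ : ∀ s s', π s = π s' ↔ Rel s s')
    (hnorm : ∀ (x : G) s, ∃ s', π s' = x * π s * x⁻¹) (x : G) : ∃ k, T π p k x := by
  obtain ⟨h, σ, hσ⟩ := aut π ((MulAut.conj x).toMonoidHom.comp π) hπ (hnorm x)
    (fun s s' => by rw [← hπ]; simp)
  obtain ⟨k, hk⟩ := exists_frob p σ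
  exact ⟨k, h, fun s => by rw [← hk, ← hσ]; rfl⟩

theorem NN_normal {f : ℕ} (hf0 : 0 < f) (hf : Fintype.card F = p ^ f) (hπ : ∀ s s', π s = π s' ↔ Rel s s')
    (hnorm : ∀ (x : G) s, ∃ s', π s' = x * π s * x⁻¹) : (NN π).Normal := by
  constructor
  intro n hn g
  obtain ⟨k, hk⟩ := exists_T p hπ hnorm g⁻¹
  have h1 := hk.div ((T_zero (p := p).2 hn).mul hk |> fun h => by simpa using h)
  simpa [mul_assoc] using h1

theorem exists_d0 {f : ℕ} (hf0 : 0 < f) (hf : Fintype.card F = p ^ f) (hπ : ∀ s s', π s = π s' ↔ Rel s s')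
    (hnorm : ∀ (x : G) s, ∃ s', π s' = x * π s * x⁻¹) :
    ∃ d0 d g, 0 < d0 ∧ 0 < d ∧ d0 * d = f ∧ T π p d0 g ∧ g ^ d ∈ NN π ∧
      ∀ x : G, ∃ k : ℕ, ∃ n ∈ NN π, x = g ^ k * n := by
  classical
  have hff : T π p f (1 : G) := by
    have : T π p 0 (1 : G) := T_zero.2 (one_mem _)
    unfold T at this ⊢
    rwa [← frob_mod hf 0 1, zero_add, one_mul] at this
  have hex : ∃ k, 0 < k ∧ ∃ x : G, T π p k x := ⟨f, hf0, 1, hff⟩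
  obtain ⟨h0, g, hg⟩ := Nat.find_spec hex
  have hmin : ∀ k, 0 < k → ∀ x : G, T π p k x → Nat.find hex ≤ k :=
    fun k h1 x h2 => Nat.find_min' hex ⟨h1, x, h2⟩
  generalize Nat.find hex = d0 at h0 hg hmin
  have hdvd : ∀ k (x : G), T π p k x → d0 ∣ k := by
    intro k x hx
    rw [Nat.dvd_iff_mod_eq_zero]
    by_contra hne
    have h1 := hx.mul (hg.pow ((f - 1) * (k / d0)))
    have h2 : k + (f - 1) * (k / d0) * d0 = k % d0 + (k / d0 * d0) * f := by
      obtain ⟨e, rfl⟩ : ∃ e, f = e + 1 := ⟨f - 1, by omega⟩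
      have := Nat.div_add_mod k d0
      simp only [Nat.add_sub_cancel]
      nlinarith
    rw [h2] at h1
    have := hmin _ (Nat.pos_of_ne_zero hne) _ (T_mod hf h1)
    have := Nat.mod_lt k h0
    omega
  obtain ⟨d, hd⟩ := hdvd _ _ hff
  refine ⟨d0, d, g, h0, ?_, hd.symm, hg, ?_, ?_⟩
  · rcases Nat.eq_zero_or_pos d with h | h
    · subst h; omega
    · exact h
  · have h1 := hg.pow d
    rw [mul_comm, ← hd] at h1
    have := hff.div h1
    simpa using this
  · intro x
    obtain ⟨k, hk⟩ := exists_T p hπ hnorm x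
    obtain ⟨j, hj⟩ := hdvd _ _ hk
    have h1 := hg.pow j
    rw [mul_comm, ← hj] at h1
    exact ⟨j, _, h1.div hk, by group⟩

theorem exists_sqrt [CharP F 2] (a : F) : ∃ b, b * b = a := by
  obtain ⟨b, hb⟩ := FiniteField.isSquare_of_char_two (F := F) (ringChar.eq F 2) a
  exact ⟨b, hb.symm⟩

theorem Del_top [CharP F 2] : Del π = ⊤ := by
  rw [eq_top_iff]
  intro a _
  obtain ⟨b, hb⟩ := exists_sqrt (a : F)
  have hb0 : b ≠ 0 := by rintro rfl; simp at hb; exact a.ne_zero hb.symm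
  have := sq_Del (π := π) (Units.mk0 b hb0)
  convert this using 1
  apply Units.ext
  rw [← hb]; simp [sq]

theorem exists_frob_elt [CharP F 2] {g : G} (hg : T π 2 1 g) :
    ∃ g' : G, (∀ x, g' * π (U x) * g'⁻¹ = π (U (x ^ 2))) ∧ g' * π W * g'⁻¹ = π W := by
  obtain ⟨h, hh⟩ := hg
  obtain ⟨b, hb⟩ := exists_sqrt (Matrix.det (h : Matrix (Fin 2) (Fin 2) F))
  have hd : Matrix.det (h : Matrix (Fin 2) (Fin 2) F) ≠ 0 :=
    ((Matrix.isUnit_iff_isUnit_det _).1 h.isUnit).ne_zero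
  have hb0 : b ≠ 0 := by rintro rfl; simp at hb; exact hd hb.symm
  let s0 : SL2 F := ⟨b⁻¹ • (h : Matrix (Fin 2) (Fin 2) F), by
    rw [Matrix.det_smul, ← hb]; simp; field_simp⟩
  have hs0 : ∀ s, cj h s = s0 * s * s0⁻¹ := by
    intro s
    rw [cj_eq]
    have h1 : (h : Matrix (Fin 2) (Fin 2) F) = b • (s0 : Matrix (Fin 2) (Fin 2) F) := by
      change _ = b • (b⁻¹ • (h : Matrix (Fin 2) (Fin 2) F))
      rw [smul_smul, mul_inv_cancel₀ hb0, one_smul]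
    rw [h1, smul_mul_assoc, mul_smul_comm]
    congr 1
    have : (s0 * s : SL2 F) = s0 * s * s0⁻¹ * s0 := by group
    exact congrArg Subtype.val this
  refine ⟨(π s0)⁻¹ * g, fun x => ?_, ?_⟩
  · have h1 := hh (U x)
    rw [hs0] at h1
    have h2 : Matrix.SpecialLinearGroup.map (iterateFrobenius F 2 1) (U x) = U (x ^ 2) := by
      apply slext
      ext i j; fin_cases i <;> fin_cases j <;> simp [U_coe, frobenius_def]
    rw [h2, map_mul, map_mul, map_inv] at h1
    rw [show (π s0)⁻¹ * g * π (U x) * ((π s0)⁻¹ * g)⁻¹ = (π s0)⁻¹ * (g * π (U x) * g⁻¹) * π s0 by group, h1]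
    group
  · have h1 := hh W
    rw [hs0] at h1
    have h2 : Matrix.SpecialLinearGroup.map (iterateFrobenius F 2 1) (W : SL2 F) = W := by
      apply slext
      ext i j; fin_cases i <;> fin_cases j <;> simp [W_coe, iterateFrobenius_def]
    rw [h2, map_mul, map_mul, map_inv] at h1
    rw [show (π s0)⁻¹ * g * π W * ((π s0)⁻¹ * g)⁻¹ = (π s0)⁻¹ * (g * π W * g⁻¹) * π s0 by group, h1]
    group

end PSL


set_option linter.unusedSectionVars false

namespace Arith

/-- number of prime factors -/
def Om (n : ℕ) : ℕ := n.primeFactorsList.length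

theorem Om_mul {a b : ℕ} (ha : a ≠ 0) (hb : b ≠ 0) : Om (a * b) = Om a + Om b :=
  ArithmeticFunction.cardFactors_mul ha hb

theorem Om_pos {a : ℕ} (ha : 2 ≤ a) : 1 ≤ Om a := by
  unfold Om
  rw [Nat.one_le_iff_ne_zero]
  intro h
  rw [List.length_eq_zero_iff, Nat.primeFactorsList_eq_nil] at h
  omega

theorem Om_one_prime {a : ℕ} (h : Om a = 1) : a.Prime := ArithmeticFunction.cardFactors_eq_one_iff_prime.1 h

theorem om2 {a b : ℕ} (ha : 2 ≤ a) (hb : 2 ≤ b) : 2 ≤ Om (a * b) := by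
  rw [Om_mul (by omega) (by omega)]
  have := Om_pos ha
  have := Om_pos hb
  omega

theorem om3 {a b c : ℕ} (ha : 2 ≤ a) (hb : 2 ≤ b) (hc : 2 ≤ c) : 3 ≤ Om (a * b * c) := by
  rw [Om_mul (by positivity) (by omega)]
  have := om2 ha hb
  have := Om_pos hc
  omega

/-- chain of strict divisors -/
theorem chain {a b c : ℕ} (ha : 2 ≤ a) (hab : a ∣ b) (h1 : a < b) (hbc : b ∣ c) (h2 : b < c) :
    3 ≤ Om c := by
  obtain ⟨x, rfl⟩ := hab
  obtain ⟨y, rfl⟩ := hbc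
  apply om3 ha
  · by_contra h
    have : x ≤ 1 := by omega
    nlinarith
  · by_contra h
    have : y ≤ 1 := by omega
    nlinarith

theorem odd_dvd (p e a : ℕ) (ha : Odd a) : p ^ e + 1 ∣ p ^ (e * a) + 1 := by
  have := ha.nat_add_dvd_pow_add_pow (p ^ e) 1
  rwa [one_pow, ← pow_mul] at this

theorem sub_dvd (p e a : ℕ) : p ^ e - 1 ∣ p ^ (e * a) - 1 := by
  have := Nat.sub_dvd_pow_sub_pow (p ^ e) 1 a
  rwa [one_pow, ← pow_mul] at this

theorem odd_or {a b : ℕ} (h : Nat.Coprime a b) : Odd a ∨ Odd b := by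
  by_contra hc
  push Not at hc
  rw [Nat.not_odd_iff_even, Nat.not_odd_iff_even] at hc
  have := Nat.dvd_gcd hc.1.two_dvd hc.2.two_dvd
  rw [h] at this
  omega

section comb
variable {m : ℕ} {I : Finset ℕ} {f : ℕ} (hI : ∀ i ∈ I, i ∣ f) (hf : 0 < f)
  (h : ∀ i ∈ I, ∀ j ∈ I, i ≠ j → Om m + Om (Nat.gcd i j) ≤ 2)

include h in
theorem card1 (hm : 3 ≤ Om m) : I.card ≤ 1 := by
  rw [Finset.card_le_one]
  intro a ha b hb
  by_contra hab
  have := h a ha b hb hab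
  omega

include hI hf h in
theorem cop (hm : Om m = 2) : ∀ i ∈ I, ∀ j ∈ I, i ≠ j → Nat.Coprime i j := by
  intro i hi j hj hij
  have h1 := h i hi j hj hij
  have h2 : Nat.gcd i j ≠ 0 := by
    intro h0
    have := Nat.eq_zero_of_gcd_eq_zero_left h0
    subst this
    have := hI _ hi
    rw [zero_dvd_iff] at this
    omega
  by_contra h3
  have h4 : Nat.gcd i j ≠ 1 := h3
  have := Om_pos (a := Nat.gcd i j) (by omega)
  omega

include hI hf h in
theorem card3 (hm : Om m = 2) (h3 : 3 ≤ I.card) : ∃ a b e, 2 ≤ a ∧ 2 ≤ b ∧ 0 < e ∧ Nat.Coprime a b ∧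
    f = e * a * b := by
  have h4 : 1 < (I.erase 1).card := by
    have := Finset.pred_card_le_card_erase (s := I) (a := 1)
    omega
  obtain ⟨a, ha, b, hb, hab⟩ := Finset.one_lt_card.1 h4
  rw [Finset.mem_erase] at ha hb
  have hc := cop hI hf h hm a ha.2 b hb.2 hab
  obtain ⟨e, he⟩ := hc.mul_dvd_of_dvd_of_dvd (hI _ ha.2) (hI _ hb.2)
  have ha0 : a ≠ 0 := by rintro rfl; simp at he; omega
  have hb0 : b ≠ 0 := by rintro rfl; simp at he; omega
  have he0 : e ≠ 0 := by rintro rfl; simp at he; omega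
  exact ⟨a, b, e, by omega, by omega, by omega, hc, by rw [he]; ring⟩

include hI hf h in
theorem card4 (hm : Om m = 2) (h3 : 4 ≤ I.card) : ∃ a b e, 2 ≤ a ∧ 2 ≤ b ∧ 0 < e ∧ Odd a ∧ Odd b ∧
    f = e * a * b := by
  have h4 : 2 < (I.erase 1).card := by
    have := Finset.pred_card_le_card_erase (s := I) (a := 1)
    omega
  obtain ⟨a, ha, b, hb, c, hc', hab, hac, hbc⟩ := Finset.two_lt_card.1 h4
  rw [Finset.mem_erase] at ha hb hc'
  have key : ∀ a b, a ≠ 1 → b ≠ 1 → a ∈ I → b ∈ I → a ≠ b → Odd a → Odd b → ∃ a b e, 2 ≤ a ∧ 2 ≤ b ∧ 0 < e ∧ Odd a ∧ Odd b ∧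
      f = e * a * b := by
    intro a b h1 h2 h3 h4 h5 h6 h7
    have hc := cop hI hf h hm a h3 b h4 h5
    obtain ⟨e, he⟩ := hc.mul_dvd_of_dvd_of_dvd (hI _ h3) (hI _ h4)
    have ha0 : a ≠ 0 := by rintro rfl; simp at he; omega
    have hb0 : b ≠ 0 := by rintro rfl; simp at he; omega
    have he0 : e ≠ 0 := by rintro rfl; simp at he; omega
    exact ⟨a, b, e, by omega, by omega, by omega, h6, h7, by rw [he]; ring⟩
  have k1 := odd_or (cop hI hf h hm a ha.2 b hb.2 hab)
  have k2 := odd_or (cop hI hf h hm a ha.2 c hc'.2 hac)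
  have k3 := odd_or (cop hI hf h hm b hb.2 c hc'.2 hbc)
  by_cases oa : Odd a
  · by_cases ob : Odd b
    · exact key a b ha.1 hb.1 ha.2 hb.2 hab oa ob
    · exact key a c ha.1 hc'.1 ha.2 hc'.2 hac oa (k3.resolve_left ob)
  · exact key b c hb.1 hc'.1 hb.2 hc'.2 hbc (k1.resolve_left oa) (k2.resolve_left oa)

theorem two_pow_facts {f k : ℕ} (hfk : f = 2 ^ k) {i : ℕ} (hi : i ∣ f) : i = 1 ∨ i = 2 ∨ 4 ∣ i := by
  subst hfk
  obtain ⟨j, -, rfl⟩ := (Nat.dvd_prime_pow Nat.prime_two).1 hi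
  rcases j with _ | _ | j
  · simp
  · simp
  · right; right; exact ⟨2 ^ j, by ring⟩

include hI hf h in
/-- case of a Fermat prime -/
theorem cardF (hm : Om m = 1) {k : ℕ} (hk : f = 2 ^ k) : I.card ≤ 3 := by
  by_contra hc
  have h1 : 1 < ((I.erase 1).erase 2).card := by
    have := Finset.pred_card_le_card_erase (s := I) (a := 1)
    have := Finset.pred_card_le_card_erase (s := I.erase 1) (a := 2)
    omega
  obtain ⟨a, ha, b, hb, hab⟩ := Finset.one_lt_card.1 h1
  simp only [Finset.mem_erase] at ha hb
  have h2 := two_pow_facts hk (hI a ha.2.2)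
  have h3 := two_pow_facts hk (hI b hb.2.2)
  have h4 : 4 ∣ Nat.gcd a b := Nat.dvd_gcd (by tauto) (by tauto)
  have h5 := h a ha.2.2 b hb.2.2 hab
  obtain ⟨c, hc⟩ := h4
  have hc0 : c ≠ 0 := by
    rintro rfl
    have := Nat.eq_zero_of_gcd_eq_zero_left hc
    subst this
    have := hI _ ha.2.2
    rw [zero_dvd_iff] at this
    omega
  rw [hc, Om_mul (by norm_num) hc0, show (4:ℕ) = 2 * 2 by rfl] at h5
  have := om2 (le_refl 2) (le_refl 2)
  omega

end comb

theorem odd_case {p f : ℕ} (hp : Odd p) (hp1 : 2 ≤ p) (hf : 0 < f) (hq : 7 ≤ p ^ f) {I J : Finset ℕ} (hI : ∀ i ∈ I, i ∣ f)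
    (hJ : ∀ i ∈ J, i ∣ f) 
    (h : ∀ i ∈ I, ∀ j ∈ I, i ≠ j → Om (p ^ f - 1) + Om (Nat.gcd i j) ≤ 2)
    (h' : ∀ i ∈ J, ∀ j ∈ J, i ≠ j → Om (p ^ f + 1) + Om (Nat.gcd i j) ≤ 2) :
    I.card + J.card ≤ 3 := by
  have hp3 : 3 ≤ p := by obtain ⟨k, hk⟩ := hp; omega
  have hodd : Odd (p ^ f) := hp.pow
  have hle : ∀ (m : ℕ) (I : Finset ℕ), (∀ i ∈ I, i ∣ f) →
      (∀ i ∈ I, ∀ j ∈ I, i ≠ j → Om m + Om (Nat.gcd i j) ≤ 2) → 2 ≤ Om m →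
      (∀ a b e, 2 ≤ a → 2 ≤ b → 0 < e → Nat.Coprime a b → f = e * a * b → 3 ≤ Om m) →
      I.card ≤ 2 := by
    intro m I hI h h2 h3
    by_contra hc
    rcases h2.lt_or_eq with h4 | h4
    · have := card1 h h4
      omega
    · obtain ⟨a, b, e, ha, hb, he, hab, hfe⟩ := card3 hI hf h h4.symm (by omega)
      have := h3 a b e ha hb he hab hfe
      omega
  have hmod : p ^ f % 4 = 1 ∨ p ^ f % 4 = 3 := by obtain ⟨k, hk⟩ := hodd; omega
  rcases hmod with hm | hm
  · have h1 : I.card ≤ 1 := by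
      apply card1 h
      obtain ⟨k, hk⟩ : ∃ k, p ^ f - 1 = 2 * 2 * k := ⟨(p ^ f - 1) / 4, by omega⟩
      rw [hk]
      exact om3 (by norm_num) (by norm_num) (by omega)
    have h2 : J.card ≤ 2 := by
      refine hle (p ^ f + 1) J hJ h' ?_ ?_
      · obtain ⟨k, hk⟩ : ∃ k, p ^ f + 1 = 2 * k := ⟨(p ^ f + 1) / 2, by omega⟩
        rw [hk]
        exact om2 (by norm_num) (by omega)
      · have key : ∀ e a, 2 ≤ a → 0 < e → Odd a → f = e * a → 3 ≤ Om (p ^ f + 1) := by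
          intro e a ha he hoa hfe
          have h3 : p ≤ p ^ e := Nat.le_self_pow he.ne' p
          have h4 : Odd (p ^ e) := hp.pow
          refine chain (a := 2) (b := p ^ e + 1) le_rfl ?_ (by omega) ?_ ?_
          · exact (h4.add_odd odd_one).two_dvd
          · rw [hfe]; exact odd_dvd p e a hoa
          · rw [hfe]
            have : p ^ e < p ^ (e * a) := Nat.pow_lt_pow_right (by omega) (by nlinarith)
            omega
        intro a b e ha hb he hab hfe
        rcases odd_or hab with ho | ho
        · exact key (e * b) a ha (by positivity) ho (by rw [hfe]; ring)
        · exact key (e * a) b hb (by positivity) ho (by rw [hfe])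
    omega
  · have h1 : J.card ≤ 1 := by
      apply card1 h'
      obtain ⟨k, hk⟩ : ∃ k, p ^ f + 1 = 2 * 2 * k := ⟨(p ^ f + 1) / 4, by omega⟩
      rw [hk]
      exact om3 (by norm_num) (by norm_num) (by omega)
    have h2 : I.card ≤ 2 := by
      refine hle (p ^ f - 1) I hI h ?_ ?_
      · obtain ⟨k, hk⟩ : ∃ k, p ^ f - 1 = 2 * k := ⟨(p ^ f - 1) / 2, by omega⟩
        rw [hk]
        exact om2 (by norm_num) (by omega)
      · intro a b e ha hb he hab hfe
        have h3 : p ^ 2 ≤ p ^ (e * a) := Nat.pow_le_pow_right (by omega) (by nlinarith)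
        have h4 : Odd (p ^ (e * a)) := hp.pow
        have h5 : 9 ≤ p ^ 2 := by nlinarith
        have h6 : p ^ (e * a) < p ^ (e * a * b) := Nat.pow_lt_pow_right (by omega) (by
          have : 0 < e * a := by positivity
          nlinarith)
        refine chain (a := 2) (b := p ^ (e * a) - 1) le_rfl ?_ (by omega) ?_ ?_
        · obtain ⟨k, hk⟩ := h4
          exact ⟨k, by omega⟩
        · rw [hfe]; exact sub_dvd p _ _
        · rw [hfe]; omega
    omega

theorem even_case {f : ℕ} (hf : 3 ≤ f) {I J : Finset ℕ} (hI : ∀ i ∈ I, i ∣ f)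
    (hJ : ∀ i ∈ J, i ∣ f)
    (h : ∀ i ∈ I, ∀ j ∈ I, i ≠ j → Om (2 ^ f - 1) + Om (Nat.gcd i j) ≤ 2)
    (h' : ∀ i ∈ J, ∀ j ∈ J, i ≠ j → Om (2 ^ f + 1) + Om (Nat.gcd i j) ≤ 2)
    (hs : f = 4 → 4 ∈ J → 1 ∈ I → False) :
    I.card + J.card ≤ 4 := by
  have hf0 : 0 < f := by omega
  have h8 : 2 ^ 3 ≤ 2 ^ f := Nat.pow_le_pow_right (by norm_num) hf
  have hm0 : 1 ≤ Om (2 ^ f - 1) := Om_pos (by omega)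
  have hp0 : 1 ≤ Om (2 ^ f + 1) := Om_pos (by omega)
  -- two odd factors
  have hodd : ∀ a b e, 2 ≤ a → 2 ≤ b → 0 < e → Odd a → Odd b → f = e * a * b → 3 ≤ Om (2 ^ f + 1) := by
    intro a b e ha hb he oa ob hfe
    have h1 : 0 < 2 ^ e := by positivity
    have h2 : 2 ^ e < 2 ^ (e * a) := Nat.pow_lt_pow_right (by omega) (by nlinarith)
    have h3 : 2 ^ (e * a) < 2 ^ (e * a * b) := Nat.pow_lt_pow_right (by omega) (by
      have : 0 < e * a := by positivity
      nlinarith)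
    rw [hfe]
    exact chain (a := 2 ^ e + 1) (b := 2 ^ (e * a) + 1) (by omega) (odd_dvd _ _ _ oa) (by omega)
      (odd_dvd _ _ _ ob) (by omega)
  have hferm : Om (2 ^ f + 1) = 1 → ∃ k, f = 2 ^ k := by
    intro h1
    exact Nat.pow_of_pow_add_prime (a := 2) (by norm_num) (by omega) (Om_one_prime h1)
  have hpr : f.Prime → I.card + J.card ≤ 4 := by
    intro hpf
    have : ∀ I : Finset ℕ, (∀ i ∈ I, i ∣ f) → I.card ≤ 2 := by
      intro I hI
      have : I ⊆ {1, f} := by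
        intro i hi
        rcases (Nat.dvd_prime hpf).1 (hI i hi) with h | h <;> simp [h]
      exact (Finset.card_le_card this).trans Finset.card_le_two
    have h1 := this I hI
    have h2 := this J hJ
    omega
  by_cases h3 : 3 ≤ Om (2 ^ f - 1)
  · have h1 : I.card ≤ 1 := card1 h h3
    suffices J.card ≤ 3 by omega
    rcases Nat.lt_or_ge 2 (Om (2 ^ f + 1)) with h4 | h4
    · have := card1 h' h4
      omega
    rcases (show Om (2 ^ f + 1) = 1 ∨ Om (2 ^ f + 1) = 2 by omega) with h5 | h5
    · obtain ⟨k, hk⟩ := hferm h5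
      exact cardF hJ hf0 h' h5 hk
    · by_contra hc
      obtain ⟨a, b, e, ha, hb, he, oa, ob, hfe⟩ := card4 hJ hf0 h' h5 (by omega)
      have := hodd a b e ha hb he oa ob hfe
      omega
  rcases (show Om (2 ^ f - 1) = 1 ∨ Om (2 ^ f - 1) = 2 by omega) with h5 | h5
  · exact hpr (Nat.prime_of_pow_sub_one_prime (by omega) (Om_one_prime h5)).2
  have hI2 : I.card ≤ 2 := by
    by_contra hc
    obtain ⟨a, b, e, ha, hb, he, hab, hfe⟩ := card3 hI hf0 h h5 (by omega)
    have h6 : Nat.Coprime (2 ^ a - 1) (2 ^ b - 1) := by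
      unfold Nat.Coprime
      rw [Nat.pow_sub_one_gcd_pow_sub_one, hab]; rfl
    have h7 : 2 ^ a - 1 ∣ 2 ^ f - 1 := by
      rw [show f = a * (e * b) by rw [hfe]; ring]; exact sub_dvd _ _ _
    have h8 : 2 ^ b - 1 ∣ 2 ^ f - 1 := by
      rw [show f = b * (e * a) by rw [hfe]; ring]; exact sub_dvd _ _ _
    have h9 := h6.mul_dvd_of_dvd_of_dvd h7 h8
    have h10 : 2 ^ 2 ≤ 2 ^ a := Nat.pow_le_pow_right (by norm_num) ha
    have h11 : 2 ^ 2 ≤ 2 ^ b := Nat.pow_le_pow_right (by norm_num) hb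
    have h12 : a + b ≤ f := by rw [hfe]; nlinarith [Nat.mul_le_mul he (le_refl (a * b))]
    have h13 : 2 ^ (a + b) ≤ 2 ^ f := Nat.pow_le_pow_right (by norm_num) h12
    rw [pow_add] at h13
    have h14 : 3 ≤ Om (2 ^ f - 1) := by
      refine chain (a := 2 ^ a - 1) (b := (2 ^ a - 1) * (2 ^ b - 1)) (by omega) (dvd_mul_right _ _)
        ?_ h9 ?_
      · have : 2 ≤ 2 ^ b - 1 := by omega
        have : 0 < 2 ^ a - 1 := by omega
        nlinarith
      · obtain ⟨x, hx⟩ : ∃ x, 2 ^ a = x + 1 := ⟨2 ^ a - 1, by omega⟩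
        obtain ⟨y, hy⟩ : ∃ y, 2 ^ b = y + 1 := ⟨2 ^ b - 1, by omega⟩
        rw [hx, hy] at h13 ⊢
        simp only [Nat.add_sub_cancel]
        have : (x + 1) * (y + 1) = x * y + x + y + 1 := by ring
        omega
    omega
  by_cases hJ2 : J.card ≤ 2
  · omega
  rcases Nat.lt_or_ge 2 (Om (2 ^ f + 1)) with h4 | h4
  · have := card1 h' h4
    omega
  rcases (show Om (2 ^ f + 1) = 1 ∨ Om (2 ^ f + 1) = 2 by omega) with h6 | h6
  · obtain ⟨k, hk⟩ := hferm h6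
    have hk2 : k = 2 := by
      rcases Nat.lt_or_ge k 3 with h7 | h7
      · interval_cases k <;> omega
      · exfalso
        obtain ⟨j, rfl⟩ : ∃ j, k = 3 + j := ⟨k - 3, by omega⟩
        have h8 : 2 ^ 8 - 1 ∣ 2 ^ f - 1 := by
          rw [hk, pow_add]; exact sub_dvd _ _ _
        obtain ⟨c, hc⟩ := h8
        have : c ≠ 0 := by rintro rfl; omega
        rw [hc, Om_mul (by norm_num) this] at h5
        have : 3 ≤ Om (2 ^ 8 - 1) := by
          rw [show 2 ^ 8 - 1 = 3 * 5 * 17 by norm_num]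
          exact om3 (by norm_num) (by norm_num) (by norm_num)
        omega
    have hf4 : f = 4 := by rw [hk, hk2]; rfl
    subst hf4
    have hdv : ∀ i, i ∣ 4 → i = 1 ∨ i = 2 ∨ i = 4 := by
      intro i hi
      have := Nat.le_of_dvd (by norm_num) hi
      interval_cases i <;> omega
    by_cases h4J : 4 ∈ J
    · have h1I : 1 ∉ I := fun h => hs rfl h4J h
      have hJ3 : J.card ≤ 3 := cardF hJ hf0 h' h6 hk
      have hI1 : I.card ≤ 1 := by
        rw [Finset.card_le_one]
        intro a ha b hb
        by_contra hab
        have h8 := cop hI hf0 h h5 a ha b hb hab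
        have ha1 : a ≠ 1 := by rintro rfl; exact h1I ha
        have hb1 : b ≠ 1 := by rintro rfl; exact h1I hb
        rcases hdv a (hI a ha) with rfl | rfl | rfl <;> rcases hdv b (hI b hb) with rfl | rfl | rfl <;>
          first | omega | (revert h8; decide)
      omega
    · exfalso
      have : J ⊆ {1, 2} := by
        intro i hi
        rcases hdv i (hJ i hi) with rfl | rfl | rfl
        · simp
        · simp
        · exact absurd hi h4J
      exact hJ2 ((Finset.card_le_card this).trans Finset.card_le_two)
  · exfalso
    obtain ⟨a, b, e, ha, hb, he, hab, hfe⟩ := card3 hJ hf0 h' h6 (by omega)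
    have key : ∀ a g, 2 ≤ a → Odd a → 0 < g → f = 2 * (g * a) → 3 ≤ Om (2 ^ f - 1) := by
      intro a g ha oa hg hfe
      have h7 : 2 ^ f - 1 = (2 ^ (g * a) - 1) * (2 ^ (g * a) + 1) := by
        rw [hfe, mul_comm 2, pow_mul]
        have := Nat.sq_sub_sq (2 ^ (g * a)) 1
        rw [one_pow] at this
        rw [this]; ring
      obtain ⟨x, hx⟩ := odd_dvd 2 g a oa
      have h8 : 2 ^ g < 2 ^ (g * a) := Nat.pow_lt_pow_right (by omega) (by nlinarith)
      have h9 : 0 < 2 ^ g := by positivity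
      have h10 : 2 ^ 2 ≤ 2 ^ (g * a) := Nat.pow_le_pow_right (by norm_num) (by nlinarith)
      rw [h7, hx, ← mul_assoc]
      refine om3 (by omega) (by omega) ?_
      by_contra hc
      have : x ≤ 1 := by omega
      nlinarith
    have key2 : ∀ a b, 2 ≤ a → 2 ≤ b → Odd a → f = e * a * b → 3 ≤ Om (2 ^ f - 1) ∨ 3 ≤ Om (2 ^ f + 1) := by
      intro a b ha hb oa hfe
      rcases Nat.even_or_odd b with eb | ob
      · left
        obtain ⟨c, hc⟩ := eb
        exact key a (e * c) ha oa (Nat.mul_pos he (by omega)) (by rw [hfe, hc]; ring)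
      · right
        exact hodd a b e ha hb he oa ob hfe
    rcases odd_or hab with ho | ho
    · have := key2 a b ha hb ho hfe
      omega
    · have := key2 b a hb ha ho (by rw [hfe]; ring)
      omega

end Arith


set_option linter.unusedSectionVars false

namespace Special

theorem isIntegral_trace {V : Type} [AddCommGroup V] [Module ℂ V] [FiniteDimensional ℂ V]
    (f : V →ₗ[ℂ] V) {n : ℕ} (hn : 0 < n) (h : f ^ n = 1) : IsIntegral ℤ (LinearMap.trace ℂ V f) := by
  rw [Module.End.trace_eq_sum_roots_charpoly_of_splits (IsAlgClosed.splits _)]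
  apply IsIntegral.multiset_sum
  intro x hx
  have h1 : Module.End.HasEigenvalue f x := by
    rw [Module.End.hasEigenvalue_iff_isRoot_charpoly]
    exact Polynomial.isRoot_of_mem_roots hx
  obtain ⟨v, hv⟩ := h1.exists_hasEigenvector
  have h2 : (f ^ n) v = x ^ n • v := hv.pow_apply n
  rw [h] at h2
  have h3 : x ^ n = 1 := by
    have h4 : (x ^ n - 1) • v = 0 := by rw [sub_smul, ← h2]; simp
    rcases smul_eq_zero.1 h4 with h5 | h5
    · exact sub_eq_zero.1 h5
    · exact absurd h5 hv.2
  exact IsIntegral.of_pow hn (by rw [h3]; exact isIntegral_one)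

theorem not_integral_half {z : ℂ} (hz : IsIntegral ℤ z) (h : 2 * z = 1) : False := by
  have h1 : z = algebraMap ℚ ℂ (1 / 2) := by
    rw [map_div₀, map_one, map_ofNat]
    linear_combination h / 2
  rw [h1, isIntegral_algebraMap_iff (algebraMap ℚ ℂ).injective] at hz
  obtain ⟨y, hy⟩ := IsIntegrallyClosed.isIntegral_iff.1 hz
  have h2 : (2 * y : ℚ) = 1 := by
    have : (y : ℚ) = 1 / 2 := hy
    rw [this]; norm_num
  have h3 : 2 * y = 1 := by exact_mod_cast h2
  omega

/-- parity of a sum with a fixed point free involution -/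
theorem invol {α : Type} [DecidableEq α] (s : Finset α) (f : α → ℂ) (hf : ∀ a, IsIntegral ℤ (f a))
    (g : α → α) (h1 : ∀ a ∈ s, f (g a) = f a) (h2 : ∀ a ∈ s, g a ≠ a) (h3 : ∀ a ∈ s, g a ∈ s)
    (h4 : ∀ a ∈ s, g (g a) = a) (h : ∑ a ∈ s, f a = 1) : False := by
  let O := integralClosure ℤ ℂ
  let F : α → O := fun a => ⟨f a, hf a⟩
  let q := Ideal.Quotient.mk (Ideal.span {(2 : O)})
  have hs : ∑ a ∈ s, q (F a) = 0 := by
    refine Finset.sum_involution (fun a _ => g a) ?_ (fun a ha _ => h2 a ha) h3 h4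
    intro a ha
    have : F (g a) = F a := Subtype.ext (h1 a ha)
    rw [this, ← map_add, Ideal.Quotient.eq_zero_iff_mem, Ideal.mem_span_singleton]
    exact ⟨F a, by ring⟩
  rw [← map_sum, Ideal.Quotient.eq_zero_iff_mem, Ideal.mem_span_singleton] at hs
  obtain ⟨z, hz⟩ := hs
  have h5 := congrArg (fun x : O => (x : ℂ)) hz
  simp only [F] at h5
  push_cast at h5
  rw [h] at h5
  exact not_integral_half z.2 h5.symm

end Special

namespace Ax

variable {F N : Type} [Field F] [Fintype F] [DecidableEq F] [Group N] [Finite N] {Δ : Subgroup Fˣ}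
  (A : Ax F N Δ)
variable {V : Type} [AddCommGroup V] [Module ℂ V] [FiniteDimensional ℂ V] {ψ : AddChar F ℂ} (hψ : ψ.IsPrimitive)
  (ρ : N →* (V →ₗ[ℂ] V))


theorem chi_comm (a b : N) : LinearMap.trace ℂ V (ρ (a * b)) = LinearMap.trace ℂ V (ρ (b * a)) := by
  rw [map_mul ρ, map_mul ρ, LinearMap.trace_mul_comm]

include hψ in
theorem chi_t (h0 : A.e ψ ρ 0 = 0) {a : Fˣ} (ha : a ∈ Δ) (h1 : a ≠ 1) :
    LinearMap.trace ℂ V (ρ (A.t a)) = 0 := by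
  have h2 : ρ (A.t a) = ∑ s, ρ (A.t a) * A.e ψ ρ s * A.e ψ ρ s := by
    conv_lhs => rw [← mul_one (ρ (A.t a)), ← A.sum_e ρ hψ, Finset.mul_sum]
    refine Finset.sum_congr rfl fun s _ => ?_
    rw [mul_assoc, A.e_idem ρ hψ]
  rw [h2, map_sum]
  refine Finset.sum_eq_zero fun s _ => ?_
  by_cases hs : s = 0
  · rw [hs, h0]; simp
  · rw [LinearMap.trace_mul_comm, ← mul_assoc, A.ete hψ ρ ha hs h1]; simp

theorem sum_u (h0 : A.e ψ ρ 0 = 0) : ∑ x, ρ (A.u x) = 0 := by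
  unfold e at h0
  rcases smul_eq_zero.1 h0 with h | h
  · exact absurd h (inv_ne_zero (A.hq0))
  · simpa using h

theorem special (hΔ : Δ = ⊤) [CharP F 2] (hq : Fintype.card F = 16) (hψ : ψ.IsPrimitive) (h0 : A.e ψ ρ 0 = 0)
    (hd : Module.finrank ℂ V = 15)
    (hinv : ∀ y, LinearMap.trace ℂ V (ρ (A.w * A.u (y ^ 2))) = LinearMap.trace ℂ V (ρ (A.w * A.u y))) : False := by
  subst hΔ
  have ht : ∀ a : Fˣ, a ∈ (⊤ : Subgroup Fˣ) := fun a => Subgroup.mem_top a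
  have hu1 : LinearMap.trace ℂ V (ρ (A.u 1)) = -1 := by
    have h1 := congrArg (LinearMap.trace ℂ V) (A.sum_u ρ h0)
    rw [map_sum, sum_eq_zero_add_units, A.u_zero, map_zero] at h1
    have h2 : ∀ x : Fˣ, LinearMap.trace ℂ V (ρ (A.u x)) = LinearMap.trace ℂ V (ρ (A.u 1)) := by
      intro x
      have h3 : A.u x = A.t x * A.u 1 * (A.t x)⁻¹ := by
        rw [A.tu x (ht x)]; simp
      rw [h3, chi_comm ρ]
      congr 2
      group
    simp only [h2] at h1
    rw [map_one, LinearMap.trace_one, hd, Finset.sum_const, Finset.card_univ, Fintype.card_units, hq] at h1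
    simp only [nsmul_eq_mul] at h1
    push_cast at h1
    linear_combination h1 / 15
  have hw : LinearMap.trace ℂ V (ρ A.w) = -1 := by
    have h1 := A.wuw 1
    have h2 : (-1 : F) = 1 := CharTwo.neg_eq 1
    simp only [inv_one, one_pow, Units.val_one, h2, A.t_one, mul_one] at h1
    have h3 : LinearMap.trace ℂ V (ρ (A.w * A.u 1 * A.w)) = -1 := by
      rw [chi_comm ρ, ← mul_assoc, A.ww, one_mul, hu1]
    rw [h1, chi_comm ρ, ← mul_assoc, ← A.u_add, CharTwo.add_self_eq_zero, A.u_zero, one_mul] at h3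
    exact h3
  obtain ⟨ω, hω⟩ : ∃ ω : Fˣ, (ω : F) ^ 2 + ω + 1 = 0 := by
    have : Fact (Nat.Prime 3) := ⟨by norm_num⟩
    obtain ⟨ω, h1⟩ := exists_prime_orderOf_dvd_card (G := Fˣ) 3 (by rw [Fintype.card_units, hq]; norm_num)
    refine ⟨ω, ?_⟩
    have h2 : (ω : F) ^ 3 = 1 := by
      have := pow_orderOf_eq_one ω
      rw [h1] at this
      simpa using congrArg Units.val this
    have h3 : (ω : F) - 1 ≠ 0 := by
      intro h
      have h4 : ω = 1 := Units.ext (sub_eq_zero.1 h)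
      rw [h4] at h1; simp at h1
    have h4 : ((ω : F) - 1) * ((ω : F) ^ 2 + ω + 1) = 0 := by linear_combination h2
    exact (mul_eq_zero.1 h4).resolve_left h3
  have h2F : (2 : F) = 0 := CharTwo.two_eq_zero
  have hw1 : LinearMap.trace ℂ V (ρ (A.w * A.u 1)) = 0 := by
    have ha1 : (ω⁻¹) ^ 2 ≠ 1 := by
      intro h
      have h1 : (ω : F) ^ 2 = 1 := by
        rw [inv_pow, inv_eq_one] at h
        simpa using congrArg Units.val h
      have h3 : (ω : F) = 0 := by linear_combination hω - h1 - h2F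
      exact ω.ne_zero h3
    have h1 := A.chi_t hψ ρ h0 (ht ((ω⁻¹) ^ 2)) ha1
    have hne : 1 - (((ω⁻¹) ^ 2 : Fˣ) : F) ≠ 0 := by
      intro h
      exact ha1 (Units.ext (by rw [Units.val_one]; linear_combination -h))
    set a : Fˣ := (ω⁻¹) ^ 2 with ha
    set y : F := ω / (1 - a) with hy
    -- conjugation
    have h3 : LinearMap.trace ℂ V (ρ (A.w * A.u y * A.t a * (A.u (-y) * A.w))) = 0 := by
      rw [chi_comm ρ, ← h1]
      congr 2
      have : A.u (-y) * A.u y = 1 := by rw [← A.u_add]; simp [A.u_zero]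
      calc A.u (-y) * A.w * (A.w * A.u y * A.t a) = A.u (-y) * (A.w * A.w) * A.u y * A.t a := by group
        _ = A.t a := by rw [A.ww, mul_one, this, one_mul]
    have h4 : A.w * A.u y * A.t a * (A.u (-y) * A.w) = A.w * A.u ω * A.w * A.t a⁻¹ := by
      have e1 : A.t a * A.u (-y) = A.u (a * (-y)) * A.t a := A.tu a (ht a) _
      have e2 : A.t a * A.w = A.w * A.t a⁻¹ := by rw [A.wt _ (ht _), inv_inv]
      have e3 : A.u y * A.u (a * -y) = A.u ω := by
        rw [← A.u_add]
        congr 1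
        rw [hy]; field_simp
        ring
      calc A.w * A.u y * A.t a * (A.u (-y) * A.w) = A.w * A.u y * (A.t a * A.u (-y)) * A.w := by group
        _ = A.w * (A.u y * A.u (a * -y)) * (A.t a * A.w) := by rw [e1]; group
        _ = _ := by rw [e3, e2]; group
    rw [h4, A.wuw, chi_comm ρ] at h3
    set z : F := -((ω⁻¹ : Fˣ) : F) with hz
    have h5 : A.t a⁻¹ * (A.u z * A.t (ω⁻¹ ^ 2) * A.w * A.u z) = A.u ((a⁻¹ : Fˣ) * z) * (A.w * A.u z) := by
      have e1 : A.t a⁻¹ * A.u z = A.u ((a⁻¹ : Fˣ) * z) * A.t a⁻¹ := A.tu _ (ht _) _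
      have e2 : A.t a⁻¹ * A.t (ω⁻¹ ^ 2) = 1 := by
        rw [← A.t_mul _ (ht _) _ (ht _), ha]; simp [A.t_one]
      calc _ = (A.t a⁻¹ * A.u z) * A.t (ω⁻¹ ^ 2) * A.w * A.u z := by group
        _ = A.u ((a⁻¹ : Fˣ) * z) * (A.t a⁻¹ * A.t (ω⁻¹ ^ 2)) * A.w * A.u z := by rw [e1]; group
        _ = _ := by rw [e2]; group
    rw [h5, chi_comm ρ, mul_assoc, ← A.u_add] at h3
    convert h3 using 5
    rw [hz, ha]
    push_cast
    field_simp
    linear_combination hω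
  have hsum : ∑ y, LinearMap.trace ℂ V (ρ (A.w * A.u y)) = 0 := by
    have h1 := congrArg (fun f => LinearMap.trace ℂ V (ρ A.w * f)) (A.sum_u ρ h0)
    simp only [mul_zero, map_zero] at h1
    rw [Finset.mul_sum, map_sum] at h1
    simpa only [map_mul] using h1
  have h16 : ∀ y : F, y ^ 16 = y := fun y => by rw [← hq]; exact FiniteField.pow_card y
  have hsum2 : ∑ y ∈ (Finset.univ.erase (0 : F)).erase 1, LinearMap.trace ℂ V (ρ (A.w * A.u y)) = 1 := by
    rw [← Finset.add_sum_erase _ _ (Finset.mem_univ (0 : F)),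
      ← Finset.add_sum_erase _ _ (show (1 : F) ∈ Finset.univ.erase 0 by simp), hw1, A.u_zero, mul_one,
      hw] at hsum
    linear_combination hsum
  have hsq1 : ∀ y : F, y ^ 2 = 1 → y = 1 := by
    intro y hy
    have : (y - 1) ^ 2 = 0 := by linear_combination hy + (1 - y) * h2F
    have := pow_eq_zero_iff (two_ne_zero) |>.1 this
    linear_combination this
  refine Special.invol _ _ ?_ (fun y => if y ^ 4 = y then y ^ 2 else y ^ 4) ?_ ?_ ?_ ?_ hsum2
  · intro y
    refine Special.isIntegral_trace _ (Nat.card_pos (α := N)) ?_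
    rw [← map_pow, pow_card_eq_one', map_one]
  · intro y hy
    split_ifs with h
    · exact hinv y
    · rw [show y ^ 4 = (y ^ 2) ^ 2 by ring, hinv, hinv]
  · intro y hy
    simp only [Finset.mem_erase, Finset.mem_univ, and_true] at hy
    split_ifs with h
    · intro h1
      have : y * (y - 1) = 0 := by linear_combination h1
      rcases mul_eq_zero.1 this with h2 | h2
      · exact hy.2 h2
      · exact hy.1 (sub_eq_zero.1 h2)
    · exact h
  · intro y hy
    simp only [Finset.mem_erase, Finset.mem_univ, and_true] at hy ⊢
    split_ifs with h
    · exact ⟨fun h1 => hy.1 (hsq1 y h1), pow_ne_zero _ hy.2⟩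
    · exact ⟨fun h1 => hy.1 (hsq1 y (hsq1 (y ^ 2) (by rw [← h1]; ring))), pow_ne_zero _ hy.2⟩
  · intro y hy
    by_cases h : y ^ 4 = y
    · rw [if_pos h, if_pos (by rw [← pow_mul, mul_comm, pow_mul, h]), ← pow_mul]
      exact h
    · have h1 : (y ^ 4) ^ 4 = y := by rw [← pow_mul]; exact h16 y
      rw [if_neg h, if_neg, h1]
      rw [h1]; exact fun h2 => h h2.symm

end Ax


set_option linter.unusedSectionVars false

/-- the degree `a` lies over an irreducible representation of `N` of dimension `n` -/
def Lies {G : Type} [Group G] (N : Subgroup G) (n a : ℕ) : Prop :=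
  a ∈ charDegrees G ∧ ∃ (V W : Type) (_ : AddCommGroup V) (_ : Module ℂ V) (_ : AddCommGroup W)
    (_ : Module ℂ W) (_ : FiniteDimensional ℂ V) (_ : FiniteDimensional ℂ W)
    (ρ : G →* (V →ₗ[ℂ] V)) (σ : N →* (W →ₗ[ℂ] W)) (f1 : W →ₗ[ℂ] V), Irr ρ ∧ Irr σ ∧
    (∀ n w, f1 (σ n w) = ρ n (f1 w)) ∧ f1 ≠ 0 ∧ Module.finrank ℂ V = a ∧ Module.finrank ℂ W = n

theorem exists_Lies {G : Type} [Group G] (N : Subgroup G) {a : ℕ} (ha : a ∈ charDegrees G) :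
    ∃ n, Lies N n a := by
  obtain ⟨V, hV, hd⟩ := id ha
  have h1 := irr_of_simple V hV
  let ρ : G →* (V →ₗ[ℂ] V) := V.ρ
  obtain ⟨p, hp, h2⟩ := irr_sub_exists (ρ.comp N.subtype) h1.1
  refine ⟨_, ha, V, p, inferInstance, inferInstance, inferInstance, inferInstance, inferInstance,
    inferInstance, ρ, subRep (ρ.comp N.subtype) p hp, p.subtype, h1, h2, fun n w => rfl, ?_, hd, rfl⟩
  intro h
  obtain ⟨v, hv⟩ := h2.1
  apply hv
  apply Subtype.ext
  exact congrArg (fun f : p →ₗ[ℂ] V => f v) h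

section
variable {F : Type} [Field F] [Fintype F] {G : Type} [Group G] [Finite G] {N : Subgroup G} [N.Normal]
  {Δ : Subgroup Fˣ} (A : Ax F N Δ)

include A in
theorem Lies.dims {n a : ℕ} (h : Lies N n a) : n = Fintype.card F + 1 ∨ n = Fintype.card F - 1 ∨
    n = 1 ∨ n = Fintype.card F ∨ (Δ ≠ ⊤ ∧ -1 ∈ Δ ∧ 2 * n = Fintype.card F + 1) ∨
    (Δ ≠ ⊤ ∧ -1 ∉ Δ ∧ 2 * n = Fintype.card F - 1) := by
  classical
  obtain ⟨-, V, W, _, _, _, _, _, _, ρ, σ, f1, hρ, hσ, -, -, -, rfl⟩ := h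
  have : Fintype N := Fintype.ofFinite N
  exact A.dims σ hσ

theorem Lies.dvd {g : G} {d : ℕ} (hd : 0 < d) (hgd : g ^ d ∈ N)
    (hgen : ∀ x : G, ∃ k : ℕ, ∃ n ∈ N, x = g ^ k * n) {n a : ℕ} (h : Lies N n a) :
    ∃ i, 0 < i ∧ i ∣ d ∧ a = n * i := by
  obtain ⟨-, V, W, _, _, _, _, _, _, ρ, σ, f1, hρ, hσ, hf, hf0, rfl, rfl⟩ := h
  obtain ⟨i, h0, h1, h2, -⟩ := clifford g d hd hgd hgen ρ hρ σ hσ f1 hf hf0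
  exact ⟨i, h0, h1, by rw [h2, mul_comm]⟩

include A in
theorem Lies.eq {g : G} {d : ℕ} (hd : 0 < d) (hgd : g ^ d ∈ N)
    (hgen : ∀ x : G, ∃ k : ℕ, ∃ n ∈ N, x = g ^ k * n) (h7 : 7 ≤ Fintype.card F) {n a b : ℕ}
    (hn : n = 1 ∨ n = Fintype.card F ∨ 2 * n = Fintype.card F + 1 ∨ 2 * n = Fintype.card F - 1)
    (h : Lies N n a) (h' : Lies N n b) : a = b := by
  classical
  have : Fintype N := Fintype.ofFinite N
  obtain ⟨-, V, W, _, _, _, _, _, _, ρ, σ, f1, hρ, hσ, hf, hf0, rfl, h1⟩ := h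
  obtain ⟨-, V', W', _, _, _, _, _, _, ρ', σ', f1', hρ', hσ', hf', hf0', rfl, h2⟩ := h'
  exact clifford_two g d hd hgd hgen n h1 h2 (A.two h7 n hn) ρ hρ σ hσ f1 hf hf0 ρ' hρ' σ' hσ' f1' hf' hf0'

theorem Lies.special (hΔ : Δ = ⊤) [CharP F 2] (hq : Fintype.card F = 16) {g : G}
    (hg : ∀ x, g * (A.u x : G) * g⁻¹ = A.u (x ^ 2)) (hw : g * (A.w : G) * g⁻¹ = A.w)
    (h : Lies N 15 15) : False := by
  classical
  have : Fintype N := Fintype.ofFinite N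
  obtain ⟨-, V, W, _, _, _, _, _, _, ρ, σ, f1, hρ, hσ, hf, hf0, hV, hW⟩ := h
  have hψ := AddChar.FiniteField.primitiveChar_to_Complex_isPrimitive F
  set ψ := AddChar.FiniteField.primitiveChar_to_Complex F
  have h0 : A.e ψ σ 0 = 0 := by
    by_contra h0
    obtain ⟨γ, hγ, hgen⟩ := exists_gen Δ
    rcases A.principal hψ σ hσ hγ hgen (A.fix_of_e0 hψ σ h0) with
      h | ⟨l, c, hi, hl, ⟨hc, h⟩ | ⟨hc, h⟩ | ⟨h, hc, hl1, h1, h2⟩⟩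
    · omega
    · omega
    · omega
    · exact h2 hΔ
  have hinj : Function.Injective f1 := schur_inj (σ := ρ.comp N.subtype) hσ f1 hf hf0
  have hsurj : Function.Surjective f1 :=
    (LinearMap.injective_iff_surjective_of_finrank_eq_finrank (by rw [hV, hW])).1 hinj
  refine A.special (ρ.comp N.subtype) hΔ hq hψ ?_ hV ?_
  · ext v
    obtain ⟨w, rfl⟩ := hsurj v
    have h1 : A.e ψ σ 0 w = 0 := by rw [h0]; rfl
    rw [A.e_apply] at h1 ⊢
    have h2 := congrArg f1 h1
    rw [map_smul, map_sum, map_zero] at h2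
    simp only [map_smul, hf] at h2
    exact h2
  · intro y
    change LinearMap.trace ℂ V (ρ ((A.w : G) * (A.u (y ^ 2) : G))) =
      LinearMap.trace ℂ V (ρ ((A.w : G) * (A.u y : G)))
    rw [← hg, ← hw, show g * (A.w : G) * g⁻¹ * (g * (A.u y : G) * g⁻¹) =
      g * ((A.w : G) * (A.u y : G) * g⁻¹) by group, Ax.chi_comm ρ]
    rw [hw]
    congr 2
    group

end

theorem subs {D : Set ℕ} (h : ∀ a ∈ D, ∀ b ∈ D, a = b) : D.Finite ∧ D.ncard ≤ 1 := by
  have h1 : D.Subsingleton := fun a ha b hb => h a ha b hb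
  exact ⟨h1.finite, (Set.ncard_le_one h1.finite).2 h⟩

/-- `Ω` bound -/
theorem hyp_mul {G : Type} [Group G] (hG : TwoPrimeHypothesis G) {m i j : ℕ} (hm : 0 < m) (hi : 0 < i)
    (h1 : m * i ∈ charDegrees G) (h2 : m * j ∈ charDegrees G) (hij : i ≠ j) :
    Arith.Om m + Arith.Om (Nat.gcd i j) ≤ 2 := by
  have := hG _ h1 _ h2 (fun h => hij (Nat.eq_of_mul_eq_mul_left hm h))
  rw [Nat.gcd_mul_left] at this
  rw [← Arith.Om_mul hm.ne' (Nat.gcd_pos_of_pos_left _ hi).ne']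
  exact this

theorem main_count {F : Type} [Field F] [Fintype F] {G : Type} [Group G] [Finite G] {N : Subgroup G}
    [N.Normal] {Δ : Subgroup Fˣ} (A : Ax F N Δ) (hG : TwoPrimeHypothesis G) {p f d0 d : ℕ} (hp : p.Prime)
    (hq : Fintype.card F = p ^ f) (h7 : 7 ≤ Fintype.card F) (hd : 0 < d) (hdf : d0 * d = f)
    {g : G} (hgd : g ^ d ∈ N) (hgen : ∀ x : G, ∃ k : ℕ, ∃ n ∈ N, x = g ^ k * n)
    (h2 : p = 2 → Δ = ⊤) (hs : p = 2 → d = 4 → f = 4 → Lies N 15 15 → False) :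
    (charDegrees G).ncard ≤ 6 := by
  classical
  set q := Fintype.card F with hqd
  have hf0 : 0 < f := by
    rcases Nat.eq_zero_or_pos f with h | h
    · subst h; simp at hq; omega
    · exact h
  have hdvd : d ∣ f := ⟨d0, by rw [← hdf, mul_comm]⟩
  let I := d.divisors.filter fun i => Lies N (q - 1) ((q - 1) * i)
  let J := d.divisors.filter fun i => Lies N (q + 1) ((q + 1) * i)
  have hI : ∀ i ∈ I, i ∣ f := fun i hi =>
    (Nat.dvd_of_mem_divisors (Finset.mem_filter.1 hi).1).trans hdvd
  have hJ : ∀ i ∈ J, i ∣ f := fun i hi =>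
    (Nat.dvd_of_mem_divisors (Finset.mem_filter.1 hi).1).trans hdvd
  have hII : ∀ i ∈ I, ∀ j ∈ I, i ≠ j → Arith.Om (p ^ f - 1) + Arith.Om (Nat.gcd i j) ≤ 2 := by
    intro i hi j hj hij
    rw [← hq]
    exact hyp_mul hG (by omega) (Nat.pos_of_dvd_of_pos (hI i hi) hf0) (Finset.mem_filter.1 hi).2.1
      (Finset.mem_filter.1 hj).2.1 hij
  have hJJ : ∀ i ∈ J, ∀ j ∈ J, i ≠ j → Arith.Om (p ^ f + 1) + Arith.Om (Nat.gcd i j) ≤ 2 := by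
    intro i hi j hj hij
    rw [← hq]
    exact hyp_mul hG (by omega) (Nat.pos_of_dvd_of_pos (hJ i hi) hf0) (Finset.mem_filter.1 hi).2.1
      (Finset.mem_filter.1 hj).2.1 hij
  let hh : ℕ := if -1 ∈ Δ then (q + 1) / 2 else (q - 1) / 2
  let C : Set ℕ := {a | Δ ≠ ⊤ ∧ (2 * hh = q + 1 ∨ 2 * hh = q - 1) ∧ Lies N hh a}
  have hsub : charDegrees G ⊆ ({a | Lies N 1 a} ∪ {a | Lies N q a}) ∪ C ∪
      ((I.image fun i => (q - 1) * i : Finset ℕ) ∪ (J.image fun i => (q + 1) * i : Finset ℕ) : Set ℕ) := by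
    intro a ha
    obtain ⟨n, hn⟩ := exists_Lies N ha
    obtain ⟨i, hi0, hid, hai⟩ := hn.dvd hd hgd hgen
    have him : i ∈ d.divisors := Nat.mem_divisors.2 ⟨hid, hd.ne'⟩
    rcases hn.dims A with h | h | h | h | ⟨h1, h2, h3⟩ | ⟨h1, h2, h3⟩
    · right; right
      rw [h] at hai hn
      rw [hai] at hn
      rw [Finset.mem_coe, Finset.mem_image]
      exact ⟨i, Finset.mem_filter.2 ⟨him, hn⟩, hai.symm⟩
    · right; left
      rw [h] at hai hn
      rw [hai] at hn
      rw [Finset.mem_coe, Finset.mem_image]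
      exact ⟨i, Finset.mem_filter.2 ⟨him, hn⟩, hai.symm⟩
    · left; left; left
      rw [h] at hn; exact hn
    · left; left; right
      rw [h] at hn; exact hn
    · left; right
      have : n = hh := by simp only [hh, if_pos h2]; omega
      refine ⟨h1, ?_, ?_⟩
      · rw [← this]; omega
      · rw [← this]; exact hn
    · left; right
      have : n = hh := by simp only [hh, if_neg h2]; omega
      refine ⟨h1, ?_, ?_⟩
      · rw [← this]; omega
      · rw [← this]; exact hn
  obtain ⟨fA, cA⟩ := subs (D := {a | Lies N 1 a}) (fun a ha b hb =>
    Lies.eq A hd hgd hgen h7 (Or.inl rfl) ha hb)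
  obtain ⟨fB, cB⟩ := subs (D := {a | Lies N q a}) (fun a ha b hb =>
    Lies.eq A hd hgd hgen h7 (Or.inr (Or.inl rfl)) ha hb)
  obtain ⟨fC, cC⟩ := subs (D := C) (fun a ha b hb =>
    Lies.eq A hd hgd hgen h7 (Or.inr (Or.inr ha.2.1)) ha.2.2 hb.2.2)
  have hcard := Set.ncard_le_ncard hsub
    (((fA.union fB).union fC).union ((Finset.finite_toSet _).union (Finset.finite_toSet _)))
  have u1 := Set.ncard_union_le (({a | Lies N 1 a} ∪ {a | Lies N q a}) ∪ C)
      ((I.image fun i => (q - 1) * i : Finset ℕ) ∪ (J.image fun i => (q + 1) * i : Finset ℕ) : Set ℕ)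
  have u2 := Set.ncard_union_le ({a | Lies N 1 a} ∪ {a | Lies N q a}) C
  have u3 := Set.ncard_union_le {a | Lies N 1 a} {a | Lies N q a}
  have u4 := Set.ncard_union_le ((I.image fun i => (q - 1) * i : Finset ℕ) : Set ℕ)
    ((J.image fun i => (q + 1) * i : Finset ℕ) : Set ℕ)
  have u5 : ((I.image fun i => (q - 1) * i : Finset ℕ) : Set ℕ).ncard ≤ I.card := by
    rw [Set.ncard_coe_finset]; exact Finset.card_image_le
  have u6 : ((J.image fun i => (q + 1) * i : Finset ℕ) : Set ℕ).ncard ≤ J.card := by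
    rw [Set.ncard_coe_finset]; exact Finset.card_image_le
  rcases hp.eq_two_or_odd' with h2' | hodd
  · have hC0 : C.ncard = 0 := by
      have : C = ∅ := by
        ext a
        constructor
        · intro h; exact h.1 (h2 h2')
        · intro h; exact h.elim
      rw [this]; simp
    subst h2'
    have hf3 : 3 ≤ f := by
      by_contra hc
      have h5 : 2 ^ f ≤ 2 ^ 2 := Nat.pow_le_pow_right (by norm_num) (by omega)
      omega
    have := Arith.even_case hf3 hI hJ hII hJJ (by
      intro hf4 h4J h1I
      have hq16 : q = 16 := by rw [hq, hf4]; norm_num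
      have h4d : 4 ∣ d := Nat.dvd_of_mem_divisors (Finset.mem_filter.1 h4J).1
      have hd4 : d = 4 := Nat.dvd_antisymm (hf4 ▸ hdvd) h4d
      have h6 := (Finset.mem_filter.1 h1I).2
      rw [hq16] at h6
      exact hs rfl hd4 hf4 h6)
    omega
  · have := Arith.odd_case hodd hp.two_le hf0 (by omega) hI hJ hII hJJ
    omega


/-- If `G` is almost simple with socle `S ≅ PSL₂(q)`, `q ≥ 7` a prime power (i.e. `S` is a
normal subgroup isomorphic to `PSL₂(q)` with trivial centralizer in `G`), and `G` satisfies
the two-prime hypothesis, then `|cd(G)| ≤ 6`. -/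
theorem almost_simple_psl2_cd_bound
    (q : ℕ) (hq : 7 ≤ q) (hpp : IsPrimePow q)
    (F : Type) [Field F] [Fintype F] (hF : Fintype.card F = q)
    (G : Type) [Group G] [Finite G]
    (S : Subgroup G) [S.Normal]
    (hiso : Nonempty (S ≃* PSL2 F))
    (hcent : Subgroup.centralizer (S : Set G) = ⊥)
    (hG : TwoPrimeHypothesis G) :
    (charDegrees G).ncard ≤ 6 := by
  classical
  subst hF
  obtain ⟨p, hpc⟩ := CharP.exists F
  obtain ⟨f, hp, hcard⟩ := FiniteField.card F p
  have : Fact p.Prime := ⟨hp⟩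
  obtain ⟨e⟩ := hiso
  let π : Matrix.SpecialLinearGroup (Fin 2) F →* G := S.subtype.comp
    (e.symm.toMonoidHom.comp (QuotientGroup.mk' (Subgroup.center (Matrix.SpecialLinearGroup (Fin 2) F))))
  have hπd : ∀ s, π s = (e.symm (QuotientGroup.mk s) : S) := fun s => rfl
  have hrange : ∀ x : G, x ∈ S → ∃ s, π s = x := by
    intro x hx
    obtain ⟨s, hs⟩ := QuotientGroup.mk_surjective (e ⟨x, hx⟩)
    exact ⟨s, by rw [hπd, hs, MulEquiv.symm_apply_apply]⟩
  have hπ : ∀ s s', π s = π s' ↔ PSL.Rel s s' := by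
    intro s s'
    rw [← PSL.mk_eq_iff, hπd, hπd, Subtype.coe_inj, e.symm.injective.eq_iff]
  have hnorm : ∀ (x : G) s, ∃ s', π s' = x * π s * x⁻¹ := by
    intro x s
    apply hrange
    exact Subgroup.Normal.conj_mem inferInstance _ (Subtype.mem _) x
  have hcen : ∀ x : G, (∀ s, x * π s = π s * x) → x = 1 := by
    intro x hx
    have h1 : x ∈ Subgroup.centralizer (S : Set G) := by
      rw [Subgroup.mem_centralizer_iff]
      intro y hy
      obtain ⟨s, rfl⟩ := hrange y hy
      exact (hx s).symm
    rw [hcent] at h1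
    exact Subgroup.mem_bot.1 h1
  have hN := PSL.NN_normal f.pos hcard hπ hnorm
  obtain ⟨d0, d, g, hd0, hd, hdf, hg, hgd, hgen⟩ := PSL.exists_d0 f.pos hcard hπ hnorm
  refine main_count (PSL.ax hπ hnorm hcen) hG hp hcard hq hd hdf hgd hgen ?_ ?_
  · intro h2
    subst h2
    exact PSL.Del_top
  · intro h2 hd4 hf4 hL
    subst h2
    have hd1 : d0 = 1 := by
      rw [hd4, hf4] at hdf; omega
    rw [hd1] at hg
    obtain ⟨g', h1, h3⟩ := PSL.exists_frob_elt hg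
    exact Lies.special (PSL.ax hπ hnorm hcen) PSL.Del_top (by rw [hcard, hf4]; norm_num) h1 h3 hL
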